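/- Let k ≥ 3 be an integer and put τ(k) = 1/(4(k−1)(k−2)). Then for every ε > 0, whenever α ∈ ℝ^k and N is a natural number sufficiently large in terms of k and ε, there exists an integer n with 1 ≤ n ≤ N such that ‖ α_1 n + α_2 n² + … + α_k n^k ‖ < N^{ε − τ(k)}. -/

import Mathlib

namespace VMV
open Finset
open scoped ComplexConjugate

/-- additive character attached to an integer vector -/
noncomputable def ch {k M : ℕ} [NeZero M] (ν : Fin k → ℤ) (a : Fin k → ZMod M) : ℂ :=
  ZMod.stdAddChar (∑ j, a j * (ν j : ZMod M))

/-- moment vector -/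
def pw (k : ℕ) (x : ℤ) : Fin k → ℤ := fun j => x ^ ((j : ℕ) + 1)

section
variable {k M : ℕ} [NeZero M]

lemma ch_zero (a : Fin k → ZMod M) : ch 0 a = 1 := by simp [ch]

lemma ch_add (ν μ : Fin k → ℤ) (a : Fin k → ZMod M) : ch (ν + μ) a = ch ν a * ch μ a := by
  simp only [ch, Pi.add_apply, Int.cast_add, mul_add, sum_add_distrib, AddChar.map_add_eq_mul]

lemma norm_ch (ν : Fin k → ℤ) (a : Fin k → ZMod M) : ‖ch ν a‖ = 1 := by
  unfold ch
  rw [ZMod.stdAddChar_apply]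
  exact Circle.norm_coe _

lemma ch_neg (ν : Fin k → ℤ) (a : Fin k → ZMod M) : ch (-ν) a = conj (ch ν a) := by
  have h1 : ch (-ν) a * ch ν a = 1 := by rw [← ch_add]; simp [ch_zero]
  have h2 : conj (ch ν a) * ch ν a = 1 := by
    rw [mul_comm, Complex.mul_conj, Complex.normSq_eq_norm_sq, norm_ch]; simp
  have h3 : ch ν a ≠ 0 := by
    intro h; have := norm_ch ν a; rw [h] at this; simp at this
  exact mul_right_cancel₀ h3 (h1.trans h2.symm)

lemma ch_sum {ι : Type*} (s : Finset ι) (v : ι → Fin k → ℤ) (a : Fin k → ZMod M) :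
    ch (∑ i ∈ s, v i) a = ∏ i ∈ s, ch (v i) a := by
  classical
  induction s using Finset.induction_on with
  | empty => simp [ch_zero]
  | insert i s hi ih => rw [sum_insert hi, prod_insert hi, ch_add, ih]

lemma ch_add_right (ν : Fin k → ℤ) (a b : Fin k → ZMod M) : ch ν (a + b) = ch ν a * ch ν b := by
  simp only [ch, Pi.add_apply, add_mul, sum_add_distrib, AddChar.map_add_eq_mul]

lemma sum_ch_zero (ν : Fin k → ℤ) (h : ∀ j, (ν j : ZMod M) = 0) :
    ∑ a : Fin k → ZMod M, ch ν a = (M : ℂ) ^ k := by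
  simp [ch, h, ZMod.card]

lemma sum_ch_ne (ν : Fin k → ℤ) (h : ∃ j, (ν j : ZMod M) ≠ 0) :
    ∑ a : Fin k → ZMod M, ch ν a = 0 := by
  obtain ⟨j, hj⟩ := h
  have key : ∀ b : Fin k → ZMod M, ch ν b * (∑ a : Fin k → ZMod M, ch ν a) =
      ∑ a : Fin k → ZMod M, ch ν a := by
    intro b
    rw [mul_sum]
    refine Eq.trans ?_ (Equiv.sum_comp (Equiv.addLeft b) (fun a => ch ν a))
    refine sum_congr rfl fun a _ => ?_
    simp [ch_add_right]
  have h1 : ch ν (Pi.single j (1 : ZMod M)) ≠ 1 := by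
    have : ch ν (Pi.single j (1 : ZMod M)) = ZMod.stdAddChar (ν j : ZMod M) := by
      unfold ch; congr 1
      rw [Finset.sum_eq_single j]
      · simp
      · intro i _ hi; simp [Pi.single_eq_of_ne hi]
      · simp
    rw [this]
    intro h
    apply hj
    apply ZMod.injective_stdAddChar
    rw [h, AddChar.map_zero_eq_one]
  have := key (Pi.single j 1)
  by_contra h0
  exact h1 (mul_right_cancel₀ h0 (by rw [this, one_mul]))

/-- exponential sum over a finite set -/
noncomputable def f (A : Finset ℤ) (a : Fin k → ZMod M) : ℂ := ∑ x ∈ A, ch (pw k x) a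

lemma prod_f {ι : Type*} [Fintype ι] [DecidableEq ι] (A : ι → Finset ℤ) (a : Fin k → ZMod M) :
    ∏ i, f (A i) a = ∑ x ∈ Fintype.piFinset A, ch (∑ i, pw k (x i)) a := by
  unfold f
  rw [prod_univ_sum]
  simp only [ch_sum]

/-- no wrap around -/
lemma nowrap {ι : Type*} [Fintype ι] {X : ℕ} (hM : Fintype.card ι * X ^ k < M)
    (x y : ι → ℤ) (hx : ∀ i, 0 ≤ x i ∧ x i ≤ X) (hy : ∀ i, 0 ≤ y i ∧ y i ≤ X)
    (h : ∀ j, (((∑ i, pw k (x i)) - ∑ i, pw k (y i)) j : ZMod M) = 0) :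
    (∑ i, pw k (x i)) = ∑ i, pw k (y i) := by
  have bd : ∀ z : ι → ℤ, (∀ i, 0 ≤ z i ∧ z i ≤ X) → ∀ j : Fin k,
      0 ≤ (∑ i, pw k (z i)) j ∧ (∑ i, pw k (z i)) j ≤ (Fintype.card ι * X ^ k : ℕ) := by
    intro z hz j
    rw [Finset.sum_apply]
    constructor
    · exact sum_nonneg fun i _ => pow_nonneg (hz i).1 _
    · have : ∀ i ∈ (univ : Finset ι), pw k (z i) j ≤ (X : ℤ) ^ k := by
        intro i _
        have hj : (j : ℕ) + 1 ≤ k := j.2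
        rcases Nat.eq_zero_or_pos X with hX | hX
        · have : z i = 0 := by have := hz i; subst hX; simp at this; omega
          simp [pw, this]
        · calc pw k (z i) j ≤ (X : ℤ) ^ ((j : ℕ) + 1) := pow_le_pow_left₀ (hz i).1 (hz i).2 _
            _ ≤ (X : ℤ) ^ k := pow_le_pow_right₀ (by exact_mod_cast hX) hj
      calc _ ≤ ∑ i : ι, (X : ℤ) ^ k := sum_le_sum this
        _ = _ := by simp
  funext j
  have h1 := bd x hx j
  have h2 := bd y hy j
  have h3 := (ZMod.intCast_zmod_eq_zero_iff_dvd _ M).1 (h j)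
  have h4 : (Fintype.card ι * X ^ k : ℕ) < (M : ℤ) := by exact_mod_cast hM
  rw [Pi.sub_apply] at h3
  have := Int.eq_zero_of_abs_lt_dvd h3 (by rw [abs_lt]; constructor <;> linarith)
  linarith

/-- orthogonality -/
lemma orth {ι : Type*} [Fintype ι] [DecidableEq ι] {X : ℕ} (hM : Fintype.card ι * X ^ k < M)
    (A A' : ι → Finset ℤ) (hA : ∀ i, A i ⊆ Icc 0 (X : ℤ)) (hA' : ∀ i, A' i ⊆ Icc 0 (X : ℤ)) :
    ∑ a : Fin k → ZMod M, (∏ i, f (A i) a) * conj (∏ i, f (A' i) a) =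
      (M : ℂ) ^ k * (((Fintype.piFinset A ×ˢ Fintype.piFinset A').filter
        (fun z => ∑ i, pw k (z.1 i) = ∑ i, pw k (z.2 i))).card : ℂ) := by
  have h1 : ∀ a : Fin k → ZMod M, (∏ i, f (A i) a) * conj (∏ i, f (A' i) a) =
      ∑ z ∈ Fintype.piFinset A ×ˢ Fintype.piFinset A',
        ch ((∑ i, pw k (z.1 i)) - ∑ i, pw k (z.2 i)) a := by
    intro a
    rw [prod_f, prod_f, map_sum, sum_mul_sum, sum_product]
    refine sum_congr rfl fun x _ => sum_congr rfl fun y _ => ?_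
    rw [sub_eq_add_neg, ch_add, ch_neg]
  simp_rw [h1]
  rw [sum_comm, card_filter, Nat.cast_sum, mul_sum]
  refine sum_congr rfl fun z hz => ?_
  rw [mem_product, Fintype.mem_piFinset, Fintype.mem_piFinset] at hz
  by_cases h : ∑ i, pw k (z.1 i) = ∑ i, pw k (z.2 i)
  · rw [if_pos h, sum_ch_zero]
    · simp
    · intro j; rw [h]; simp
  · rw [if_neg h, sum_ch_ne]
    · simp
    · by_contra hc
      push Not at hc
      exact h (nowrap hM z.1 z.2 (fun i => by simpa using hA i (hz.1 i))
        (fun i => by simpa using hA' i (hz.2 i)) hc)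

/-- normalized average -/
noncomputable def E (g : (Fin k → ZMod M) → ℝ) : ℝ := (∑ a, g a) / (M : ℝ) ^ k

lemma Mpos : (0 : ℝ) < (M : ℝ) ^ k := by
  have : 0 < M := Nat.pos_of_ne_zero (NeZero.ne M)
  positivity

lemma E_nonneg {g : (Fin k → ZMod M) → ℝ} (h : ∀ a, 0 ≤ g a) : 0 ≤ E g :=
  div_nonneg (sum_nonneg fun a _ => h a) Mpos.le

lemma E_mono {g g' : (Fin k → ZMod M) → ℝ} (h : ∀ a, g a ≤ g' a) : E g ≤ E g' :=
  div_le_div_of_nonneg_right (sum_le_sum fun a _ => h a) Mpos.le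

lemma E_add (g g' : (Fin k → ZMod M) → ℝ) : E (fun a => g a + g' a) = E g + E g' := by
  simp [E, sum_add_distrib, add_div]

lemma E_const_mul (c : ℝ) (g : (Fin k → ZMod M) → ℝ) : E (fun a => c * g a) = c * E g := by
  simp [E, ← mul_sum, mul_div_assoc]

lemma E_sum {ι : Type*} (s : Finset ι) (g : ι → (Fin k → ZMod M) → ℝ) :
    E (fun a => ∑ i ∈ s, g i a) = ∑ i ∈ s, E (g i) := by
  simp only [E]
  rw [sum_comm, sum_div]

/-- Hölder -/
lemma E_holder {g h : (Fin k → ZMod M) → ℝ} (hg : ∀ a, 0 ≤ g a) (hh : ∀ a, 0 ≤ h a)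
    {θ φ : ℝ} (hθ : 0 < θ) (hφ : 0 < φ) (hs : θ + φ = 1) :
    E (fun a => g a ^ θ * h a ^ φ) ≤ E g ^ θ * E h ^ φ := by
  have hpq : Real.HolderConjugate (1 / θ) (1 / φ) := by
    rw [Real.holderConjugate_iff]
    constructor
    · rw [lt_div_iff₀ hθ]; linarith
    · simp [hs]
  have := Real.inner_le_Lp_mul_Lq_of_nonneg (univ : Finset (Fin k → ZMod M)) hpq
    (f := fun a => g a ^ θ) (g := fun a => h a ^ φ)
    (fun a _ => Real.rpow_nonneg (hg a) _) (fun a _ => Real.rpow_nonneg (hh a) _)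
  have e1 : ∀ a, (g a ^ θ) ^ (1 / θ) = g a := fun a => by
    rw [← Real.rpow_mul (hg a), mul_one_div_cancel hθ.ne', Real.rpow_one]
  have e2 : ∀ a, (h a ^ φ) ^ (1 / φ) = h a := fun a => by
    rw [← Real.rpow_mul (hh a), mul_one_div_cancel hφ.ne', Real.rpow_one]
  simp only [e1, e2, one_div, inv_inv] at this
  unfold E
  rw [Real.div_rpow (sum_nonneg fun a _ => hg a) Mpos.le,
    Real.div_rpow (sum_nonneg fun a _ => hh a) Mpos.le, div_mul_div_comm,
    ← Real.rpow_add Mpos, hs, Real.rpow_one]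
  have e1 : ∀ a, (g a ^ θ) ^ (θ⁻¹) = g a := fun a => by
    rw [← Real.rpow_mul (hg a), mul_inv_cancel₀ hθ.ne', Real.rpow_one]
  have e2 : ∀ a, (h a ^ φ) ^ (φ⁻¹) = h a := fun a => by
    rw [← Real.rpow_mul (hh a), mul_inv_cancel₀ hφ.ne', Real.rpow_one]
  simp only [e1, e2] at this
  exact div_le_div_of_nonneg_right this Mpos.le

end

/-- number of solutions -/
noncomputable def Js (k t : ℕ) (A : Finset ℤ) : ℕ :=
  (((Fintype.piFinset fun _ : Fin t => A) ×ˢ (Fintype.piFinset fun _ : Fin t => A)).filter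
    (fun z => ∑ i, pw k (z.1 i) = ∑ i, pw k (z.2 i))).card

section
variable {k M : ℕ} [NeZero M]

lemma E_eq_Js {t X : ℕ} (hM : t * X ^ k < M) (A : Finset ℤ) (hA : A ⊆ Icc 0 (X : ℤ)) :
    E (fun a : Fin k → ZMod M => ‖f A a‖ ^ (2 * t)) = Js k t A := by
  have h := orth (k := k) (M := M) (ι := Fin t) (X := X) (by simpa using hM) (fun _ => A)
    (fun _ => A) (fun _ => hA) (fun _ => hA)
  have h2 : ∀ a : Fin k → ZMod M, (∏ _i : Fin t, f A a) * conj (∏ _i : Fin t, f A a) =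
      ((‖f A a‖ ^ (2 * t) : ℝ) : ℂ) := by
    intro a
    rw [Complex.mul_conj, Complex.normSq_eq_norm_sq]
    simp only [prod_const, card_univ, Fintype.card_fin, norm_pow]
    rw [← pow_mul, mul_comm t 2]
  simp only [h2] at h
  unfold E Js
  rw [div_eq_iff Mpos.ne']
  refine Eq.trans ?_ (mul_comm _ _)
  exact_mod_cast h

/-- vanishing of mixed averages -/
lemma orth_zero {ι : Type*} [Fintype ι] [DecidableEq ι] {X : ℕ} (hM : Fintype.card ι * X ^ k < M)
    (A A' : ι → Finset ℤ) (hA : ∀ i, A i ⊆ Icc 0 (X : ℤ)) (hA' : ∀ i, A' i ⊆ Icc 0 (X : ℤ))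
    (hno : ∀ x ∈ Fintype.piFinset A, ∀ y ∈ Fintype.piFinset A',
      ∑ i, pw k (x i) ≠ ∑ i, pw k (y i)) :
    ∑ a : Fin k → ZMod M, (∏ i, f (A i) a) * conj (∏ i, f (A' i) a) = 0 := by
  rw [orth hM A A' hA hA', Finset.filter_eq_empty_iff.2]
  · simp
  · intro z hz
    rw [mem_product] at hz
    exact hno _ hz.1 _ hz.2

/-- splitting a square with vanishing cross terms -/
lemma fiber_bound {Z T : Type*} [DecidableEq T] (S : Finset Z) (F : Z → (Fin k → ZMod M) → ℂ)
    (W : (Fin k → ZMod M) → ℝ) (hW : ∀ a, 0 ≤ W a) (μ : Z → T) (B : ℕ)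
    (hB : ∀ z ∈ S, (S.filter fun w => μ w = μ z).card ≤ B)
    (h0 : ∀ z ∈ S, ∀ w ∈ S, μ z ≠ μ w → ∑ a, F z a * conj (F w a) * (W a : ℂ) = 0) :
    E (fun a => ‖∑ z ∈ S, F z a‖ ^ 2 * W a) ≤ B * ∑ z ∈ S, E (fun a => ‖F z a‖ ^ 2 * W a) := by
  unfold E
  rw [← sum_div, mul_div_assoc']
  apply div_le_div_of_nonneg_right _ Mpos.le
  have e1 : ((∑ a, ‖∑ z ∈ S, F z a‖ ^ 2 * W a : ℝ) : ℂ) =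
      ∑ z ∈ S, ∑ w ∈ S, ∑ a, F z a * conj (F w a) * (W a : ℂ) := by
    push_cast
    have : ∀ a, ((‖∑ z ∈ S, F z a‖ : ℂ)) ^ 2 * (W a : ℂ) =
        ∑ z ∈ S, ∑ w ∈ S, F z a * conj (F w a) * (W a : ℂ) := by
      intro a
      rw [← Complex.mul_conj', map_sum, sum_mul_sum, sum_mul]
      simp_rw [sum_mul]
    simp_rw [this]
    rw [sum_comm]
    refine sum_congr rfl fun z _ => ?_
    rw [sum_comm]
  set Q : Z → ℝ := fun z => ∑ a, ‖F z a‖ ^ 2 * W a with hQ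
  have e2 : ∀ z ∈ S, ∀ w ∈ S, ‖∑ a, F z a * conj (F w a) * (W a : ℂ)‖ ≤
      if μ w = μ z then (Q z + Q w) / 2 else 0 := by
    intro z hz w hw
    split_ifs with h
    · calc _ ≤ ∑ a, ‖F z a * conj (F w a) * (W a : ℂ)‖ := norm_sum_le _ _
        _ ≤ ∑ a, (‖F z a‖ ^ 2 * W a + ‖F w a‖ ^ 2 * W a) / 2 := by
          refine sum_le_sum fun a _ => ?_
          rw [norm_mul, norm_mul, RCLike.norm_conj, Complex.norm_real, Real.norm_eq_abs,
            abs_of_nonneg (hW a)]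
          nlinarith [mul_nonneg (sq_nonneg (‖F z a‖ - ‖F w a‖)) (hW a)]
        _ = _ := by rw [← sum_div, sum_add_distrib]
    · rw [h0 z hz w hw (fun h' => h h'.symm)]; simp
  have hQ0 : ∀ z, 0 ≤ Q z := fun z => sum_nonneg fun a _ => mul_nonneg (by positivity) (hW a)
  have e3 : ∑ a, ‖∑ z ∈ S, F z a‖ ^ 2 * W a ≤
      ∑ z ∈ S, ∑ w ∈ S, if μ w = μ z then (Q z + Q w) / 2 else 0 := by
    calc _ ≤ ‖((∑ a, ‖∑ z ∈ S, F z a‖ ^ 2 * W a : ℝ) : ℂ)‖ := by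
          rw [Complex.norm_real]; exact le_abs_self _
      _ ≤ _ := by
          rw [e1]
          refine (norm_sum_le _ _).trans (sum_le_sum fun z hz => ?_)
          exact (norm_sum_le _ _).trans (sum_le_sum fun w hw => e2 z hz w hw)
  have e4 : ∑ z ∈ S, ∑ w ∈ S, (if μ w = μ z then (Q z + Q w) / 2 else 0) =
      ∑ z ∈ S, ∑ w ∈ S, (if μ w = μ z then Q z else 0) := by
    have s1 : ∑ z ∈ S, ∑ w ∈ S, (if μ w = μ z then Q w else 0) =
        ∑ z ∈ S, ∑ w ∈ S, (if μ w = μ z then Q z else 0) := by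
      rw [sum_comm]
      refine sum_congr rfl fun z _ => sum_congr rfl fun w _ => ?_
      simp only [eq_comm]
    have s2 : ∀ z w, (if μ w = μ z then (Q z + Q w) / 2 else 0) =
        (if μ w = μ z then Q z else 0) / 2 + (if μ w = μ z then Q w else 0) / 2 := by
      intro z w; split_ifs <;> ring
    simp_rw [s2, sum_add_distrib, ← sum_div]
    rw [s1]; ring
  rw [e4] at e3
  refine e3.trans ?_
  rw [mul_sum]
  refine sum_le_sum fun z hz => ?_
  rw [← sum_filter, sum_const, nsmul_eq_mul]
  exact mul_le_mul_of_nonneg_right (by exact_mod_cast hB z hz) (hQ0 z)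

end

/-- polynomial consequences of equal power sums -/
lemma poly_sum {ι : Type*} [Fintype ι] {k : ℕ} (x y : ι → ℤ)
    (h : ∑ i, pw k (x i) = ∑ i, pw k (y i)) (Q : Polynomial ℤ) (hQ : Q.natDegree ≤ k) :
    ∑ i, Q.eval (x i) = ∑ i, Q.eval (y i) := by
  simp_rw [Polynomial.eval_eq_sum_range' (Nat.lt_succ_of_le hQ)]
  rw [sum_comm, sum_comm (s := univ) (f := fun i j => Q.coeff j * y i ^ j)]
  refine sum_congr rfl fun j hj => ?_
  rw [← mul_sum, ← mul_sum]
  congr 1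
  rcases j with _ | j
  · simp
  · have hj' : j < k := by simpa using hj
    have := congrFun h ⟨j, hj'⟩
    simpa [Finset.sum_apply, pw] using this

lemma shift_sum {ι : Type*} [Fintype ι] {k : ℕ} (x y : ι → ℤ)
    (h : ∑ i, pw k (x i) = ∑ i, pw k (y i)) (e : ℤ) (j : ℕ) (hj : j ≤ k) :
    ∑ i, (x i + e) ^ j = ∑ i, (y i + e) ^ j := by
  have := poly_sum x y h ((Polynomial.X + Polynomial.C e) ^ j)
    (by rw [Polynomial.natDegree_pow, Polynomial.natDegree_X_add_C]; simpa using hj)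
  simpa using this

/-- residue class in an interval -/
noncomputable def cls (X : ℕ) (q η : ℤ) : Finset ℤ := (Icc (1 : ℤ) X).filter fun x => q ∣ x - η

lemma cls_sub (X : ℕ) (q η : ℤ) : cls X q η ⊆ Icc 0 (X : ℤ) := by
  intro x hx
  simp only [cls, mem_filter, mem_Icc] at hx ⊢
  omega

lemma Js_cls_le (k t X : ℕ) (q : ℕ) (hq : 0 < q) (η : ℤ) :
    Js k t (cls X q η) ≤ Js k t (Icc 1 ((X / q + 1 : ℕ) : ℤ)) := by
  have hq' : (0 : ℤ) < q := by exact_mod_cast hq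
  have key : ∀ x ∈ cls X q η, x = η % q + q * (x / q) ∧
      x / q + 1 ∈ Icc (1 : ℤ) ((X / q + 1 : ℕ) : ℤ) := by
    intro x hx
    simp only [cls, mem_filter, mem_Icc] at hx
    have h1 : x % q = η % q := ((Int.modEq_iff_dvd).2 hx.2).symm
    refine ⟨?_, ?_⟩
    · rw [← h1]; exact (Int.emod_add_mul_ediv x q).symm
    · rw [mem_Icc]
      have h2 : 0 ≤ x / q := Int.ediv_nonneg (by omega) hq'.le
      have h3 : x / q ≤ (X : ℤ) / q := Int.ediv_le_ediv hq' hx.1.2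
      push_cast
      omega
  unfold Js
  refine card_le_card_of_injOn
    (fun z => (fun i => z.1 i / q + 1, fun i => z.2 i / q + 1)) ?_ ?_
  · intro z hz
    simp only [coe_filter, Set.mem_setOf_eq, mem_product, Fintype.mem_piFinset] at hz ⊢
    refine ⟨⟨fun i => (key _ (hz.1.1 i)).2, fun i => (key _ (hz.1.2 i)).2⟩, ?_⟩
    funext j
    have h := shift_sum z.1 z.2 hz.2 (q - η % q) ((j : ℕ) + 1) j.2
    have e : ∀ x ∈ cls X q η, x + (q - η % q) = q * (x / q + 1) := by
      intro x hx
      have := (key x hx).1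
      linear_combination this
    have h1 : ∀ i, (z.1 i + (q - η % q)) ^ ((j : ℕ) + 1) =
        (q : ℤ) ^ ((j : ℕ) + 1) * (z.1 i / q + 1) ^ ((j : ℕ) + 1) := fun i => by
      rw [e _ (hz.1.1 i), mul_pow]
    have h2 : ∀ i, (z.2 i + (q - η % q)) ^ ((j : ℕ) + 1) =
        (q : ℤ) ^ ((j : ℕ) + 1) * (z.2 i / q + 1) ^ ((j : ℕ) + 1) := fun i => by
      rw [e _ (hz.1.2 i), mul_pow]
    simp_rw [h1, h2, ← mul_sum] at h
    simp only [Finset.sum_apply, pw]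
    exact mul_left_cancel₀ (pow_ne_zero _ hq'.ne') h
  · intro z hz w hw hzw
    simp only [coe_filter, Set.mem_setOf_eq, mem_product, Fintype.mem_piFinset] at hz hw
    simp only [Prod.mk.injEq] at hzw
    refine Prod.ext ?_ ?_
    · funext i
      have := congrFun hzw.1 i
      rw [(key _ (hz.1.1 i)).1, (key _ (hw.1.1 i)).1, add_right_cancel this]
    · funext i
      have := congrFun hzw.2 i
      rw [(key _ (hz.1.2 i)).1, (key _ (hw.1.2 i)).1, add_right_cancel this]

end VMV


namespace VMV
open Finset

/-- integral antiderivative of `k! g` -/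
noncomputable def anti (k : ℕ) (g : Polynomial ℤ) : Polynomial ℤ :=
  ∑ j ∈ range k, Polynomial.C (((k.factorial / (j + 1) : ℕ) : ℤ) * g.coeff j) * Polynomial.X ^ (j + 1)

lemma anti_deriv (k : ℕ) (g : Polynomial ℤ) (hg : g.natDegree < k) :
    (anti k g).derivative = Polynomial.C (k.factorial : ℤ) * g := by
  conv_rhs => rw [g.as_sum_range' k hg, mul_sum]
  unfold anti
  rw [Polynomial.derivative_sum]
  refine sum_congr rfl fun j hj => ?_
  have hd : (j + 1) ∣ k.factorial := Nat.dvd_factorial (by omega) (by simpa using hj)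
  have : (k.factorial : ℤ) = ((k.factorial / (j + 1) : ℕ) : ℤ) * ((j : ℤ) + 1) := by
    have := Nat.div_mul_cancel hd
    exact_mod_cast this.symm
  rw [Polynomial.derivative_C_mul_X_pow, ← Polynomial.C_mul_X_pow_eq_monomial, ← mul_assoc,
    ← Polynomial.C_mul, this]
  congr 2
  push_cast
  ring

lemma anti_eval (k : ℕ) (g : Polynomial ℤ) (x : ℤ) :
    (anti k g).eval x = ∑ j ∈ range k, ((k.factorial / (j + 1) : ℕ) : ℤ) * g.coeff j * x ^ (j + 1) := by
  unfold anti
  rw [Polynomial.eval_finset_sum]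
  simp

/-- triangular systems modulo p -/
lemma tri_zero {r : ℕ} {p : ℤ} (hp : Prime p) (A : Fin r → Fin r → ℤ) (d : Fin r → ℤ)
    (h0 : ∀ l i, i < l → p ∣ A l i) (h1 : ∀ l, ¬ p ∣ A l l)
    (h : ∀ l, p ∣ ∑ i, d i * A l i) : ∀ l, p ∣ d l := by
  by_contra hc
  push Not at hc
  have hne : (univ.filter fun l => ¬ p ∣ d l).Nonempty := by
    obtain ⟨l, hl⟩ := hc
    exact ⟨l, by simp [hl]⟩
  obtain ⟨l, hl, hmax⟩ := exists_max_image _ id hne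
  simp only [mem_filter, mem_univ, true_and, id] at hl hmax
  have h2 := h l
  rw [← add_sum_erase _ _ (mem_univ l)] at h2
  have h3 : p ∣ ∑ i ∈ univ.erase l, d i * A l i := by
    refine dvd_sum fun i hi => ?_
    rcases lt_or_gt_of_ne (ne_of_mem_erase hi) with hlt | hgt
    · exact (h0 l i hlt).mul_left _
    · have : p ∣ d i := by
        by_contra hd
        exact absurd (hmax i hd) (not_le.2 hgt)
      exact this.mul_right _
  have h4 := (dvd_add_left h3).1 h2
  rcases hp.dvd_or_dvd h4 with h | h
  · exact hl h
  · exact h1 l h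

lemma hensel_core {r k : ℕ} {p : ℕ} (hp : p.Prime) (hpk : k < p) (c0 w : ℤ) (s : Fin r → ℤ)
    (Q : Fin r → Polynomial ℤ)
    (hQ : ∀ l, (Q l).derivative = Polynomial.C (k.factorial : ℤ) *
      ((Polynomial.C c0 + Polynomial.C w * Polynomial.X) *
        ∏ m ∈ univ.filter (· < l), (Polynomial.X - Polynomial.C (s m))))
    (hc : ∀ i, ¬ (p : ℤ) ∣ c0 + w * s i) (hs : ∀ i m, i ≠ m → ¬ (p : ℤ) ∣ s i - s m)
    (S S' : Fin r → ℤ) (hS : ∀ i, (p : ℤ) ∣ S i - s i) (hS' : ∀ i, (p : ℤ) ∣ S' i - s i)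
    (n : ℕ) (h : ∀ l, (p : ℤ) ^ n ∣ ∑ i, ((Q l).eval (S i) - (Q l).eval (S' i))) :
    ∀ i, (p : ℤ) ^ n ∣ S i - S' i := by
  have hpp : Prime (p : ℤ) := Nat.prime_iff_prime_int.1 hp
  have hp0 : (p : ℤ) ≠ 0 := hpp.ne_zero
  have hfac : ¬ (p : ℤ) ∣ (k.factorial : ℤ) := by
    intro hd
    have : p ∣ k.factorial := by exact_mod_cast hd
    exact absurd ((hp.dvd_factorial).1 this) (by omega)
  have main : ∀ e : ℕ, e + 1 ≤ n → ∀ i, (p : ℤ) ^ (e + 1) ∣ S i - S' i := by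
    intro e
    induction e with
    | zero => intro _ i; simpa using dvd_sub (hS i) (hS' i)
    | succ e ih =>
      intro hen
      have ih' := ih (by omega)
      choose d hd using ih'
      have hdd : ∀ l, (p : ℤ) ∣ d l := by
        refine tri_zero hpp (fun l i => (k.factorial : ℤ) * ((c0 + w * s i) *
          ∏ m ∈ univ.filter (· < l), (s i - s m))) d ?_ ?_ ?_
        · intro l i hil
          refine Dvd.dvd.mul_left (Dvd.dvd.mul_left ?_ _) _
          rw [prod_eq_zero (i := i) (by simpa using hil) (by simp)]
          exact dvd_zero _
        · intro l hd
          rcases hpp.dvd_or_dvd hd with hd | hd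
          · exact hfac hd
          rcases hpp.dvd_or_dvd hd with hd | hd
          · exact hc l hd
          rw [hpp.dvd_finset_prod_iff] at hd
          obtain ⟨m, hm, hd⟩ := hd
          exact hs l m (by simp at hm; exact hm.ne') hd
        · intro l
          have h1 := (pow_dvd_pow (p : ℤ) hen).trans (h l)
          have h2 : (p : ℤ) ^ (e + 1 + 1) ∣ ∑ i, (p : ℤ) ^ (e + 1) * (d i * (Q l).derivative.eval (S' i)) := by
            have : ∀ i, ∃ z, (Q l).eval (S i) - (Q l).eval (S' i) =
                (p : ℤ) ^ (e + 1) * (d i * (Q l).derivative.eval (S' i)) + (p : ℤ) ^ (e + 1 + 1) * z := by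
              intro i
              obtain ⟨z, hz⟩ := Polynomial.binomExpansion (Q l) (S' i) ((p : ℤ) ^ (e + 1) * d i)
              rw [← hd, add_sub_cancel] at hz
              refine ⟨z * d i ^ 2 * (p : ℤ) ^ e, ?_⟩
              rw [hz, hd]
              ring
            choose z hz using this
            rw [sum_congr rfl fun i _ => hz i, sum_add_distrib, ← mul_sum (a := (p : ℤ) ^ (e + 1 + 1))] at h1
            exact (dvd_add_left (dvd_mul_right _ _)).1 h1
          rw [← mul_sum, pow_succ] at h2
          have h3 := (mul_dvd_mul_iff_left (pow_ne_zero _ hp0)).1 h2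
          have h4 : (p : ℤ) ∣ ∑ i, (d i * (Q l).derivative.eval (s i) - d i * (Q l).derivative.eval (S' i)) := by
            refine dvd_sum fun i _ => ?_
            rw [← mul_sub]
            refine Dvd.dvd.mul_left ?_ _
            have := Polynomial.sub_dvd_eval_sub (s i) (S' i) (Q l).derivative
            exact (by rw [← dvd_neg, neg_sub]; exact hS' i : (p : ℤ) ∣ s i - S' i).trans this
          rw [sum_sub_distrib] at h4
          have h5 := dvd_add h4 h3
          rw [sub_add_cancel] at h5
          have h6 : ∀ i, (Q l).derivative.eval (s i) = (k.factorial : ℤ) * ((c0 + w * s i) *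
              ∏ m ∈ univ.filter (· < l), (s i - s m)) := by
            intro i
            rw [hQ]
            simp [Polynomial.eval_prod]
          simp_rw [h6] at h5
          exact h5
      intro i
      rw [hd, pow_succ _ (e + 1)]
      exact mul_dvd_mul_left _ (hdd i)
  intro i
  rcases n with _ | n
  · simp
  · exact main n le_rfl i

/-- the polynomials whose antiderivatives are used -/
noncomputable def gg {r : ℕ} (c : Fin r → ℤ) (l : Fin r) : Polynomial ℤ :=
  Polynomial.X * ∏ m ∈ univ.filter (· < l), (Polynomial.X - Polynomial.C (c m))

lemma fin_card_lt {r : ℕ} (l : Fin r) : (univ.filter (· < l)).card = (l : ℕ) := by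
  rw [Finset.filter_gt_eq_Iio, Fin.card_Iio]

lemma gg_deg {r : ℕ} (c : Fin r → ℤ) (l : Fin r) : (gg c l).natDegree < r + 1 := by
  unfold gg
  refine lt_of_le_of_lt Polynomial.natDegree_mul_le ?_
  rw [Polynomial.natDegree_X, Polynomial.natDegree_prod_of_monic _ _ (fun m _ => Polynomial.monic_X_sub_C _)]
  simp only [Polynomial.natDegree_X_sub_C, sum_const, smul_eq_mul, mul_one, fin_card_lt]
  omega

lemma gg_coeff_zero {r : ℕ} (c : Fin r → ℤ) (l : Fin r) : (gg c l).coeff 0 = 0 := by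
  unfold gg; simp

lemma mod_code {x y m n : ℤ} (h1 : x % m = y % m) (h2 : (x / m) % n = (y / m) % n) :
    m * n ∣ x - y := by
  have e1 := Int.emod_add_mul_ediv x m
  have e2 := Int.emod_add_mul_ediv y m
  have : x - y = m * (x / m - y / m) := by linear_combination h1 - e1 + e2
  rw [this]
  exact mul_dvd_mul_left _ (Int.ModEq.dvd h2.symm)

lemma anti_comp {r : ℕ} (c0 w : ℤ) (s c : Fin r → ℤ) (hc : ∀ i, c i = c0 + w * s i) (l : Fin r)
    (S S' : ℤ) :
    (anti (r + 1) (gg c l)).eval (c0 + w * S) - (anti (r + 1) (gg c l)).eval (c0 + w * S') =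
    w ^ ((l : ℕ) + 1) * ((anti (r + 1) ((Polynomial.C c0 + Polynomial.C w * Polynomial.X) *
        ∏ m ∈ univ.filter (· < l), (Polynomial.X - Polynomial.C (s m)))).eval S -
      (anti (r + 1) ((Polynomial.C c0 + Polynomial.C w * Polynomial.X) *
        ∏ m ∈ univ.filter (· < l), (Polynomial.X - Polynomial.C (s m)))).eval S') ∧
    (anti (r + 1) ((Polynomial.C c0 + Polynomial.C w * Polynomial.X) *
        ∏ m ∈ univ.filter (· < l), (Polynomial.X - Polynomial.C (s m)))).derivative =
      Polynomial.C ((r + 1).factorial : ℤ) * ((Polynomial.C c0 + Polynomial.C w * Polynomial.X) *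
        ∏ m ∈ univ.filter (· < l), (Polynomial.X - Polynomial.C (s m))) := by
  set g2 := (Polynomial.C c0 + Polynomial.C w * Polynomial.X) *
        ∏ m ∈ univ.filter (· < l), (Polynomial.X - Polynomial.C (s m)) with hg2
  have hdeg : g2.natDegree < r + 1 := by
    rw [hg2]
    refine lt_of_le_of_lt Polynomial.natDegree_mul_le ?_
    rw [Polynomial.natDegree_prod_of_monic _ _ (fun m _ => Polynomial.monic_X_sub_C _)]
    simp only [Polynomial.natDegree_X_sub_C, sum_const, smul_eq_mul, mul_one, fin_card_lt]
    have : (Polynomial.C c0 + Polynomial.C w * Polynomial.X).natDegree ≤ 1 := by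
      compute_degree
    omega
  have hd2 := anti_deriv (r + 1) g2 hdeg
  refine ⟨?_, hd2⟩
  have hd1 := anti_deriv (r + 1) (gg c l) (gg_deg c l)
  set q : Polynomial ℤ := Polynomial.C c0 + Polynomial.C w * Polynomial.X with hq
  set R := (anti (r + 1) (gg c l)).comp q - Polynomial.C (w ^ ((l : ℕ) + 1)) * anti (r + 1) g2 with hR
  have hR0 : R.derivative = 0 := by
    rw [hR, Polynomial.derivative_sub, Polynomial.derivative_comp, hd1, Polynomial.derivative_C_mul, hd2]
    have e1 : (Polynomial.C ((r + 1).factorial : ℤ) * gg c l).comp q =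
        Polynomial.C ((r + 1).factorial : ℤ) * (q * (Polynomial.C w ^ (l : ℕ) *
          ∏ m ∈ univ.filter (· < l), (Polynomial.X - Polynomial.C (s m)))) := by
      unfold gg
      rw [Polynomial.mul_comp, Polynomial.mul_comp, Polynomial.C_comp, Polynomial.X_comp,
        Polynomial.prod_comp]
      congr 2
      rw [← fin_card_lt l, ← prod_const, ← prod_mul_distrib]
      refine prod_congr (by simp [fin_card_lt]) fun m _ => ?_
      rw [Polynomial.sub_comp, Polynomial.X_comp, Polynomial.C_comp, hc m, hq]
      simp only [Polynomial.C_add, Polynomial.C_mul]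
      ring
    have e2 : q.derivative = Polynomial.C w := by rw [hq]; simp
    rw [e1, e2, hg2, Polynomial.C_pow]
    ring
  have h1 := Polynomial.eq_C_of_natDegree_eq_zero (Polynomial.natDegree_eq_zero_of_derivative_eq_zero hR0)
  have h2 : R.eval S = R.eval S' := by rw [h1]; simp
  rw [hR] at h2
  simp only [Polynomial.eval_sub, Polynomial.eval_comp, Polynomial.eval_mul, Polynomial.eval_C, hq,
    Polynomial.eval_add, Polynomial.eval_X] at h2
  linear_combination h2

/-- the residue vector -/
def muv {r : ℕ} (k p b : ℕ) (η : ℤ) (ζ : Fin r → ℤ) : Fin k → ℤ :=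
  fun j => (∑ l, (ζ l - η) ^ ((j : ℕ) + 1)) % (p : ℤ) ^ (((j : ℕ) + 1) * b)

/-- lifts -/
noncomputable def Zs {r : ℕ} (p A c : ℕ) (ξ : Fin r → ℤ) : Finset (Fin r → ℤ) :=
  Fintype.piFinset fun l => (Ico (0 : ℤ) ((p : ℤ) ^ A)).filter fun z => (p : ℤ) ^ c ∣ z - ξ l

lemma hensel_inj {r p a b : ℕ} (hp : p.Prime) (hpk : r + 1 < p) (hab : a < b) (η : ℤ) (ξ : Fin r → ℤ)
    (h1 : ∀ l m, (p : ℤ) ^ a ∣ ξ l - ξ m) (h2 : ∀ l m, l ≠ m → ¬ (p : ℤ) ^ (a + 1) ∣ ξ l - ξ m)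
    (h3 : ∀ l, ¬ (p : ℤ) ∣ ξ l - η) (z w : Fin r → ℤ)
    (hz : z ∈ Zs p ((r + 1) * b) (a + 1) ξ) (hw : w ∈ Zs p ((r + 1) * b) (a + 1) ξ)
    (h : ∀ l : Fin r, (p : ℤ) ^ ((r + 1) * b) * (p : ℤ) ^ ((l : ℕ) * a) ∣
      (∑ i, (anti (r + 1) (gg (fun m => ξ m - η) l)).eval (z i - η)) -
      (∑ i, (anti (r + 1) (gg (fun m => ξ m - η) l)).eval (w i - η))) : z = w := by
  have hp0 : (p : ℤ) ≠ 0 := by exact_mod_cast hp.ne_zero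
  rcases Nat.eq_zero_or_pos r with hr | hr
  · subst hr; exact Subsingleton.elim _ _
  simp only [Zs, Fintype.mem_piFinset, mem_filter, mem_Ico] at hz hw
  set c0 := ξ ⟨0, hr⟩ - η with hc0
  choose s hs using fun i => h1 i ⟨0, hr⟩
  have hc : ∀ i, ξ i - η = c0 + (p : ℤ) ^ a * s i := fun i => by rw [← hs i, hc0]; ring
  choose z' hz' using fun i => (hz i).2
  choose w' hw' using fun i => (hw i).2
  have ez : ∀ i, z i - η = c0 + (p : ℤ) ^ a * (s i + p * z' i) := fun i => by
    have := hz' i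
    have := hc i
    rw [pow_succ] at *
    linear_combination hz' i + hc i
  have ew : ∀ i, w i - η = c0 + (p : ℤ) ^ a * (s i + p * w' i) := fun i => by
    have := hw' i
    rw [pow_succ] at *
    linear_combination hw' i + hc i
  have hle : a ≤ (r + 1) * b := by nlinarith
  have key := hensel_core hp hpk c0 ((p : ℤ) ^ a) s
    (fun l => anti (r + 1) ((Polynomial.C c0 + Polynomial.C ((p : ℤ) ^ a) * Polynomial.X) *
        ∏ m ∈ univ.filter (· < l), (Polynomial.X - Polynomial.C (s m))))
    (fun l => (anti_comp c0 ((p : ℤ) ^ a) s (fun m => ξ m - η) hc l 0 0).2)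
    (fun i => by rw [← hc i]; exact h3 i)
    (fun i m him hd => h2 i m him (by
      have : ξ i - ξ m = (p : ℤ) ^ a * (s i - s m) := by linear_combination hc i - hc m
      rw [this, pow_succ]
      exact mul_dvd_mul_left _ hd))
    (fun i => s i + p * z' i) (fun i => s i + p * w' i) (fun i => by simp) (fun i => by simp)
    ((r + 1) * b - a) (by
      intro l
      have hl := h l
      simp_rw [ez, ew] at hl
      rw [← sum_sub_distrib] at hl
      simp_rw [fun i => (anti_comp c0 ((p : ℤ) ^ a) s (fun m => ξ m - η) hc l
        (s i + p * z' i) (s i + p * w' i)).1] at hl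
      rw [← mul_sum] at hl
      have e : (p : ℤ) ^ ((r + 1) * b) * (p : ℤ) ^ ((l : ℕ) * a) =
        ((p : ℤ) ^ a) ^ ((l : ℕ) + 1) * (p : ℤ) ^ ((r + 1) * b - a) := by
        rw [← pow_add, ← pow_mul, ← pow_add]
        congr 1
        have : a * ((l : ℕ) + 1) = (l : ℕ) * a + a := by ring
        omega
      rw [e] at hl
      exact (mul_dvd_mul_iff_left (pow_ne_zero _ (pow_ne_zero _ hp0))).1 hl)
  funext i
  have hd : (p : ℤ) ^ ((r + 1) * b) ∣ z i - w i := by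
    have := mul_dvd_mul_left ((p : ℤ) ^ a) (key i)
    rw [← pow_add, Nat.add_sub_cancel' hle] at this
    refine this.trans (dvd_of_eq ?_)
    linear_combination ew i - ez i
  have := Int.eq_zero_of_abs_lt_dvd hd (by
    rw [abs_lt]; constructor <;> linarith [(hz i).1.1, (hz i).1.2, (hw i).1.1, (hw i).1.2])
  linarith

lemma fiber_count {r p a b : ℕ} (hp : p.Prime) (hpk : r + 1 < p) (hab : a < b) (η : ℤ) (ξ : Fin r → ℤ)
    (h1 : ∀ l m, (p : ℤ) ^ a ∣ ξ l - ξ m) (h2 : ∀ l m, l ≠ m → ¬ (p : ℤ) ^ (a + 1) ∣ ξ l - ξ m)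
    (h3 : ∀ l, ¬ (p : ℤ) ∣ ξ l - η) (z : Fin r → ℤ) :
    ((Zs p ((r + 1) * b) (a + 1) ξ).filter fun w => muv (r + 1) p b η w = muv (r + 1) p b η z).card
      ≤ p ^ (r * (r - 1) / 2 * (a + b)) := by
  have hp0 : (0 : ℤ) < p := by exact_mod_cast hp.pos
  set Φ : (Fin r → ℤ) → Fin r → ℤ := fun w l =>
    ∑ i, (anti (r + 1) (gg (fun m => ξ m - η) l)).eval (w i - η) with hΦ
  set σ : (Fin r → ℤ) → ℕ → ℤ := fun w j => ∑ i, (w i - η) ^ j with hσ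
  set T : Finset (Fin r → ℤ × ℤ) := Fintype.piFinset fun i : Fin r =>
    Ico (0 : ℤ) ((p : ℤ) ^ ((r - 1 - i) * b)) ×ˢ Ico (0 : ℤ) ((p : ℤ) ^ ((i : ℕ) * a)) with hT
  have hTcard : T.card = p ^ (r * (r - 1) / 2 * (a + b)) := by
    rw [hT, Fintype.card_piFinset]
    have e : ∀ i : Fin r, (Ico (0 : ℤ) ((p : ℤ) ^ ((r - 1 - i) * b)) ×ˢ
        Ico (0 : ℤ) ((p : ℤ) ^ ((i : ℕ) * a))).card = p ^ ((r - 1 - i) * b + i * a) := by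
      intro i
      rw [card_product, Int.card_Ico, Int.card_Ico, pow_add]
      simp only [sub_zero]
      norm_cast
    simp_rw [e]
    rw [prod_pow_eq_pow_sum]
    congr 1
    rw [sum_add_distrib, ← sum_mul, ← sum_mul, Fin.sum_univ_eq_sum_range (fun i => i),
      Fin.sum_univ_eq_sum_range (fun i => r - 1 - i), sum_range_reflect (fun i => i), sum_range_id]
    ring
  rw [← hTcard]
  refine card_le_card_of_injOn (fun w i => ((σ w (i + 2) / (p : ℤ) ^ (((i : ℕ) + 2) * b)) %
    (p : ℤ) ^ ((r - 1 - i) * b), (Φ w i / (p : ℤ) ^ ((r + 1) * b)) % (p : ℤ) ^ ((i : ℕ) * a))) ?_ ?_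
  · intro w _
    simp only [hT, mem_coe, Fintype.mem_piFinset, mem_product, mem_Ico]
    intro i
    exact ⟨⟨Int.emod_nonneg _ (by positivity), Int.emod_lt_of_pos _ (by positivity)⟩,
      ⟨Int.emod_nonneg _ (by positivity), Int.emod_lt_of_pos _ (by positivity)⟩⟩
  · intro u hu w hw huw
    rw [mem_coe, mem_filter] at hu hw
    have hmu := hu.2.trans hw.2.symm
    have hs : ∀ j, j ∈ range (r + 1) → j ≠ 0 → (p : ℤ) ^ ((r + 1) * b) ∣ σ u (j + 1) - σ w (j + 1) := by
      intro j hj hj0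
      rw [mem_range] at hj
      obtain ⟨i, rfl⟩ := Nat.exists_eq_succ_of_ne_zero hj0
      have e1 := congrFun hmu ⟨i + 1, hj⟩
      have e2 := congrArg Prod.fst (congrFun huw ⟨i, by omega⟩)
      have := mod_code (m := (p : ℤ) ^ ((i + 2) * b)) e1 e2
      rw [← pow_add] at this
      convert this using 2
      rw [← add_mul]
      congr 1
      simp only
      omega
    refine hensel_inj hp hpk hab η ξ h1 h2 h3 u w hu.1 hw.1 fun l => ?_
    have e2 := congrArg Prod.snd (congrFun huw l)
    refine mod_code ?_ e2
    refine (Int.emod_emod_of_dvd _ dvd_rfl).symm.trans ?_ |>.trans (Int.emod_emod_of_dvd _ dvd_rfl)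
    rw [Int.emod_emod_of_dvd _ dvd_rfl, Int.emod_emod_of_dvd _ dvd_rfl]
    refine ((Int.modEq_iff_dvd).2 ?_).symm
    simp only [hΦ, anti_eval]
    rw [sum_comm, sum_comm (s := univ) (t := range (r + 1)) (f := fun x j => _ * _ * (w x - η) ^ (j + 1)),
      ← sum_sub_distrib]
    refine dvd_sum fun j hj => ?_
    rw [← mul_sum, ← mul_sum, ← mul_sub]
    rcases eq_or_ne j 0 with rfl | hj0
    · rw [gg_coeff_zero]; simp
    · exact (hs j hj hj0).mul_left _

end VMV


namespace VMV
open Finset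
open scoped ComplexConjugate

lemma mem_cls {X : ℕ} {q η x : ℤ} : x ∈ cls X q η ↔ (1 ≤ x ∧ x ≤ X) ∧ q ∣ x - η := by
  simp [cls]

/-- class splitting -/
lemma f_split {k M : ℕ} [NeZero M] {X p c A : ℕ} (hp : 0 < p) (hcA : c ≤ A) (ξ : ℤ)
    (a : Fin k → ZMod M) :
    f (cls X ((p : ℤ) ^ c) ξ) a = ∑ z ∈ (Ico (0 : ℤ) ((p : ℤ) ^ A)).filter
      (fun z => (p : ℤ) ^ c ∣ z - ξ), f (cls X ((p : ℤ) ^ A) z) a := by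
  have hp' : (0 : ℤ) < (p : ℤ) ^ A := by positivity
  have hdv : (p : ℤ) ^ c ∣ (p : ℤ) ^ A := pow_dvd_pow _ hcA
  unfold f
  rw [← sum_fiberwise_of_maps_to (g := fun x => x % (p : ℤ) ^ A) (t := (Ico (0 : ℤ) ((p : ℤ) ^ A)).filter
      (fun z => (p : ℤ) ^ c ∣ z - ξ))]
  · refine sum_congr rfl fun z hz => ?_
    refine sum_congr ?_ fun _ _ => rfl
    ext x
    simp only [mem_filter, mem_Ico, mem_cls] at hz ⊢
    constructor
    · rintro ⟨⟨h1, h2⟩, h3⟩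
      refine ⟨h1, ?_⟩
      rw [← h3]
      exact Int.dvd_self_sub_emod
    · rintro ⟨h1, h2⟩
      refine ⟨⟨h1, ?_⟩, ?_⟩
      · have := dvd_add (hdv.trans h2) hz.2
        simpa using this
      · have : z % (p : ℤ) ^ A = x % (p : ℤ) ^ A := (Int.modEq_iff_dvd).2 h2
        rw [← this]
        exact Int.emod_eq_of_lt hz.1.1 hz.1.2
  · intro x hx
    rw [mem_cls] at hx
    simp only [mem_filter, mem_Ico]
    refine ⟨⟨Int.emod_nonneg _ hp'.ne', Int.emod_lt_of_pos _ hp'⟩, ?_⟩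
    have : (p : ℤ) ^ c ∣ x % (p : ℤ) ^ A - x := by
      refine hdv.trans ?_
      rw [← dvd_neg, neg_sub]
      exact Int.dvd_self_sub_emod
    have := dvd_add this hx.2
    simpa using this

lemma card_split {p c A : ℕ} (hp : 0 < p) (hcA : c ≤ A) (ξ : ℤ) :
    ((Ico (0 : ℤ) ((p : ℤ) ^ A)).filter (fun z => (p : ℤ) ^ c ∣ z - ξ)).card ≤ p ^ (A - c) := by
  have hp' : (0 : ℤ) < (p : ℤ) ^ c := by positivity
  have : (Ico (0 : ℤ) ((p : ℤ) ^ (A - c))).card = p ^ (A - c) := by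
    rw [Int.card_Ico, sub_zero]; norm_cast
  rw [← this]
  refine card_le_card_of_injOn (fun z => z / (p : ℤ) ^ c) ?_ ?_
  · intro z hz
    simp only [coe_filter, mem_Ico, Set.mem_ofPred_eq] at hz
    simp only [mem_coe, mem_Ico]
    refine ⟨Int.ediv_nonneg hz.1.1 hp'.le, ?_⟩
    apply Int.ediv_lt_of_lt_mul hp'
    rw [← pow_add, Nat.sub_add_cancel hcA]
    exact hz.1.2
  · intro z hz w hw hzw
    simp only [coe_filter, mem_Ico, Set.mem_ofPred_eq] at hz hw
    have e1 := Int.emod_add_mul_ediv z ((p : ℤ) ^ c)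
    have e2 := Int.emod_add_mul_ediv w ((p : ℤ) ^ c)
    have e3 : z % (p : ℤ) ^ c = w % (p : ℤ) ^ c := by
      have h1 : ξ % (p : ℤ) ^ c = z % (p : ℤ) ^ c := (Int.modEq_iff_dvd).2 hz.2
      have h2 : ξ % (p : ℤ) ^ c = w % (p : ℤ) ^ c := (Int.modEq_iff_dvd).2 hw.2
      rw [← h1, h2]
    simp only at hzw
    rw [← e1, ← e2, e3, hzw]

/-- well spaced classes -/
def Val {r : ℕ} (p a : ℕ) (ξ : Fin r → ℤ) (η : ℤ) : Prop :=
  (∀ l m, (p : ℤ) ^ a ∣ ξ l - ξ m) ∧ (∀ l m, l ≠ m → ¬ (p : ℤ) ^ (a + 1) ∣ ξ l - ξ m) ∧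
    ∀ l, ¬ (p : ℤ) ∣ ξ l - η

/-- the mixed mean value -/
noncomputable def II {r : ℕ} (M X p a b : ℕ) [NeZero M] (ξ : Fin r → ℤ) (η : ℤ) : ℝ :=
  E (fun u : Fin (r + 1) → ZMod M => (∏ l, ‖f (cls X ((p : ℤ) ^ (a + 1)) (ξ l)) u‖ ^ 2) *
    ‖f (cls X ((p : ℤ) ^ b) η) u‖ ^ (2 * (r * (r + 1))))

/-- the second mixed mean value -/
noncomputable def KK {r : ℕ} (M X p a b : ℕ) [NeZero M] (ξ η : Fin r → ℤ) : ℝ :=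
  E (fun u : Fin (r + 1) → ZMod M => (∏ l, ‖f (cls X ((p : ℤ) ^ (a + 1)) (ξ l)) u‖ ^ 2) *
    ∏ l, ‖f (cls X ((p : ℤ) ^ (b + 1)) (η l)) u‖ ^ (2 * (r + 1)))

lemma congr_step {r M X p a b : ℕ} [NeZero M] (hM : (r * (r + 2)) * X ^ (r + 1) < M)
    (hp : p.Prime) (hpk : r + 1 < p) (hab : a < b) (ξ : Fin r → ℤ) (η0 : ℤ) (hV : Val p a ξ η0)
    (η : Fin r → ℤ) (hη : ∀ l, (p : ℤ) ^ b ∣ η l - η0) :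
    KK M X p a b ξ η ≤ ((p ^ (r * (r - 1) / 2 * (a + b)) : ℕ) : ℝ) *
      ∑ ζ ∈ Zs p ((r + 1) * b) (a + 1) ξ,
        E (fun u : Fin (r + 1) → ZMod M => ‖∏ l, f (cls X ((p : ℤ) ^ ((r + 1) * b)) (ζ l)) u‖ ^ 2 *
          ∏ l, ‖f (cls X ((p : ℤ) ^ (b + 1)) (η l)) u‖ ^ (2 * (r + 1))) := by
  have hle : a + 1 ≤ (r + 1) * b := by nlinarith
  have hsplit : ∀ u : Fin (r + 1) → ZMod M, ∏ l, ‖f (cls X ((p : ℤ) ^ (a + 1)) (ξ l)) u‖ ^ 2 =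
      ‖∑ ζ ∈ Zs p ((r + 1) * b) (a + 1) ξ, ∏ l, f (cls X ((p : ℤ) ^ ((r + 1) * b)) (ζ l)) u‖ ^ 2 := by
    intro u
    unfold Zs
    rw [← prod_univ_sum (fun l => (Ico (0 : ℤ) ((p : ℤ) ^ ((r + 1) * b))).filter
      fun z => (p : ℤ) ^ (a + 1) ∣ z - ξ l) (fun l z => f (cls X ((p : ℤ) ^ ((r + 1) * b)) z) u)]
    simp_rw [← f_split hp.pos hle]
    rw [norm_prod, prod_pow]
  unfold KK
  simp_rw [hsplit]
  refine fiber_bound (Zs p ((r + 1) * b) (a + 1) ξ)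
    (fun ζ u => ∏ l, f (cls X ((p : ℤ) ^ ((r + 1) * b)) (ζ l)) u)
    (fun u => ∏ l, ‖f (cls X ((p : ℤ) ^ (b + 1)) (η l)) u‖ ^ (2 * (r + 1)))
    (fun u => prod_nonneg fun l _ => by positivity) (muv (r + 1) p b η0) _ ?_ ?_
  · intro z _
    exact fiber_count hp hpk hab η0 ξ hV.1 hV.2.1 hV.2.2 z
  · intro z _ w _ hzw
    set A : (Fin r → ℤ) → (Fin r ⊕ (Fin r × Fin (r + 1))) → Finset ℤ := fun z =>
      Sum.elim (fun l => cls X ((p : ℤ) ^ ((r + 1) * b)) (z l))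
        (fun l => cls X ((p : ℤ) ^ (b + 1)) (η l.1)) with hA
    have hsub : ∀ z i, A z i ⊆ Icc 0 (X : ℤ) := by
      intro z i
      rcases i with i | i
      · exact cls_sub _ _ _
      · exact cls_sub _ _ _
    have h0 := orth_zero (k := r + 1) (M := M) (X := X) (by
      simp only [Fintype.card_sum, Fintype.card_prod, Fintype.card_fin]
      calc _ = (r * (r + 2)) * X ^ (r + 1) := by ring
        _ < M := hM) (A z) (A w) (hsub z) (hsub w) (by
      intro x hx y hy hxy
      apply hzw
      rw [Fintype.mem_piFinset] at hx hy
      funext j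
      have hs := shift_sum x y hxy (-η0) ((j : ℕ) + 1) j.2
      rw [Fintype.sum_sum_type, Fintype.sum_sum_type] at hs
      have hB : ∀ v : Fin r ⊕ (Fin r × Fin (r + 1)) → ℤ, (∀ i, v (Sum.inr i) ∈ cls X ((p : ℤ) ^ (b + 1)) (η i.1)) →
          (p : ℤ) ^ (((j : ℕ) + 1) * b) ∣ ∑ i, (v (Sum.inr i) + -η0) ^ ((j : ℕ) + 1) := by
        intro v hv
        refine dvd_sum fun i _ => ?_
        have h1 := (mem_cls.1 (hv i)).2
        have h2 := dvd_add ((pow_dvd_pow (p : ℤ) (Nat.le_succ b)).trans h1) (hη i.1)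
        rw [sub_add_sub_cancel, sub_eq_add_neg] at h2
        rw [mul_comm, pow_mul]
        exact pow_dvd_pow_of_dvd h2 _
      have hC : ∀ (z : Fin r → ℤ) (v : Fin r ⊕ (Fin r × Fin (r + 1)) → ℤ),
          (∀ i, v (Sum.inl i) ∈ cls X ((p : ℤ) ^ ((r + 1) * b)) (z i)) →
          (p : ℤ) ^ (((j : ℕ) + 1) * b) ∣ ∑ i, (v (Sum.inl i) + -η0) ^ ((j : ℕ) + 1)
            - ∑ l, (z l - η0) ^ ((j : ℕ) + 1) := by
        intro z v hv
        rw [← sum_sub_distrib]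
        refine dvd_sum fun i _ => ?_
        have h1 := (mem_cls.1 (hv i)).2
        have h2 := (pow_dvd_pow (p : ℤ) (Nat.mul_le_mul_right b (show (j : ℕ) + 1 ≤ r + 1 from j.2))).trans h1
        refine h2.trans ?_
        have h3 := sub_dvd_pow_sub_pow (v (Sum.inl i) + -η0) (z i - η0) ((j : ℕ) + 1)
        convert h3 using 1
        ring
      have hx1 := hB x (fun i => hx (Sum.inr i))
      have hy1 := hB y (fun i => hy (Sum.inr i))
      have hx2 := hC z x (fun i => hx (Sum.inl i))
      have hy2 := hC w y (fun i => hy (Sum.inl i))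
      unfold muv
      refine ((Int.modEq_iff_dvd).2 ?_ : _ ≡ _ [ZMOD _])
      have := dvd_sub (dvd_sub hx2 hy2) (dvd_sub hy1 hx1)
      refine this.trans (dvd_of_eq ?_)
      linear_combination hs)
    have hprod : ∀ z (u : Fin (r + 1) → ZMod M), ∏ i, f (A z i) u =
        (∏ l, f (cls X ((p : ℤ) ^ ((r + 1) * b)) (z l)) u) *
          ∏ l, f (cls X ((p : ℤ) ^ (b + 1)) (η l)) u ^ (r + 1) := by
      intro z u
      rw [Fintype.prod_sum_type, Fintype.prod_prod_type]
      simp [hA]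
    rw [← h0]
    refine sum_congr rfl fun u _ => ?_
    rw [hprod, hprod, map_mul]
    have : ((∏ l, ‖f (cls X ((p : ℤ) ^ (b + 1)) (η l)) u‖ ^ (2 * (r + 1)) : ℝ) : ℂ) =
        (∏ l, f (cls X ((p : ℤ) ^ (b + 1)) (η l)) u ^ (r + 1)) *
        conj (∏ l, f (cls X ((p : ℤ) ^ (b + 1)) (η l)) u ^ (r + 1)) := by
      rw [Complex.mul_conj, Complex.normSq_eq_norm_sq, norm_prod, ← prod_pow]
      congr 1
      refine prod_congr rfl fun l _ => ?_
      rw [norm_pow, ← pow_mul, mul_comm]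
    rw [this]
    ring

end VMV


namespace VMV
open Finset

lemma prod_le_sum_pow {r : ℕ} (hr : 0 < r) (x : Fin r → ℝ) (hx : ∀ i, 0 ≤ x i) :
    ∏ i, x i ≤ ∑ i, x i ^ r := by
  have : Nonempty (Fin r) := ⟨⟨0, hr⟩⟩
  obtain ⟨m, _, hm⟩ := exists_max_image (univ : Finset (Fin r)) x univ_nonempty
  calc ∏ i, x i ≤ ∏ _i : Fin r, x m := prod_le_prod (fun i _ => hx i) fun i hi => hm i hi
    _ = x m ^ r := by simp
    _ ≤ ∑ i, x i ^ r := single_le_sum (f := fun i => x i ^ r) (fun i _ => pow_nonneg (hx i) r) (mem_univ m)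

lemma holder_alg (k r : ℕ) (hk : 0 < k) (A x : ℝ) (hA : 0 ≤ A) (hx : 0 ≤ x) :
    (A * x ^ (2 * (r * k))) ^ (1 / (k : ℝ)) * (A ^ (k + 1)) ^ (1 - 1 / (k : ℝ)) = x ^ (2 * r) * A ^ k := by
  have hk' : (0 : ℝ) < k := by exact_mod_cast hk
  have hk1 : (1 : ℝ) ≤ k := by exact_mod_cast hk
  have hle : 1 / (k : ℝ) ≤ 1 := by rw [div_le_one hk']; exact hk1
  have e1 : x ^ (2 * (r * k)) = (x ^ (2 * r)) ^ k := by rw [← pow_mul]; ring_nf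
  rw [Real.mul_rpow hA (by positivity), e1, one_div, Real.pow_rpow_inv_natCast (by positivity) hk.ne',
    ← Real.rpow_natCast A (k + 1), ← Real.rpow_mul hA, mul_right_comm, ← Real.rpow_add_of_nonneg hA (by positivity)
    (by have : 0 ≤ 1 - (k : ℝ)⁻¹ := by rw [← one_div]; linarith
        positivity)]
  rw [← Real.rpow_natCast A k, mul_comm]
  congr 2
  push_cast
  field_simp
  ring

lemma KK_le {r M X p a b : ℕ} [NeZero M] (hr : 0 < r) (hM : (r * (r + 2)) * X ^ (r + 1) < M)
    (hp : p.Prime) (hpk : r + 1 < p) (hab : a < b) (ξ : Fin r → ℤ) (η0 : ℤ) (hV : Val p a ξ η0)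
    (η : Fin r → ℤ) (hη : ∀ l, (p : ℤ) ^ b ∣ η l - η0)
    (hη2 : ∀ l m, l ≠ m → ¬ (p : ℤ) ^ (b + 1) ∣ η l - η m) (Ib Jb : ℝ)
    (hI : ∀ (η' : Fin r → ℤ) (ζ : ℤ), Val p b η' ζ → II M X p b ((r + 1) * b) η' ζ ≤ Ib)
    (hJ : (Js (r + 1) (r * (r + 2)) (Icc 1 ((X / p ^ (b + 1) + 1 : ℕ) : ℤ)) : ℝ) ≤ Jb) :
    KK M X p a b ξ η ≤ (p : ℝ) ^ (r * (r - 1) / 2 * (a + b)) * ((p : ℝ) ^ (((r + 1) * b - (a + 1)) * r) *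
      (r * (Ib ^ (1 / ((r + 1 : ℕ) : ℝ)) * (r * Jb) ^ (1 - 1 / ((r + 1 : ℕ) : ℝ))))) := by
  have hle : a + 1 ≤ (r + 1) * b := by nlinarith
  refine (congr_step hM hp hpk hab ξ η0 hV η hη).trans ?_
  rw [Nat.cast_pow]
  refine mul_le_mul_of_nonneg_left ?_ (by positivity)
  have hk1 : (0 : ℝ) < ((r + 1 : ℕ) : ℝ) := by positivity
  have hlt : 1 / ((r + 1 : ℕ) : ℝ) < 1 := by
    rw [div_lt_one hk1]; push_cast; have : (0 : ℝ) < r := by exact_mod_cast hr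
    linarith
  have hcard : ((Zs p ((r + 1) * b) (a + 1) ξ).card : ℝ) ≤ (p : ℝ) ^ (((r + 1) * b - (a + 1)) * r) := by
    have : (Zs p ((r + 1) * b) (a + 1) ξ).card ≤ p ^ (((r + 1) * b - (a + 1)) * r) := by
      unfold Zs
      rw [Fintype.card_piFinset]
      calc _ ≤ ∏ _l : Fin r, p ^ ((r + 1) * b - (a + 1)) :=
            prod_le_prod' fun l _ => card_split hp.pos hle (ξ l)
        _ = _ := by simp [pow_mul]
    exact_mod_cast this
  set W : ℝ := (r * (Ib ^ (1 / ((r + 1 : ℕ) : ℝ)) * (r * Jb) ^ (1 - 1 / ((r + 1 : ℕ) : ℝ)))) with hW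
  have hJ0 : 0 ≤ Jb := (Nat.cast_nonneg _).trans hJ
  have main : ∀ ζ ∈ Zs p ((r + 1) * b) (a + 1) ξ,
      E (fun u : Fin (r + 1) → ZMod M => ‖∏ l, f (cls X ((p : ℤ) ^ ((r + 1) * b)) (ζ l)) u‖ ^ 2 *
          ∏ l, ‖f (cls X ((p : ℤ) ^ (b + 1)) (η l)) u‖ ^ (2 * (r + 1))) ≤ W ∧ 0 ≤ W := by
    intro ζ hζ
    simp only [Zs, Fintype.mem_piFinset, mem_filter, mem_Ico] at hζ
    have hval : ∀ l, Val p b η (ζ l) := by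
      intro l
      refine ⟨fun i m => ?_, hη2, fun i hd => ?_⟩
      · have := dvd_sub (hη i) (hη m)
        simpa using this
      · apply hV.2.2 l
        have h1 : (p : ℤ) ∣ η i - η0 := (dvd_pow_self _ (by omega)).trans (hη i)
        have h2 : (p : ℤ) ∣ ζ l - ξ l := (dvd_pow_self _ (by omega)).trans (hζ l).2
        have h3 := dvd_sub (dvd_sub h1 hd) h2
        refine h3.trans (dvd_of_eq ?_)
        ring
    have hIb : 0 ≤ Ib := le_trans (E_nonneg fun u => by
      refine mul_nonneg (prod_nonneg fun l _ => by positivity) (by positivity)) (hI η (ζ ⟨0, hr⟩) (hval _))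
    refine ⟨?_, by positivity⟩
    have hstep : ∀ l : Fin r, E (fun u : Fin (r + 1) → ZMod M =>
        ‖f (cls X ((p : ℤ) ^ ((r + 1) * b)) (ζ l)) u‖ ^ (2 * r) *
          (∏ l, ‖f (cls X ((p : ℤ) ^ (b + 1)) (η l)) u‖ ^ 2) ^ (r + 1)) ≤
        Ib ^ (1 / ((r + 1 : ℕ) : ℝ)) * (r * Jb) ^ (1 - 1 / ((r + 1 : ℕ) : ℝ)) := by
      intro l
      have h1 := E_holder (g := fun u : Fin (r + 1) → ZMod M =>
          (∏ l, ‖f (cls X ((p : ℤ) ^ (b + 1)) (η l)) u‖ ^ 2) *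
          ‖f (cls X ((p : ℤ) ^ ((r + 1) * b)) (ζ l)) u‖ ^ (2 * (r * (r + 1))))
        (h := fun u => (∏ l, ‖f (cls X ((p : ℤ) ^ (b + 1)) (η l)) u‖ ^ 2) ^ (r + 1 + 1))
        (fun u => mul_nonneg (prod_nonneg fun l _ => by positivity) (by positivity))
        (fun u => pow_nonneg (prod_nonneg fun l _ => by positivity) _)
        (θ := 1 / ((r + 1 : ℕ) : ℝ)) (φ := 1 - 1 / ((r + 1 : ℕ) : ℝ)) (by positivity) (by linarith) (by ring)
      simp_rw [fun u : Fin (r + 1) → ZMod M => holder_alg (r + 1) r (Nat.succ_pos r)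
        (∏ l, ‖f (cls X ((p : ℤ) ^ (b + 1)) (η l)) u‖ ^ 2)
        ‖f (cls X ((p : ℤ) ^ ((r + 1) * b)) (ζ l)) u‖ (prod_nonneg fun l _ => by positivity) (norm_nonneg _)] at h1
      refine h1.trans ?_
      have h2 := hI η (ζ l) (hval l)
      have h20 : 0 ≤ II M X p b ((r + 1) * b) η (ζ l) := E_nonneg fun u =>
        mul_nonneg (prod_nonneg fun l _ => by positivity) (by positivity)
      have h3 : E (fun u : Fin (r + 1) → ZMod M =>
          (∏ l, ‖f (cls X ((p : ℤ) ^ (b + 1)) (η l)) u‖ ^ 2) ^ (r + 1 + 1)) ≤ r * Jb := by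
        calc _ ≤ E (fun u : Fin (r + 1) → ZMod M =>
              ∑ l, ‖f (cls X ((p : ℤ) ^ (b + 1)) (η l)) u‖ ^ (2 * (r * (r + 2)))) := by
              refine E_mono fun u => ?_
              rw [← prod_pow]
              refine (prod_le_sum_pow hr _ (fun l => by positivity)).trans (le_of_eq ?_)
              refine sum_congr rfl fun l _ => ?_
              rw [← pow_mul, ← pow_mul]
              congr 1; ring
          _ = ∑ l, E (fun u : Fin (r + 1) → ZMod M =>
              ‖f (cls X ((p : ℤ) ^ (b + 1)) (η l)) u‖ ^ (2 * (r * (r + 2)))) := E_sum _ _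
          _ ≤ ∑ _l : Fin r, Jb := by
              refine sum_le_sum fun l _ => ?_
              rw [E_eq_Js hM _ (cls_sub _ _ _)]
              have := Js_cls_le (r + 1) (r * (r + 2)) X (p ^ (b + 1)) (pow_pos hp.pos _) (η l)
              push_cast at this hJ ⊢
              refine le_trans ?_ hJ
              exact_mod_cast this
          _ = r * Jb := by simp
      refine mul_le_mul (Real.rpow_le_rpow h20 h2 (by positivity))
        (Real.rpow_le_rpow (E_nonneg fun u => pow_nonneg (prod_nonneg fun l _ => by positivity) _) h3
          (by linarith)) (Real.rpow_nonneg (E_nonneg fun u =>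
            pow_nonneg (prod_nonneg fun l _ => by positivity) _) _) (by positivity)
    calc _ ≤ E (fun u : Fin (r + 1) → ZMod M => ∑ l,
          ‖f (cls X ((p : ℤ) ^ ((r + 1) * b)) (ζ l)) u‖ ^ (2 * r) *
          (∏ l, ‖f (cls X ((p : ℤ) ^ (b + 1)) (η l)) u‖ ^ 2) ^ (r + 1)) := by
          refine E_mono fun u => ?_
          rw [← sum_mul]
          have e : ∏ l, ‖f (cls X ((p : ℤ) ^ (b + 1)) (η l)) u‖ ^ (2 * (r + 1)) =
            (∏ l, ‖f (cls X ((p : ℤ) ^ (b + 1)) (η l)) u‖ ^ 2) ^ (r + 1) := by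
            rw [← prod_pow]; exact prod_congr rfl fun l _ => by rw [pow_mul]
          rw [e]
          refine mul_le_mul_of_nonneg_right ?_ (pow_nonneg (prod_nonneg fun l _ => by positivity) _)
          rw [norm_prod, ← prod_pow]
          refine (prod_le_sum_pow hr _ (fun l => by positivity)).trans (le_of_eq ?_)
          exact sum_congr rfl fun l _ => (pow_mul _ 2 r).symm
      _ = _ := E_sum _ _
      _ ≤ ∑ _l : Fin r, Ib ^ (1 / ((r + 1 : ℕ) : ℝ)) * (r * Jb) ^ (1 - 1 / ((r + 1 : ℕ) : ℝ)) :=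
          sum_le_sum fun l _ => hstep l
      _ = W := by simp [hW]
  rcases (Zs p ((r + 1) * b) (a + 1) ξ).eq_empty_or_nonempty with he | ⟨ζ, hζ⟩
  · rw [he] at hcard ⊢
    simp only [sum_empty]
    have hex : 0 ≤ W := by
      obtain ⟨ζ, hζ⟩ : (Zs p ((r + 1) * b) (a + 1) ξ).Nonempty := by
        refine ⟨fun l => ξ l % (p : ℤ) ^ ((r + 1) * b), ?_⟩
        have hpz : (0 : ℤ) < (p : ℤ) ^ ((r + 1) * b) := pow_pos (by exact_mod_cast hp.pos) _
        simp only [Zs, Fintype.mem_piFinset, mem_filter, mem_Ico]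
        refine fun l => ⟨⟨Int.emod_nonneg _ hpz.ne', Int.emod_lt_of_pos _ hpz⟩, ?_⟩
        refine (pow_dvd_pow (p : ℤ) hle).trans ?_
        rw [← dvd_neg, neg_sub]
        exact Int.dvd_self_sub_emod
      exact (main ζ hζ).2
    exact mul_nonneg (by positivity) hex
  · calc _ ≤ ∑ _ζ ∈ Zs p ((r + 1) * b) (a + 1) ξ, W := sum_le_sum fun ζ hζ => (main ζ hζ).1
      _ = (Zs p ((r + 1) * b) (a + 1) ξ).card * W := by simp
      _ ≤ _ := mul_le_mul_of_nonneg_right hcard (main ζ hζ).2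

end VMV


namespace VMV
open Finset

lemma bn_alt {ι : Type*} [DecidableEq ι] (T : Finset ι) (p n : ℕ) (hp : 0 < p) (hn : 0 < n)
    (hT : T.card ≤ p) (g : ι → ℂ) :
    (∃ i : Fin n → ι, Function.Injective i ∧ (∀ l, i l ∈ T) ∧
      ∀ l, ‖∑ z ∈ T, g z‖ ≤ 2 * p * ‖g (i l)‖) ∨
    (∃ i ∈ T, ‖∑ z ∈ T, g z‖ ≤ 2 * n * ‖g i‖) ∨ ‖∑ z ∈ T, g z‖ = 0 := by
  set F := ‖∑ z ∈ T, g z‖ with hF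
  have hp' : (0 : ℝ) < p := by exact_mod_cast hp
  have hn' : (0 : ℝ) < n := by exact_mod_cast hn
  set S := T.filter fun z => F ≤ 2 * p * ‖g z‖ with hS
  by_cases hc : n ≤ S.card
  · left
    obtain ⟨S', hS', hcard⟩ := exists_subset_card_eq hc
    have e := (S'.equivFinOfCardEq hcard).symm
    refine ⟨fun l => (e l : ι), fun a b h => e.injective (Subtype.ext h), fun l => ?_, fun l => ?_⟩
    · exact (mem_filter.1 (hS' (e l).2)).1
    · exact (mem_filter.1 (hS' (e l).2)).2
  · right
    by_contra hcon
    push Not at hcon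
    obtain ⟨h1, h2⟩ := hcon
    have hF0 : 0 < F := lt_of_le_of_ne (norm_nonneg _) (Ne.symm h2)
    have e1 : F ≤ ∑ z ∈ T, ‖g z‖ := norm_sum_le _ _
    rw [← sum_filter_add_sum_filter_not T (fun z => F ≤ 2 * p * ‖g z‖)] at e1
    have e2 : ∑ z ∈ T.filter (fun z => ¬ F ≤ 2 * p * ‖g z‖), ‖g z‖ ≤ F / 2 := by
      calc _ ≤ ∑ z ∈ T.filter (fun z => ¬ F ≤ 2 * p * ‖g z‖), F / (2 * p) := by
            refine sum_le_sum fun z hz => ?_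
            have := (mem_filter.1 hz).2
            rw [le_div_iff₀ (by positivity)]
            linarith
        _ = (T.filter (fun z => ¬ F ≤ 2 * p * ‖g z‖)).card * (F / (2 * p)) := by simp
        _ ≤ p * (F / (2 * p)) := by
            refine mul_le_mul_of_nonneg_right ?_ (by positivity)
            exact_mod_cast (card_filter_le _ _).trans hT
        _ = F / 2 := by field_simp
    have e3 : ∑ z ∈ S, ‖g z‖ < F / 2 := by
      calc _ ≤ ∑ z ∈ S, F / (2 * n) := by
            refine sum_le_sum fun z hz => ?_
            have := h1 z (mem_filter.1 hz).1
            rw [le_div_iff₀ (by positivity)]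
            linarith
        _ = S.card * (F / (2 * n)) := by simp
        _ < n * (F / (2 * n)) := by
            refine mul_lt_mul_of_pos_right ?_ (by positivity)
            exact_mod_cast not_le.1 hc
        _ = F / 2 := by field_simp
    linarith

/-- injective tuples in a finite set -/
noncomputable def tup {ι : Type*} [DecidableEq ι] (n : ℕ) (T : Finset ι) : Finset (Fin n → ι) := by
  classical
  exact (Fintype.piFinset fun _ : Fin n => T).filter Function.Injective

lemma mem_tup {ι : Type*} [DecidableEq ι] {n : ℕ} {T : Finset ι} {i : Fin n → ι} :
    i ∈ tup n T ↔ (∀ l, i l ∈ T) ∧ Function.Injective i := by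
  simp [tup]

lemma card_tup {ι : Type*} [DecidableEq ι] {n p : ℕ} {T : Finset ι} (hT : T.card ≤ p) :
    (tup n T).card ≤ p ^ n := by
  unfold tup
  refine (card_filter_le _ _).trans ?_
  rw [Fintype.card_piFinset]
  simp only [prod_const, card_univ, Fintype.card_fin]
  exact Nat.pow_le_pow_left hT n

lemma bn_ineq {ι : Type*} [DecidableEq ι] (T : Finset ι) (p n m : ℕ) (hp : 0 < p) (hn : 0 < n)
    (hm : 0 < m) (hT : T.card ≤ p) (g : ι → ℂ) (w : Fin n → ℕ) (hw : ∑ l, w l = m) :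
    ‖∑ z ∈ T, g z‖ ^ m ≤ (2 * n) ^ m * ∑ z ∈ T, ‖g z‖ ^ m +
      (2 * p) ^ m * ∑ i ∈ tup n T, ∏ l, ‖g (i l)‖ ^ (w l) := by
  have n1 : (0 : ℝ) ≤ (2 * n) ^ m * ∑ z ∈ T, ‖g z‖ ^ m := by positivity
  have n2 : (0 : ℝ) ≤ (2 * p) ^ m * ∑ i ∈ tup n T, ∏ l, ‖g (i l)‖ ^ (w l) := by positivity
  rcases bn_alt T p n hp hn hT g with ⟨i, hi, hiT, h⟩ | ⟨i, hi, h⟩ | h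
  · refine le_trans ?_ (le_add_of_nonneg_left n1)
    calc ‖∑ z ∈ T, g z‖ ^ m = ∏ l, ‖∑ z ∈ T, g z‖ ^ (w l) := by rw [prod_pow_eq_pow_sum, hw]
      _ ≤ ∏ l, (2 * p * ‖g (i l)‖) ^ (w l) :=
          prod_le_prod (fun l _ => by positivity) fun l _ => pow_le_pow_left₀ (norm_nonneg _) (h l) _
      _ = (2 * p) ^ m * ∏ l, ‖g (i l)‖ ^ (w l) := by
          simp_rw [mul_pow (2 * (p : ℝ))]
          rw [prod_mul_distrib, prod_pow_eq_pow_sum, hw]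
      _ ≤ _ := by
          refine mul_le_mul_of_nonneg_left ?_ (by positivity)
          exact single_le_sum (f := fun i : Fin n → ι => ∏ l, ‖g (i l)‖ ^ (w l))
            (fun i _ => by positivity) (mem_tup.2 ⟨hiT, hi⟩)
  · refine le_trans ?_ (le_add_of_nonneg_right n2)
    calc ‖∑ z ∈ T, g z‖ ^ m ≤ (2 * n * ‖g i‖) ^ m := pow_le_pow_left₀ (norm_nonneg _) h _
      _ = (2 * n) ^ m * ‖g i‖ ^ m := mul_pow _ _ _
      _ ≤ _ := by
          refine mul_le_mul_of_nonneg_left ?_ (by positivity)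
          exact single_le_sum (f := fun i => ‖g i‖ ^ m) (fun i _ => by positivity) hi
  · rw [h, zero_pow hm.ne']
    positivity

/-- subclasses -/
noncomputable def subc (p b : ℕ) (η : ℤ) : Finset ℤ :=
  (Ico (0 : ℤ) ((p : ℤ) ^ (b + 1))).filter (fun z => (p : ℤ) ^ b ∣ z - η)

lemma subc_card {p b : ℕ} (hp : 0 < p) (η : ℤ) : (subc p b η).card ≤ p := by
  have := card_split hp (Nat.le_succ b) η
  simpa [subc] using this

lemma subc_dist {p b : ℕ} {η z w : ℤ} (hz : z ∈ subc p b η) (hw : w ∈ subc p b η) (h : z ≠ w) :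
    ¬ (p : ℤ) ^ (b + 1) ∣ z - w := by
  intro hd
  simp only [subc, mem_filter, mem_Ico] at hz hw
  have := Int.eq_zero_of_abs_lt_dvd hd (by
    rw [abs_lt]; constructor <;> linarith [hz.1.1, hz.1.2, hw.1.1, hw.1.2])
  exact h (by linarith)

lemma II_nonneg {r : ℕ} (M X p a b : ℕ) [NeZero M] (ξ : Fin r → ℤ) (η : ℤ) :
    0 ≤ II M X p a b ξ η :=
  E_nonneg fun u => mul_nonneg (prod_nonneg fun l _ => by positivity) (by positivity)

lemma step_I {r M X p a b : ℕ} [NeZero M] (hr : 0 < r) (hp : 0 < p) (hb : 0 < b)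
    (ξ : Fin r → ℤ) (η : ℤ) (hV : Val p a ξ η) (Y1 Y2 : ℝ) (h1' : 0 ≤ Y1) (h2' : 0 ≤ Y2)
    (h1 : ∀ η', Val p a ξ η' → II M X p a (b + 1) ξ η' ≤ Y1)
    (h2 : ∀ η' : Fin r → ℤ, (∀ l, (p : ℤ) ^ b ∣ η' l - η) →
      (∀ l m, l ≠ m → ¬ (p : ℤ) ^ (b + 1) ∣ η' l - η' m) → KK M X p a b ξ η' ≤ Y2) :
    II M X p a b ξ η ≤ (2 * r) ^ (2 * (r * (r + 1))) * (p * Y1) +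
      (2 * p) ^ (2 * (r * (r + 1))) * (p ^ r * Y2) := by
  have key : II M X p a b ξ η ≤ (2 * r) ^ (2 * (r * (r + 1))) *
      ∑ z ∈ subc p b η, II M X p a (b + 1) ξ z +
      (2 * p) ^ (2 * (r * (r + 1))) * ∑ i ∈ tup r (subc p b η), KK M X p a b ξ i := by
    unfold II KK
    rw [← E_sum, ← E_sum, ← E_const_mul, ← E_const_mul, ← E_add]
    refine E_mono fun u => ?_
    rw [← mul_sum, ← mul_sum]
    have hs := bn_ineq (subc p b η) p r (2 * (r * (r + 1))) hp hr (by positivity) (subc_card hp η)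
      (fun z => f (k := r + 1) (cls X ((p : ℤ) ^ (b + 1)) z) u) (fun _ => 2 * (r + 1)) (by simp; ring)
    have : f (cls X ((p : ℤ) ^ b) η) u = ∑ z ∈ subc p b η, f (cls X ((p : ℤ) ^ (b + 1)) z) u :=
      f_split hp (Nat.le_succ b) η u
    rw [this]
    have := mul_le_mul_of_nonneg_left hs
      (prod_nonneg (fun l _ => by positivity) :
        (0 : ℝ) ≤ ∏ l, ‖f (k := r + 1) (cls X ((p : ℤ) ^ (a + 1)) (ξ l)) u‖ ^ 2)
    refine this.trans (le_of_eq ?_)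
    ring
  refine key.trans (add_le_add ?_ ?_)
  · refine mul_le_mul_of_nonneg_left ?_ (by positivity)
    calc _ ≤ ∑ _z ∈ subc p b η, Y1 := by
          refine sum_le_sum fun z hz => h1 z ⟨hV.1, hV.2.1, fun l hd => hV.2.2 l ?_⟩
          have : (p : ℤ) ∣ z - η := (dvd_pow_self _ hb.ne').trans (mem_filter.1 hz).2
          have := dvd_add hd this
          simpa using this
      _ = (subc p b η).card * Y1 := by simp
      _ ≤ _ := mul_le_mul_of_nonneg_right (by exact_mod_cast subc_card hp η) h1'
  · refine mul_le_mul_of_nonneg_left ?_ (by positivity)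
    calc _ ≤ ∑ _z ∈ tup r (subc p b η), Y2 := by
          refine sum_le_sum fun z hz => ?_
          rw [mem_tup] at hz
          exact h2 z (fun l => (mem_filter.1 (hz.1 l)).2)
            fun l m hlm => subc_dist (hz.1 l) (hz.1 m) fun h => hlm (hz.2 h)
      _ = (tup r (subc p b η)).card * Y2 := by simp
      _ ≤ _ := mul_le_mul_of_nonneg_right (by exact_mod_cast card_tup (subc_card hp η)) h2'

lemma step_start {r M X p : ℕ} [NeZero M] (hr : 0 < r) (hM : (r * (r + 2)) * X ^ (r + 1) < M) (hp : 0 < p)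
    (Y : ℝ) (hY0 : 0 ≤ Y)
    (hY : ∀ (ξ : Fin r → ℤ) η, Val p 0 ξ η → II M X p 0 1 ξ η ≤ Y) :
    (Js (r + 1) (r * (r + 2)) (Icc 1 (X : ℤ)) : ℝ) ≤ (2 * (r + 1)) ^ (2 * (r * (r + 2))) *
      (p * (Js (r + 1) (r * (r + 2)) (Icc 1 ((X / p + 1 : ℕ) : ℤ)) : ℝ)) +
      (2 * p) ^ (2 * (r * (r + 2))) * (p ^ (r + 1) * Y) := by
  have h0 : (Js (r + 1) (r * (r + 2)) (Icc 1 (X : ℤ)) : ℝ) =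
      E (fun u : Fin (r + 1) → ZMod M => ‖f (cls X ((p : ℤ) ^ 0) 0) u‖ ^ (2 * (r * (r + 2)))) := by
    rw [E_eq_Js hM _ (cls_sub _ _ _)]
    congr 2
    ext x
    simp [mem_cls]
  set w : Fin (r + 1) → ℕ := Fin.cons (2 * (r * (r + 1))) (fun _ => 2) with hw
  have key : E (fun u : Fin (r + 1) → ZMod M => ‖f (cls X ((p : ℤ) ^ 0) 0) u‖ ^ (2 * (r * (r + 2)))) ≤
      (2 * (r + 1)) ^ (2 * (r * (r + 2))) *
      ∑ z ∈ subc p 0 0, E (fun u : Fin (r + 1) → ZMod M =>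
        ‖f (cls X ((p : ℤ) ^ (0 + 1)) z) u‖ ^ (2 * (r * (r + 2)))) +
      (2 * p) ^ (2 * (r * (r + 2))) * ∑ i ∈ tup (r + 1) (subc p 0 0),
        II M X p 0 1 (fun l : Fin r => i l.succ) (i 0) := by
    unfold II
    rw [← E_sum, ← E_sum, ← E_const_mul, ← E_const_mul, ← E_add]
    refine E_mono fun u => ?_
    have hs := bn_ineq (subc p 0 0) p (r + 1) (2 * (r * (r + 2))) hp (Nat.succ_pos r) (by positivity) (subc_card hp 0)
      (fun z => f (k := r + 1) (cls X ((p : ℤ) ^ (0 + 1)) z) u) w (by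
        rw [hw, Fin.sum_univ_succ]; simp; ring)
    have : f (cls X ((p : ℤ) ^ 0) 0) u = ∑ z ∈ subc p 0 0, f (cls X ((p : ℤ) ^ (0 + 1)) z) u :=
      f_split hp (Nat.le_succ 0) 0 u
    rw [this]
    refine hs.trans (le_of_eq ?_)
    push_cast
    congr 2
    refine sum_congr rfl fun i _ => ?_
    rw [Fin.prod_univ_succ, mul_comm]
    simp [hw]
  rw [h0]
  refine key.trans (add_le_add ?_ ?_)
  · refine mul_le_mul_of_nonneg_left ?_ (by positivity)
    calc _ ≤ ∑ _z ∈ subc p 0 0, (Js (r + 1) (r * (r + 2)) (Icc 1 ((X / p + 1 : ℕ) : ℤ)) : ℝ) := by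
          refine sum_le_sum fun z hz => ?_
          rw [E_eq_Js hM _ (cls_sub _ _ _)]
          have := Js_cls_le (r + 1) (r * (r + 2)) X p hp z
          simp only [zero_add, pow_one]
          exact_mod_cast this
      _ = (subc p 0 0).card * (Js (r + 1) (r * (r + 2)) (Icc 1 ((X / p + 1 : ℕ) : ℤ)) : ℝ) := by simp
      _ ≤ _ := mul_le_mul_of_nonneg_right (by exact_mod_cast subc_card hp 0) (Nat.cast_nonneg _)
  · refine mul_le_mul_of_nonneg_left ?_ (by positivity)
    calc _ ≤ ∑ _z ∈ tup (r + 1) (subc p 0 0), Y := by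
          refine sum_le_sum fun z hz => ?_
          rw [mem_tup] at hz
          refine hY _ _ ⟨fun l m => by simp, fun l m hlm => subc_dist (hz.1 _) (hz.1 _) fun h =>
            hlm (Fin.succ_injective _ (hz.2 h)), fun l => ?_⟩
          have := subc_dist (hz.1 l.succ) (hz.1 0) fun h => (Fin.succ_ne_zero l) (hz.2 h)
          simpa using this
      _ = (tup (r + 1) (subc p 0 0)).card * Y := by simp
      _ ≤ _ := mul_le_mul_of_nonneg_right (by exact_mod_cast card_tup (subc_card hp 0)) hY0

end VMV


namespace VMV
open Finset

noncomputable def kap (r : ℕ) : ℝ := ((r : ℝ) + 2) * (3 * r - 1) / 2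
noncomputable def Dc (r : ℕ) : ℝ := 2 * (2 * (r * (r + 1)) + r + 1)
noncomputable def ca (r : ℕ) : ℝ := r - r * (r - 1) / 2

/-- running hypotheses -/
structure Par (r M X p B : ℕ) (Δ Λ : ℝ) : Prop where
  hr : 0 < r
  hM : (r * (r + 2)) * X ^ (r + 1) < M
  hp : p.Prime
  hpk : r + 1 < p
  hΔ : 0 < Δ
  hΛ : 0 < Λ
  hJ : ∀ c : ℕ, 1 ≤ c → c ≤ B → (Js (r + 1) (r * (r + 2)) (Icc 1 ((X / p ^ c + 1 : ℕ) : ℤ)) : ℝ) ≤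
    4 ^ (r * (r + 2)) * (Λ * (p : ℝ) ^ (-(c : ℝ) * (kap r + Δ)))
  c1 : 2 * (2 * (r : ℝ)) ^ (2 * (r * (r + 1))) ≤ p
  c2 : 2 * (2 : ℝ) ^ (2 * (r * (r + 1))) * (r * (r * 4 ^ (r * (r + 2)))) ≤ p
  c3 : 2 * ((2 * ((r : ℝ) + 1)) ^ (2 * (r * (r + 2))) * 4 ^ (r * (r + 2))) ≤ p
  c4 : 2 * (2 : ℝ) ^ (2 * (r * (r + 2))) ≤ p

lemma interp {c Λ P x y θ : ℝ} (hc : 0 ≤ c) (hΛ : 0 < Λ) (hP : 0 < P) (hθ : 0 < θ) (hθ1 : θ < 1) :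
    (c * (Λ * P ^ x)) ^ θ * (c * (Λ * P ^ y)) ^ (1 - θ) = c * (Λ * P ^ (θ * x + (1 - θ) * y)) := by
  have hx : 0 ≤ P ^ x := (Real.rpow_pos_of_pos hP x).le
  have hy : 0 ≤ P ^ y := (Real.rpow_pos_of_pos hP y).le
  rcases eq_or_lt_of_le hc with h | h
  · rw [← h]; simp [Real.zero_rpow hθ.ne']
  rw [Real.mul_rpow hc (by positivity), Real.mul_rpow hΛ.le hx, Real.mul_rpow hc (by positivity),
    Real.mul_rpow hΛ.le hy, ← Real.rpow_mul hP.le, ← Real.rpow_mul hP.le]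
  have e1 : c ^ θ * c ^ (1 - θ) = c := by rw [← Real.rpow_add h]; simp
  have e2 : Λ ^ θ * Λ ^ (1 - θ) = Λ := by rw [← Real.rpow_add hΛ]; simp
  have e3 : P ^ (θ * x + (1 - θ) * y) = P ^ (x * θ) * P ^ (y * (1 - θ)) := by
    rw [← Real.rpow_add hP]; congr 1; ring
  rw [e3]
  calc _ = (c ^ θ * c ^ (1 - θ)) * ((Λ ^ θ * Λ ^ (1 - θ)) * (P ^ (x * θ) * P ^ (y * (1 - θ)))) := by ring
    _ = _ := by rw [e1, e2]

lemma Par.P1 {r M X p B : ℕ} {Δ Λ : ℝ} (h : Par r M X p B Δ Λ) : (1 : ℝ) < p := by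
  exact_mod_cast h.hp.one_lt

lemma cast_tri (r : ℕ) : ((r * (r - 1) / 2 : ℕ) : ℝ) = r * (r - 1) / 2 := by
  have h : 2 ∣ r * (r - 1) := (Nat.even_mul_pred_self r).two_dvd
  rw [Nat.cast_div h (by norm_num)]
  rcases r with _ | r
  · simp
  · push_cast; simp

/-- first bound -/
lemma H_zero {r M X p B : ℕ} [NeZero M] {Δ Λ : ℝ} (h : Par r M X p B Δ Λ) {a b : ℕ} (hab : a < b) (hb : b ≤ B)
    (ξ : Fin r → ℤ) (η : ℤ) :
    II M X p a b ξ η ≤ Λ * (p : ℝ) ^ (Dc r - ca r * a - (2 + Δ / 2) * b) := by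
  have hr := h.hr
  have hr' : (1 : ℝ) ≤ r := by exact_mod_cast hr
  have hP := h.P1
  have hP0 : (0 : ℝ) < p := by linarith
  have hΛ := h.hΛ
  have hΔ := h.hΔ
  set θ : ℝ := 1 / ((r : ℝ) + 2) with hθ
  have hθ0 : 0 < θ := by positivity
  have hθ1 : θ < 1 := by rw [hθ, div_lt_one (by positivity)]; linarith
  set c : ℝ := r * 4 ^ (r * (r + 2)) with hc
  have e4 : (0 : ℝ) ≤ 4 ^ (r * (r + 2)) := by positivity
  have hE1 : E (fun u : Fin (r + 1) → ZMod M => (∏ l, ‖f (cls X ((p : ℤ) ^ (a + 1)) (ξ l)) u‖ ^ 2) ^ (r + 2)) ≤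
      c * (Λ * (p : ℝ) ^ (-((a + 1 : ℕ) : ℝ) * (kap r + Δ))) := by
    calc _ ≤ E (fun u : Fin (r + 1) → ZMod M =>
              ∑ l, ‖f (cls X ((p : ℤ) ^ (a + 1)) (ξ l)) u‖ ^ (2 * (r * (r + 2)))) := by
              refine E_mono fun u => ?_
              rw [← prod_pow]
              refine (prod_le_sum_pow hr _ (fun l => by positivity)).trans (le_of_eq ?_)
              refine sum_congr rfl fun l _ => ?_
              rw [← pow_mul, ← pow_mul]
              congr 1; ring
      _ = ∑ l, E (fun u : Fin (r + 1) → ZMod M =>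
              ‖f (cls X ((p : ℤ) ^ (a + 1)) (ξ l)) u‖ ^ (2 * (r * (r + 2)))) := E_sum _ _
      _ ≤ ∑ _l : Fin r, 4 ^ (r * (r + 2)) * (Λ * (p : ℝ) ^ (-((a + 1 : ℕ) : ℝ) * (kap r + Δ))) := by
              refine sum_le_sum fun l _ => ?_
              rw [E_eq_Js h.hM _ (cls_sub _ _ _)]
              refine le_trans ?_ (h.hJ (a + 1) (by omega) (by omega))
              have := Js_cls_le (r + 1) (r * (r + 2)) X (p ^ (a + 1)) (pow_pos h.hp.pos _) (ξ l)
              push_cast at this ⊢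
              exact_mod_cast this
      _ = _ := by rw [sum_const, card_univ, Fintype.card_fin, nsmul_eq_mul, hc]; ring
  have hE2 : E (fun u : Fin (r + 1) → ZMod M => ‖f (cls X ((p : ℤ) ^ b) η) u‖ ^ (2 * (r * (r + 2)))) ≤
      c * (Λ * (p : ℝ) ^ (-(b : ℝ) * (kap r + Δ))) := by
    rw [E_eq_Js h.hM _ (cls_sub _ _ _)]
    have h1 := h.hJ b (by omega) hb
    have h2 := Js_cls_le (r + 1) (r * (r + 2)) X (p ^ b) (pow_pos h.hp.pos _) η
    have h3 : (Js (r + 1) (r * (r + 2)) (cls X ((p : ℤ) ^ b) η) : ℝ) ≤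
      Js (r + 1) (r * (r + 2)) (Icc 1 ((X / p ^ b + 1 : ℕ) : ℤ)) := by
      push_cast at h2 ⊢
      exact_mod_cast h2
    refine (h3.trans h1).trans ?_
    refine mul_le_mul_of_nonneg_right ?_ (by positivity)
    rw [hc]; nlinarith
  have hH := E_holder (g := fun u : Fin (r + 1) → ZMod M =>
      (∏ l, ‖f (cls X ((p : ℤ) ^ (a + 1)) (ξ l)) u‖ ^ 2) ^ (r + 2))
    (h := fun u => ‖f (cls X ((p : ℤ) ^ b) η) u‖ ^ (2 * (r * (r + 2))))
    (fun u => pow_nonneg (prod_nonneg fun l _ => by positivity) _) (fun u => by positivity)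
    hθ0 (sub_pos.2 hθ1) (by ring)
  have e5 : ∀ A y : ℝ, 0 ≤ A → 0 ≤ y → (A ^ (r + 2)) ^ θ * (y ^ (2 * (r * (r + 2)))) ^ (1 - θ) =
      A * y ^ (2 * (r * (r + 1))) := by
    intro A y hA hy
    rw [← Real.rpow_natCast A, ← Real.rpow_natCast y, ← Real.rpow_natCast y, ← Real.rpow_mul hA,
      ← Real.rpow_mul hy]
    have i1 : ((r + 2 : ℕ) : ℝ) * θ = 1 := by rw [hθ]; push_cast; field_simp
    have i2 : ((2 * (r * (r + 2)) : ℕ) : ℝ) * (1 - θ) = ((2 * (r * (r + 1)) : ℕ) : ℝ) := by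
      rw [hθ]; push_cast; field_simp; ring
    rw [i1, i2, Real.rpow_one]
  simp_rw [fun u : Fin (r + 1) → ZMod M => e5 (∏ l, ‖f (cls X ((p : ℤ) ^ (a + 1)) (ξ l)) u‖ ^ 2)
    ‖f (cls X ((p : ℤ) ^ b) η) u‖ (prod_nonneg fun l _ => by positivity) (norm_nonneg _)] at hH
  unfold II
  refine hH.trans ?_
  have n1 : 0 ≤ E (fun u : Fin (r + 1) → ZMod M =>
      (∏ l, ‖f (cls X ((p : ℤ) ^ (a + 1)) (ξ l)) u‖ ^ 2) ^ (r + 2)) :=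
    E_nonneg fun u => pow_nonneg (prod_nonneg fun l _ => by positivity) _
  have n2 : 0 ≤ E (fun u : Fin (r + 1) → ZMod M => ‖f (cls X ((p : ℤ) ^ b) η) u‖ ^ (2 * (r * (r + 2)))) :=
    E_nonneg fun u => by positivity
  refine (mul_le_mul (Real.rpow_le_rpow n1 hE1 hθ0.le) (Real.rpow_le_rpow n2 hE2 (sub_pos.2 hθ1).le)
    (Real.rpow_nonneg n2 _) (by positivity)).trans ?_
  rw [interp (by positivity) hΛ hP0 hθ0 hθ1]
  have hcP : c ≤ (p : ℝ) ^ (1 : ℝ) := by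
    rw [Real.rpow_one]
    refine le_trans ?_ h.c2
    have : (1 : ℝ) ≤ 2 ^ (2 * (r * (r + 1))) := one_le_pow₀ (by norm_num)
    have hc0 : 0 ≤ c := by positivity
    nlinarith [mul_nonneg (sub_nonneg.2 this) (mul_nonneg hc0 (by linarith : (0:ℝ) ≤ r)), mul_nonneg hc0 (sub_nonneg.2 hr')]
  calc c * (Λ * (p : ℝ) ^ (θ * (-((a + 1 : ℕ) : ℝ) * (kap r + Δ)) + (1 - θ) * (-(b : ℝ) * (kap r + Δ))))
      ≤ (p : ℝ) ^ (1 : ℝ) * (Λ * (p : ℝ) ^ (θ * (-((a + 1 : ℕ) : ℝ) * (kap r + Δ)) +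
        (1 - θ) * (-(b : ℝ) * (kap r + Δ)))) := mul_le_mul_of_nonneg_right hcP (by positivity)
    _ = Λ * (p : ℝ) ^ (1 + (θ * (-((a + 1 : ℕ) : ℝ) * (kap r + Δ)) +
        (1 - θ) * (-(b : ℝ) * (kap r + Δ)))) := by rw [Real.rpow_add hP0 1]; ring
    _ ≤ _ := by
      refine mul_le_mul_of_nonneg_left (Real.rpow_le_rpow_of_exponent_le hP.le ?_) hΛ.le
      have k1 : θ * kap r = (3 * r - 1) / 2 := by rw [hθ, kap]; field_simp
      have k2 : (1 - θ) * kap r = (r + 1) * (3 * r - 1) / 2 := by rw [hθ, kap]; field_simp; ring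
      have k3 : 1 / 2 ≤ 1 - θ := by
        have : θ ≤ 1 / 2 := by rw [hθ]; apply one_div_le_one_div_of_le <;> linarith
        linarith
      have hD : 1 ≤ Dc r := by unfold Dc; nlinarith
      have ha : (0 : ℝ) ≤ a := Nat.cast_nonneg a
      have hb0 : (0 : ℝ) ≤ b := Nat.cast_nonneg b
      have j1 : ca r * a ≤ (3 * r - 1) / 2 * a := by
        refine mul_le_mul_of_nonneg_right ?_ ha
        unfold ca; nlinarith
      have j2 : (2 + Δ / 2) * b ≤ ((1 - θ) * kap r + (1 - θ) * Δ) * b := by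
        refine mul_le_mul_of_nonneg_right ?_ hb0
        rw [k2]; nlinarith
      have j3 : 0 ≤ θ * kap r + θ * Δ * (a + 1) := by rw [k1]; have : 0 ≤ θ * Δ * (a + 1) := by positivity
                                                      linarith
      push_cast
      rw [← k1] at j1
      linarith

lemma kk_arith {r : ℕ} (hr' : (1 : ℝ) ≤ r) {a b g b' G Δ : ℝ} (hΔ : 0 < Δ) (hG : 2 + Δ / 2 ≤ G)
    (hg : 0 ≤ g) (hb'0 : 0 ≤ b') (f5 : b' = b + g) :
    (r * (r - 1) / 2 * (a + b')) + (((r + 1) * b' - (a + 1)) * r) +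
      (1 / ((r : ℝ) + 1) * (Dc r - ca r * b' - G * (((r : ℝ) + 1) * b')) +
          (1 - 1 / ((r : ℝ) + 1)) * (-(b' + 1) * (kap r + Δ))) ≤
      Dc r / 2 - ca r * a - (G + Δ / 2) * b - 2 * g := by
  have f4 : (r : ℝ) * (r - 1) / 2 + r * (r + 1) - 1 / ((r : ℝ) + 1) * ca r = (1 - 1 / ((r : ℝ) + 1)) * kap r := by
    rw [kap, ca]; field_simp; ring
  have hφk : 1 / ((r : ℝ) + 1) * (r + 1) = 1 := by field_simp
  have hφ0 : 0 < 1 / ((r : ℝ) + 1) := by positivity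
  have hφ2 : 1 / ((r : ℝ) + 1) ≤ 1 / 2 := by
    apply one_div_le_one_div_of_le <;> linarith
  have g5 : r * (r - 1) / 2 * (a + b') + ((r + 1) * b' - (a + 1)) * r =
      ((r : ℝ) * (r - 1) / 2 + r * (r + 1)) * b' - ca r * a - r := by rw [ca]; ring
  have hkap : 0 ≤ kap r := by unfold kap; apply div_nonneg _ (by norm_num); apply mul_nonneg <;> linarith
  have hD0 : 0 ≤ Dc r := by unfold Dc; positivity
  rw [g5]
  generalize 1 / ((r : ℝ) + 1) = φ at *
  generalize kap r = κ at *
  generalize Dc r = D at *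
  generalize ca r = A at *
  have g6 : ((r : ℝ) * (r - 1) / 2 + r * (r + 1) - φ * A) * b' = (1 - φ) * κ * b' := by rw [f4]
  have g1 : φ * D ≤ 1 / 2 * D := mul_le_mul_of_nonneg_right hφ2 hD0
  have g2 : 0 ≤ (1 - φ) * (κ + Δ) := mul_nonneg (by linarith) (by linarith)
  have g3 : 1 / 2 * (Δ * b') ≤ (1 - φ) * (Δ * b') :=
    mul_le_mul_of_nonneg_right (by linarith) (mul_nonneg hΔ.le hb'0)
  have g4 : φ * (G * ((r + 1) * b')) = G * b' := by linear_combination G * b' * hφk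
  have f6 : (2 : ℝ) * g ≤ (G + Δ / 2) * g := mul_le_mul_of_nonneg_right (by linarith) hg
  subst f5
  linarith

set_option maxHeartbeats 1000000 in
lemma H_step {r M X p B B1 : ℕ} [NeZero M] {Δ Λ G : ℝ} (h : Par r M X p B Δ Λ) (hB : B1 ≤ B)
    (hG : 2 + Δ / 2 ≤ G)
    (hH : ∀ a b : ℕ, a < b → b ≤ B1 → ∀ (ξ : Fin r → ℤ) (η : ℤ), Val p a ξ η →
      II M X p a b ξ η ≤ Λ * (p : ℝ) ^ (Dc r - ca r * a - G * b))
    {a b : ℕ} (hab : a < b) (hb : 2 * (r + 1) * b ≤ B1)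
    (ξ : Fin r → ℤ) (η : ℤ) (hV : Val p a ξ η) :
    II M X p a b ξ η ≤ Λ * (p : ℝ) ^ (Dc r - ca r * a - (G + Δ / 2) * b) := by
  have hr := h.hr
  have hr' : (1 : ℝ) ≤ r := by exact_mod_cast hr
  have hP := h.P1
  have hP0 : (0 : ℝ) < p := by linarith
  have hΛ := h.hΛ
  have hΔ := h.hΔ
  set c : ℝ := r * 4 ^ (r * (r + 2)) with hc
  have hc1 : 1 ≤ c := by
    have : (1 : ℝ) ≤ 4 ^ (r * (r + 2)) := one_le_pow₀ (by norm_num)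
    rw [hc]; nlinarith
  set U : ℝ := Dc r - ca r * a - (G + Δ / 2) * b with hU
  have claim : ∀ h' : ℕ, ∀ g, h' + g = b → ∀ η, Val p a ξ η →
      II M X p a (b + g) ξ η ≤ Λ * (p : ℝ) ^ (U - 2 * g) := by
    intro h'
    induction h' with
    | zero =>
      intro g hg η hV
      have := hH a (b + g) (by omega) (by nlinarith) ξ η hV
      refine this.trans ?_
      refine mul_le_mul_of_nonneg_left (Real.rpow_le_rpow_of_exponent_le hP.le ?_) hΛ.le
      have hgb : (g : ℝ) = b := by exact_mod_cast (by omega : g = b)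
      have hb0 : (0 : ℝ) ≤ b := Nat.cast_nonneg b
      push_cast
      rw [hgb, hU]
      nlinarith [mul_nonneg (sub_nonneg.2 hG) hb0]
    | succ h' ih =>
      intro g hg η hV
      set b' := b + g with hb'
      have hgb : g + 1 ≤ b := by omega
      have hY1 := ih (g + 1) (by omega)
      -- bound for KK
      set Y2 : ℝ := r * (c * (Λ * (p : ℝ) ^ (Dc r / 2 - ca r * a - (G + Δ / 2) * b - 2 * g))) with hY2
      have hK : ∀ η' : Fin r → ℤ, (∀ l, (p : ℤ) ^ b' ∣ η' l - η) →
          (∀ l m, l ≠ m → ¬ (p : ℤ) ^ (b' + 1) ∣ η' l - η' m) → KK M X p a b' ξ η' ≤ Y2 := by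
        intro η' h1 h2
        have hkb : (r + 1) * b' ≤ B1 := by
          calc (r + 1) * b' ≤ (r + 1) * (2 * b) := Nat.mul_le_mul_left _ (by omega)
            _ = 2 * (r + 1) * b := by ring
            _ ≤ B1 := hb
        have hb1 : b' + 1 ≤ B := by nlinarith
        have hbk : b' < (r + 1) * b' := by nlinarith
        set Ib : ℝ := c * (Λ * (p : ℝ) ^ (Dc r - ca r * b' - G * ((r + 1 : ℕ) * b' : ℝ))) with hIb
        set Jb : ℝ := 4 ^ (r * (r + 2)) * (Λ * (p : ℝ) ^ (-((b' + 1 : ℕ) : ℝ) * (kap r + Δ))) with hJb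
        have hk := KK_le hr h.hM h.hp h.hpk (by omega : a < b') ξ η hV η' h1 h2 Ib Jb (by
          intro η'' ζ hv
          refine (hH b' ((r + 1) * b') hbk hkb η'' ζ hv).trans ?_
          rw [hIb]
          push_cast
          exact le_mul_of_one_le_left (by positivity) hc1) (h.hJ (b' + 1) (by omega) hb1)
        refine hk.trans ?_
        have hrJ : r * Jb = c * (Λ * (p : ℝ) ^ (-((b' + 1 : ℕ) : ℝ) * (kap r + Δ))) := by
          rw [hJb, hc]; ring
        have hk0 : (0 : ℝ) < ((r + 1 : ℕ) : ℝ) := by positivity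
        have hθ1 : 1 / ((r + 1 : ℕ) : ℝ) < 1 := by
          rw [div_lt_one hk0]; push_cast; linarith
        rw [hrJ, hIb, interp (by linarith) hΛ hP0 (by positivity) hθ1, hY2]
        have hle : a + 1 ≤ (r + 1) * b' := by nlinarith
        rw [← Real.rpow_natCast (p : ℝ) (r * (r - 1) / 2 * (a + b')),
          ← Real.rpow_natCast (p : ℝ) (((r + 1) * b' - (a + 1)) * r)]
        have e : ∀ x1 x2 x3 : ℝ, (p : ℝ) ^ x1 * ((p : ℝ) ^ x2 * (r * (c * (Λ * (p : ℝ) ^ x3)))) =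
            r * (c * (Λ * (p : ℝ) ^ (x1 + x2 + x3))) := by
          intro x1 x2 x3
          rw [Real.rpow_add hP0 (x1 + x2) x3, Real.rpow_add hP0 x1 x2]; ring
        rw [e]
        refine mul_le_mul_of_nonneg_left (mul_le_mul_of_nonneg_left (mul_le_mul_of_nonneg_left
          (Real.rpow_le_rpow_of_exponent_le hP.le ?_) hΛ.le) (by linarith)) (by linarith)
        have f1 : ((r * (r - 1) / 2 * (a + b') : ℕ) : ℝ) = r * (r - 1) / 2 * (a + b') := by
          rw [Nat.cast_mul, cast_tri]; push_cast; ring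
        have f2 : ((((r + 1) * b' - (a + 1)) * r : ℕ) : ℝ) = ((r + 1) * b' - (a + 1)) * r := by
          rw [Nat.cast_mul, Nat.cast_sub hle]; push_cast; ring
        have f5 : (b' : ℝ) = b + g := by rw [hb']; push_cast; ring
        have := kk_arith hr' (a := a) hΔ hG (Nat.cast_nonneg g) (Nat.cast_nonneg b') f5
        rw [f1, f2]
        have k1 : ((r + 1 : ℕ) : ℝ) = r + 1 := by push_cast; ring
        have k2 : ((b' + 1 : ℕ) : ℝ) = b' + 1 := by push_cast; ring
        rw [k1, k2]
        exact this
      have hY20 : 0 ≤ Y2 := by rw [hY2]; positivity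
      have hs := step_I hr h.hp.pos (by omega : 0 < b') ξ η hV _ Y2 (by positivity) hY20 hY1 hK
      refine hs.trans ?_
      set s2 := 2 * (r * (r + 1)) with hs2
      set W : ℝ := Λ * (p : ℝ) ^ (U - 2 * g) with hW
      have hW0 : 0 ≤ W := by positivity
      have t1 : (2 * (r : ℝ)) ^ s2 * (p * (Λ * (p : ℝ) ^ (U - 2 * ((g + 1 : ℕ) : ℝ)))) ≤ W / 2 := by
        have : (p : ℝ) ^ (U - 2 * ((g + 1 : ℕ) : ℝ)) = (p : ℝ) ^ (U - 2 * g) / (p * p) := by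
          rw [← sq, ← Real.rpow_natCast, ← Real.rpow_sub hP0]
          congr 1; push_cast; ring
        rw [this, hW]
        have h5 := h.c1
        have : (2 * (r : ℝ)) ^ s2 * (p * (Λ * ((p : ℝ) ^ (U - 2 * g) / (p * p)))) =
            ((2 * (r : ℝ)) ^ s2 / p) * (Λ * (p : ℝ) ^ (U - 2 * g)) := by field_simp
        rw [this, div_eq_mul_inv _ (2 : ℝ), mul_comm (Λ * (p : ℝ) ^ (U - 2 * g)) _]
        refine mul_le_mul_of_nonneg_right ?_ hW0
        rw [div_le_iff₀ hP0]
        linarith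
      have t2 : (2 * (p : ℝ)) ^ s2 * (p ^ r * Y2) ≤ W / 2 := by
        have e1 : (2 * (p : ℝ)) ^ s2 * (p ^ r * Y2) = (2 ^ s2 * (r * c)) *
            (Λ * (p : ℝ) ^ ((s2 : ℝ) + r + (Dc r / 2 - ca r * a - (G + Δ / 2) * b - 2 * g))) := by
          rw [Real.rpow_add hP0, Real.rpow_add hP0, Real.rpow_natCast, Real.rpow_natCast, hY2]; ring
        have e2 : (s2 : ℝ) + r + (Dc r / 2 - ca r * a - (G + Δ / 2) * b - 2 * g) = (U - 2 * g) - 1 := by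
          rw [hU, Dc, hs2]; push_cast; ring
        rw [e1, e2, Real.rpow_sub_one hP0.ne']
        have h5 := h.c2
        have : (2 ^ s2 * (r * c)) * (Λ * ((p : ℝ) ^ (U - 2 * g) / p)) = (2 ^ s2 * (r * c) / p) * W := by
          rw [hW]; field_simp
        rw [this, div_eq_mul_inv W (2 : ℝ), mul_comm W]
        refine mul_le_mul_of_nonneg_right ?_ hW0
        rw [div_le_iff₀ hP0]
        linarith
      linarith
  have := claim b 0 (by omega) η hV
  simpa using this

end VMV


namespace VMV
open Finset

lemma H_iter {r M X p m : ℕ} [NeZero M] {Δ Λ : ℝ} (h : Par r M X p ((2 * (r + 1)) ^ m) Δ Λ) (n : ℕ) :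
    n ≤ m → ∀ a b : ℕ, a < b → b ≤ (2 * (r + 1)) ^ (m - n) → ∀ (ξ : Fin r → ℤ) (η : ℤ), Val p a ξ η →
      II M X p a b ξ η ≤ Λ * (p : ℝ) ^ (Dc r - ca r * a - (2 + (n + 1) * (Δ / 2)) * b) := by
  induction n with
  | zero =>
    intro _ a b hab hb ξ η _
    have := H_zero h hab hb ξ η
    simpa using this
  | succ n ih =>
    intro hn a b hab hb ξ η hV
    have h1 : 2 * (r + 1) * b ≤ (2 * (r + 1)) ^ (m - n) := by
      have : m - n = (m - (n + 1)) + 1 := by omega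
      rw [this, pow_succ, mul_comm ((2 * (r + 1)) ^ _)]
      exact Nat.mul_le_mul_left _ hb
    have hd := h.hΔ
    have hn0 : (0 : ℝ) ≤ n := Nat.cast_nonneg n
    have := H_step h (Nat.pow_le_pow_right (by omega) (Nat.sub_le m n)) (G := 2 + (n + 1) * (Δ / 2))
      (by nlinarith) (ih (by omega)) hab h1 ξ η hV
    refine this.trans (le_of_eq ?_)
    congr 3
    push_cast; ring

lemma Js_final {r M X p m : ℕ} [NeZero M] {Δ Λ : ℝ} (h : Par r M X p ((2 * (r + 1)) ^ m) Δ Λ)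
    (hm : Dc r + 2 * (r * (r + 2)) + r + 3 ≤ 2 + (m + 1) * (Δ / 2)) :
    (Js (r + 1) (r * (r + 2)) (Icc 1 X) : ℝ) ≤ Λ / p := by
  have hP := h.P1
  have hP0 : (0 : ℝ) < p := by linarith
  have hΛ := h.hΛ
  have hΔ := h.hΔ
  have hr := h.hr
  have hr' : (1 : ℝ) ≤ r := by exact_mod_cast hr
  set t := r * (r + 2) with ht
  have h1 : ∀ (ξ : Fin r → ℤ) (η : ℤ), Val p 0 ξ η → II M X p 0 1 ξ η ≤
      Λ * (p : ℝ) ^ (Dc r - (2 + (m + 1) * (Δ / 2))) := by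
    intro ξ η hV
    have := H_iter h m le_rfl 0 1 (by omega) (by simp) ξ η hV
    simpa using this
  have hs := step_start (M := M) (X := X) (r := r) (p := p) hr h.hM h.hp.pos _ (by positivity) h1
  have hj := h.hJ 1 le_rfl (Nat.one_le_pow _ _ (by omega))
  rw [pow_one] at hj
  have hkap : 3 ≤ kap r := by unfold kap; nlinarith
  have e1 : (p : ℝ) ^ (-((1 : ℕ) : ℝ) * (kap r + Δ)) ≤ 1 / (p * p * p) := by
    calc (p : ℝ) ^ (-((1 : ℕ) : ℝ) * (kap r + Δ)) ≤ (p : ℝ) ^ (-3 : ℝ) :=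
          Real.rpow_le_rpow_of_exponent_le hP.le (by push_cast; linarith)
      _ = 1 / (p * p * p) := by
          rw [Real.rpow_neg hP0.le, one_div]; congr 1
          rw [show (3 : ℝ) = ((3 : ℕ) : ℝ) by norm_num, Real.rpow_natCast]; ring
  have e2 : (2 * (p : ℝ)) ^ (2 * t) * (p ^ (r + 1) * (Λ * (p : ℝ) ^ (Dc r - (2 + (m + 1) * (Δ / 2))))) ≤
      2 ^ (2 * t) * (Λ * (1 / (p * p))) := by
    calc _ = 2 ^ (2 * t) * (Λ * (p : ℝ) ^ (((2 * t : ℕ) : ℝ) + ((r + 1 : ℕ) : ℝ) + (Dc r - (2 + (m + 1) * (Δ / 2))))) := by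
          rw [Real.rpow_add hP0 (((2 * t : ℕ) : ℝ) + ((r + 1 : ℕ) : ℝ)), Real.rpow_add hP0,
            Real.rpow_natCast, Real.rpow_natCast]; ring
      _ ≤ 2 ^ (2 * t) * (Λ * (p : ℝ) ^ (-2 : ℝ)) := by
          refine mul_le_mul_of_nonneg_left (mul_le_mul_of_nonneg_left
            (Real.rpow_le_rpow_of_exponent_le hP.le ?_) hΛ.le) (by positivity)
          rw [ht]; push_cast; linarith
      _ = _ := by
          congr 2
          rw [Real.rpow_neg hP0.le, one_div]; congr 1
          rw [show (2 : ℝ) = ((2 : ℕ) : ℝ) by norm_num, Real.rpow_natCast]; ring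
  have e3 : (2 * ((r : ℝ) + 1)) ^ (2 * t) * (p * (Js (r + 1) t (Icc 1 ((X / p + 1 : ℕ) : ℤ)) : ℝ)) ≤
      (2 * ((r : ℝ) + 1)) ^ (2 * t) * (p * (4 ^ t * (Λ * (1 / (p * p * p))))) := by
    refine mul_le_mul_of_nonneg_left (mul_le_mul_of_nonneg_left (hj.trans ?_) hP0.le) (by positivity)
    exact mul_le_mul_of_nonneg_left (mul_le_mul_of_nonneg_left e1 hΛ.le) (by positivity)
  have e4 : (2 * ((r : ℝ) + 1)) ^ (2 * t) * (p * (4 ^ t * (Λ * (1 / (p * p * p))))) =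
      (((2 * ((r : ℝ) + 1)) ^ (2 * t) * 4 ^ t) / p) * (Λ / p) := by field_simp
  have e5 : (2 : ℝ) ^ (2 * t) * (Λ * (1 / (p * p))) = (2 ^ (2 * t) / p) * (Λ / p) := by field_simp
  have hL : 0 ≤ Λ / p := by positivity
  have e6 : (((2 * ((r : ℝ) + 1)) ^ (2 * t) * 4 ^ t) / p) ≤ 1 / 2 := by
    rw [div_le_iff₀ hP0]; have := h.c3; linarith
  have e7 : ((2 : ℝ) ^ (2 * t) / p) ≤ 1 / 2 := by
    rw [div_le_iff₀ hP0]; have := h.c4; linarith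
  have e8 := mul_le_mul_of_nonneg_right e6 hL
  have e9 := mul_le_mul_of_nonneg_right e7 hL
  rw [e4] at e3; rw [e5] at e2
  linarith

def Adm (r : ℕ) (Δ : ℝ) : Prop := ∃ C : ℝ, 1 ≤ C ∧ ∀ Y : ℕ, 1 ≤ Y →
  (Js (r + 1) (r * (r + 2)) (Icc 1 (Y : ℤ)) : ℝ) ≤ C * (Y : ℝ) ^ (kap r + Δ)

lemma Adm_mono {r : ℕ} {Δ Δ' : ℝ} (h : Δ ≤ Δ') (hA : Adm r Δ) : Adm r Δ' := by
  obtain ⟨C, hC, h1⟩ := hA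
  refine ⟨C, hC, fun Y hY => (h1 Y hY).trans ?_⟩
  exact mul_le_mul_of_nonneg_left (Real.rpow_le_rpow_of_exponent_le (by exact_mod_cast hY) (by linarith))
    (by linarith)

lemma Js_triv (k t Y : ℕ) : (Js k t (Icc 1 (Y : ℤ)) : ℝ) ≤ (Y : ℝ) ^ (2 * t) := by
  have : Js k t (Icc 1 (Y : ℤ)) ≤ Y ^ (2 * t) := by
    unfold Js
    refine (card_filter_le _ _).trans ?_
    rw [card_product]
    simp [Fintype.card_piFinset]
    rw [two_mul, pow_add]
  exact_mod_cast this

lemma kap_add (r : ℕ) : kap r + ((r : ℝ) + 1) * (r + 2) / 2 = ((2 * (r * (r + 2)) : ℕ) : ℝ) := by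
  unfold kap; push_cast; ring

lemma Adm_start (r : ℕ) : Adm r (((r : ℝ) + 1) * (r + 2) / 2) := by
  refine ⟨1, le_rfl, fun Y hY => ?_⟩
  rw [kap_add, Real.rpow_natCast, one_mul]
  exact Js_triv _ _ _

/-- size of prime needed -/
noncomputable def P0 (r : ℕ) : ℝ := (r + 2) + 2 * (2 * (r : ℝ)) ^ (2 * (r * (r + 1))) +
  2 * (2 : ℝ) ^ (2 * (r * (r + 1))) * (r * (r * 4 ^ (r * (r + 2)))) +
  2 * ((2 * ((r : ℝ) + 1)) ^ (2 * (r * (r + 2))) * 4 ^ (r * (r + 2))) + 2 * (2 : ℝ) ^ (2 * (r * (r + 2)))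

lemma one_step {r X p m : ℕ} {Δ C : ℝ} (hr : 0 < r) (hp : p.Prime) (hP : P0 r ≤ p) (hX : 1 ≤ X)
    (hΔ : 0 < Δ) (hΔK : Δ ≤ ((r : ℝ) + 1) * (r + 2) / 2) (hC : 1 ≤ C)
    (hA : ∀ Y : ℕ, 1 ≤ Y → (Js (r + 1) (r * (r + 2)) (Icc 1 (Y : ℤ)) : ℝ) ≤ C * (Y : ℝ) ^ (kap r + Δ))
    (hm : Dc r + 2 * (r * (r + 2)) + r + 3 ≤ 2 + (m + 1) * (Δ / 2))
    (hpX : p ^ ((2 * (r + 1)) ^ m) ≤ X) :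
    (Js (r + 1) (r * (r + 2)) (Icc 1 X) : ℝ) ≤ C * (X : ℝ) ^ (kap r + Δ) / p := by
  have hX0 : (0 : ℝ) < X := by exact_mod_cast hX
  have hp0 : (0 : ℝ) < p := by exact_mod_cast hp.pos
  have hr' : (1 : ℝ) ≤ r := by exact_mod_cast hr
  have q1 : 0 ≤ 2 * (2 * (r : ℝ)) ^ (2 * (r * (r + 1))) := by positivity
  have q2 : 0 ≤ 2 * (2 : ℝ) ^ (2 * (r * (r + 1))) * (r * (r * 4 ^ (r * (r + 2)))) := by positivity
  have q3 : 0 ≤ 2 * ((2 * ((r : ℝ) + 1)) ^ (2 * (r * (r + 2))) * 4 ^ (r * (r + 2))) := by positivity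
  have q4 : 0 ≤ 2 * (2 : ℝ) ^ (2 * (r * (r + 2))) := by positivity
  unfold P0 at hP
  have hkap : 3 ≤ kap r := by unfold kap; nlinarith
  refine Js_final (M := r * (r + 2) * X ^ (r + 1) + 1) (m := m) (Δ := Δ)
    ⟨hr, Nat.lt_succ_self _, hp, ?_, hΔ, by positivity, ?_, by linarith, by linarith, by linarith, by linarith⟩ hm
  · have : ((r + 1 : ℕ) : ℝ) < p := by push_cast; linarith
    exact_mod_cast this
  · intro c hc1 hcB
    have hpc : p ^ c ≤ X := (Nat.pow_le_pow_right hp.pos hcB).trans hpX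
    have hpc' : ((p : ℝ) ^ c) ≤ X := by exact_mod_cast hpc
    refine (hA _ (Nat.le_add_left 1 _)).trans ?_
    have hpc0 : (0 : ℝ) < (p : ℝ) ^ c := by positivity
    have g1 : ((X / p ^ c + 1 : ℕ) : ℝ) ≤ 2 * (X / (p : ℝ) ^ c) := by
      have a1 : ((X / p ^ c : ℕ) : ℝ) ≤ (X : ℝ) / ((p ^ c : ℕ) : ℝ) := Nat.cast_div_le
      have a2 : 1 ≤ (X : ℝ) / (p : ℝ) ^ c := by rw [le_div_iff₀ hpc0]; linarith
      push_cast at a1 ⊢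
      linarith
    have g2 : ((X / p ^ c + 1 : ℕ) : ℝ) ^ (kap r + Δ) ≤ 4 ^ (r * (r + 2)) *
        ((X : ℝ) ^ (kap r + Δ) * (p : ℝ) ^ (-(c : ℝ) * (kap r + Δ))) := by
      refine (Real.rpow_le_rpow (Nat.cast_nonneg _) g1 (by linarith)).trans ?_
      rw [Real.mul_rpow (by norm_num) (by positivity), Real.div_rpow hX0.le hpc0.le]
      have : ((p : ℝ) ^ c) ^ (kap r + Δ) = ((p : ℝ) ^ (-(c : ℝ) * (kap r + Δ)))⁻¹ := by
        rw [← Real.rpow_natCast, ← Real.rpow_mul hp0.le, ← Real.rpow_neg hp0.le]; congr 1; ring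
      rw [this, div_inv_eq_mul]
      refine mul_le_mul_of_nonneg_right ?_ (by positivity)
      have hk := kap_add r
      calc (2 : ℝ) ^ (kap r + Δ) ≤ 2 ^ (((2 * (r * (r + 2)) : ℕ) : ℝ)) :=
            Real.rpow_le_rpow_of_exponent_le (by norm_num) (by linarith)
        _ = 4 ^ (r * (r + 2)) := by rw [Real.rpow_natCast, pow_mul]; norm_num
    calc _ ≤ C * (4 ^ (r * (r + 2)) *
        ((X : ℝ) ^ (kap r + Δ) * (p : ℝ) ^ (-(c : ℝ) * (kap r + Δ)))) :=
          mul_le_mul_of_nonneg_left g2 (by linarith)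
      _ = _ := by ring

lemma Adm_step {r m : ℕ} {Δ : ℝ} (hr : 0 < r) (hΔ : 0 < Δ) (hΔK : Δ ≤ ((r : ℝ) + 1) * (r + 2) / 2)
    (hm : Dc r + 2 * (r * (r + 2)) + r + 3 ≤ 2 + (m + 1) * (Δ / 2)) (hA : Adm r Δ) :
    Adm r (Δ - 1 / ((2 * (r + 1)) ^ m : ℕ)) := by
  obtain ⟨C, hC, hA⟩ := hA
  set B := (2 * (r + 1)) ^ m with hB
  have hB1 : 1 ≤ B := Nat.one_le_pow _ _ (by omega)
  have hB1' : (1 : ℝ) ≤ B := by exact_mod_cast hB1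
  have hinv : 1 / (B : ℝ) ≤ 1 := by rw [div_le_one (by linarith)]; exact hB1'
  have hkap : 3 ≤ kap r := by
    have hr' : (1 : ℝ) ≤ r := by exact_mod_cast hr
    unfold kap; nlinarith
  -- threshold
  set z0 : ℕ := 2 * (⌈P0 r⌉₊ + 1) with hz0
  set X0 : ℕ := z0 ^ B with hX0
  have hX01 : (1 : ℝ) ≤ (X0 : ℝ) ^ (2 * (r * (r + 2))) := by
    apply one_le_pow₀
    have : 1 ≤ X0 := Nat.one_le_pow _ _ (by omega)
    exact_mod_cast this
  refine ⟨4 * C + (X0 : ℝ) ^ (2 * (r * (r + 2))), by linarith, fun X hX => ?_⟩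
  have hXp : (1 : ℝ) ≤ X := by exact_mod_cast hX
  have hX0' : (0 : ℝ) < X := by linarith
  have hexp : 0 ≤ kap r + (Δ - 1 / (B : ℝ)) := by linarith
  have hpos : 1 ≤ (X : ℝ) ^ (kap r + (Δ - 1 / (B : ℝ))) := Real.one_le_rpow hXp hexp
  rcases lt_or_ge X X0 with hlt | hge
  · refine (Js_triv _ _ _).trans ?_
    have : (X : ℝ) ^ (2 * (r * (r + 2))) ≤ (X0 : ℝ) ^ (2 * (r * (r + 2))) :=
      pow_le_pow_left₀ hX0'.le (by exact_mod_cast hlt.le) _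
    nlinarith
  · -- z = floor of X^(1/B)
    set w : ℝ := (X : ℝ) ^ (1 / (B : ℝ)) with hw
    have hw0 : 0 < w := Real.rpow_pos_of_pos hX0' _
    have hwB : w ^ B = X := by
      rw [hw, ← Real.rpow_natCast, ← Real.rpow_mul hX0'.le, one_div_mul_cancel (by linarith), Real.rpow_one]
    have hzw : (z0 : ℝ) ≤ w := by
      by_contra hcon
      push Not at hcon
      have : w ^ B < (z0 : ℝ) ^ B := pow_lt_pow_left₀ hcon hw0.le (by omega)
      rw [hwB] at this
      have : (X : ℝ) < X0 := by rw [hX0]; push_cast; exact this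
      have : X < X0 := by exact_mod_cast this
      omega
    set y : ℕ := ⌊w / 2⌋₊ with hy
    have hyle : (y : ℝ) ≤ w / 2 := Nat.floor_le (by positivity)
    have hygt : w / 2 < y + 1 := Nat.lt_floor_add_one _
    have hz0' : (z0 : ℝ) = 2 * (⌈P0 r⌉₊ + 1) := by rw [hz0]; push_cast; ring
    have hy1 : (⌈P0 r⌉₊ : ℝ) < y := by
      by_contra hcon
      push Not at hcon
      have : (y : ℝ) + 1 ≤ ⌈P0 r⌉₊ + 1 := by linarith
      linarith
    have hyP : P0 r ≤ y := (Nat.le_ceil _).trans hy1.le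
    have hy0 : y ≠ 0 := by
      rintro h0
      rw [h0] at hy1
      have : (0 : ℝ) ≤ ⌈P0 r⌉₊ := Nat.cast_nonneg _
      push_cast at hy1; linarith
    obtain ⟨p, hp, hyp, hp2⟩ := Nat.exists_prime_lt_and_le_two_mul y hy0
    have hypr : (y : ℝ) + 1 ≤ p := by exact_mod_cast hyp
    have hp2r : (p : ℝ) ≤ 2 * y := by exact_mod_cast hp2
    have hpw : (p : ℝ) ≤ w := by linarith
    have hpX : p ^ B ≤ X := by
      have : (p : ℝ) ^ B ≤ X := by rw [← hwB]; exact pow_le_pow_left₀ (Nat.cast_nonneg _) hpw _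
      exact_mod_cast this
    have := one_step hr hp (by linarith) hX hΔ hΔK hC hA hm hpX
    refine this.trans ?_
    have hpp : w / 2 ≤ p := by linarith
    calc C * (X : ℝ) ^ (kap r + Δ) / p ≤ C * (X : ℝ) ^ (kap r + Δ) / (w / 2) := by
          apply div_le_div_of_nonneg_left (by positivity) (by positivity) hpp
      _ = 2 * C * (X : ℝ) ^ (kap r + (Δ - 1 / (B : ℝ))) := by
          have : (X : ℝ) ^ (kap r + (Δ - 1 / (B : ℝ))) = (X : ℝ) ^ (kap r + Δ) / w := by
            rw [hw, ← Real.rpow_sub hX0']; congr 1; ring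
          rw [this]; field_simp
      _ ≤ _ := by
          refine mul_le_mul_of_nonneg_right ?_ (by linarith)
          linarith

theorem Adm_all {r : ℕ} (hr : 0 < r) {Δ : ℝ} (hΔ : 0 < Δ) : Adm r Δ := by
  set K : ℝ := ((r : ℝ) + 1) * (r + 2) / 2 with hK
  rcases le_or_gt K Δ with h | h
  · exact Adm_mono h (Adm_start r)
  obtain ⟨m, hm⟩ := exists_nat_ge ((Dc r + 2 * (r * (r + 2)) + r + 3) / (Δ / 2))
  rw [div_le_iff₀ (by positivity)] at hm
  set B := (2 * (r + 1)) ^ m with hB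
  have hB1 : 1 ≤ B := Nat.one_le_pow _ _ (by omega)
  have hB1' : (1 : ℝ) ≤ B := by exact_mod_cast hB1
  have key : ∀ n : ℕ, Adm r (max Δ (K - n / B)) := by
    intro n
    induction n with
    | zero => simp only [Nat.cast_zero, zero_div, sub_zero]; exact Adm_mono (le_max_right _ _) (Adm_start r)
    | succ n ih =>
      have h0 : (0 : ℝ) ≤ n / B := by positivity
      have := Adm_step (m := m) hr (lt_max_of_lt_left hΔ) (max_le h.le (by linarith)) (by
        have : (m : ℝ) * (Δ / 2) ≤ m * (max Δ (K - n / B) / 2) :=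
          mul_le_mul_of_nonneg_left (by linarith [le_max_left Δ (K - n / B)]) (Nat.cast_nonneg _)
        have h2 := le_max_left Δ (K - n / B)
        linarith) ih
      refine Adm_mono ?_ this
      rw [← hB]
      have h1 : 0 < 1 / (B : ℝ) := by positivity
      have : ((n + 1 : ℕ) : ℝ) / B = n / B + 1 / B := by push_cast; ring
      rw [this, sub_le_iff_le_add]
      refine max_le ?_ ?_
      · linarith [le_max_left Δ (K - (n / B + 1 / B))]
      · linarith [le_max_right Δ (K - (n / B + 1 / B))]
  obtain ⟨n, hn⟩ := exists_nat_ge (K * B)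
  have := key n
  rwa [max_eq_left] at this
  have : K ≤ n / B := by rw [le_div_iff₀ (by linarith)]; exact hn
  linarith

end VMV


namespace VMV
open Finset
open scoped ComplexConjugate

lemma sum_char_lower {M : ℕ} [NeZero M] (L : ℕ) (ν : ℤ) (h0 : 0 ≤ ν) (h : 8 * (L * ν) ≤ M) :
    (L : ℝ) / 2 ≤ ‖∑ θ ∈ range L, ZMod.stdAddChar (((θ : ℤ) * ν : ℤ) : ZMod M)‖ := by
  have hM : (0 : ℝ) < M := by exact_mod_cast Nat.pos_of_ne_zero (NeZero.ne M)
  refine le_trans ?_ (Complex.re_le_norm _)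
  rw [Complex.re_sum]
  have : ∀ θ ∈ range L, (1 / 2 : ℝ) ≤ (ZMod.stdAddChar (((θ : ℤ) * ν : ℤ) : ZMod M) : ℂ).re := by
    intro θ hθ
    rw [ZMod.stdAddChar_coe]
    have e : (2 * (Real.pi : ℂ) * Complex.I * ((θ : ℤ) * ν : ℤ) / (M : ℂ)) =
        ((2 * Real.pi * (θ * ν / M) : ℝ) : ℂ) * Complex.I := by push_cast; ring
    rw [e, Complex.exp_ofReal_mul_I_re, ← Real.cos_pi_div_three]
    have hθL : (θ : ℝ) ≤ L := by exact_mod_cast (mem_range.1 hθ).le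
    have hν : (0 : ℝ) ≤ ν := by exact_mod_cast h0
    have h' : 8 * ((L : ℝ) * ν) ≤ M := by exact_mod_cast h
    have h1 : (θ : ℝ) * ν / M ≤ 1 / 8 := by
      rw [div_le_iff₀ hM]
      have := mul_le_mul_of_nonneg_right hθL hν
      linarith
    have h2 : 0 ≤ (θ : ℝ) * ν / M := by positivity
    have hpi := Real.pi_pos
    refine Real.cos_le_cos_of_nonneg_of_le_pi (by positivity) (by linarith) ?_
    nlinarith
  calc (L : ℝ) / 2 = ∑ θ ∈ range L, (1 / 2 : ℝ) := by simp; ring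
    _ ≤ _ := sum_le_sum this

section
variable {d M : ℕ} [NeZero M]

/-- box sums -/
lemma box_sum (L : Fin d → ℕ) (ν : Fin d → ℤ) :
    ∑ θ ∈ Fintype.piFinset (fun j => range (L j)), ch ν (fun j => ((θ j : ℕ) : ZMod M)) =
      ∏ j, ∑ θ ∈ range (L j), (ZMod.stdAddChar (((θ : ℤ) * ν j : ℤ) : ZMod M) : ℂ) := by
  rw [prod_univ_sum]
  refine sum_congr rfl fun θ _ => ?_
  unfold ch
  have key : ∀ (s : Finset (Fin d)) (g : Fin d → ZMod M), (ZMod.stdAddChar (∑ j ∈ s, g j) : ℂ) =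
      ∏ j ∈ s, ZMod.stdAddChar (g j) := by
    intro s g
    induction s using Finset.induction_on with
    | empty => simp
    | insert i s hi ih => rw [sum_insert hi, prod_insert hi, AddChar.map_add_eq_mul, ih]
  rw [key]
  refine prod_congr rfl fun j _ => ?_
  push_cast; rfl

lemma box_lower (L : Fin d → ℕ) (ν : Fin d → ℤ) (h0 : ∀ j, 0 ≤ ν j) (h : ∀ j, 8 * (L j * ν j) ≤ M) :
    (∏ j, (L j : ℝ)) / 2 ^ d ≤
      ‖∑ θ ∈ Fintype.piFinset (fun j => range (L j)), ch ν (fun j => ((θ j : ℕ) : ZMod M))‖ := by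
  rw [box_sum, norm_prod]
  calc (∏ j, (L j : ℝ)) / 2 ^ d = ∏ j, ((L j : ℝ) / 2) := by
        rw [prod_div_distrib]; simp
    _ ≤ _ := prod_le_prod (fun j _ => by positivity) fun j _ => sum_char_lower _ _ (h0 j) (h j)

lemma parseval {t X : ℕ} (hM : t * X ^ d < M) (b : (Fin t → ℤ) → ℂ) (c : ℝ) (hb : ∀ x, ‖b x‖ ≤ c) :
    ∑ v : Fin d → ZMod M, ‖∑ x ∈ Fintype.piFinset (fun _ : Fin t => Icc (1 : ℤ) X),
      b x * ch (∑ i, pw d (x i)) v‖ ^ 2 ≤ (M : ℝ) ^ d * (c ^ 2 * Js d t (Icc 1 (X : ℤ))) := by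
  set S := Fintype.piFinset (fun _ : Fin t => Icc (1 : ℤ) X) with hS
  have e1 : ∀ v : Fin d → ZMod M, (((‖∑ x ∈ S, b x * ch (∑ i, pw d (x i)) v‖ ^ 2 : ℝ)) : ℂ) =
      ∑ z ∈ S ×ˢ S, b z.1 * conj (b z.2) * ch (∑ i, pw d (z.1 i) - ∑ i, pw d (z.2 i)) v := by
    intro v
    rw [← Complex.normSq_eq_norm_sq, ← Complex.mul_conj, map_sum, sum_mul_sum, ← sum_product']
    refine sum_congr rfl fun z _ => ?_
    rw [map_mul, sub_eq_add_neg, ch_add, ch_neg]; ring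
  have e2 : ((∑ v : Fin d → ZMod M, ‖∑ x ∈ S, b x * ch (∑ i, pw d (x i)) v‖ ^ 2 : ℝ) : ℂ) =
      ∑ z ∈ S ×ˢ S, b z.1 * conj (b z.2) *
        ∑ v : Fin d → ZMod M, ch (∑ i, pw d (z.1 i) - ∑ i, pw d (z.2 i)) v := by
    rw [Complex.ofReal_sum]
    simp_rw [e1]
    rw [sum_comm]
    simp_rw [mul_sum]
  have e3 : ∀ z ∈ S ×ˢ S, ‖b z.1 * conj (b z.2) *
        ∑ v : Fin d → ZMod M, ch (∑ i, pw d (z.1 i) - ∑ i, pw d (z.2 i)) v‖ ≤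
      if ∑ i, pw d (z.1 i) = ∑ i, pw d (z.2 i) then (M : ℝ) ^ d * c ^ 2 else 0 := by
    intro z hz
    rw [mem_product, hS, Fintype.mem_piFinset, Fintype.mem_piFinset] at hz
    have hc : 0 ≤ c := (norm_nonneg _).trans (hb z.1)
    split_ifs with h
    · rw [h, sub_self, sum_ch_zero _ (by simp), norm_mul, norm_mul, Complex.norm_conj]
      have : ‖b z.1‖ * ‖b z.2‖ ≤ c * c := mul_le_mul (hb _) (hb _) (norm_nonneg _) hc
      have hn : ‖(M : ℂ) ^ d‖ = (M : ℝ) ^ d := by simp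
      rw [hn]
      calc _ ≤ c * c * (M : ℝ) ^ d := mul_le_mul_of_nonneg_right this (by positivity)
        _ = _ := by ring
    · rw [sum_ch_ne]
      · simp
      · by_contra hcon
        push Not at hcon
        apply h
        refine nowrap (k := d) (M := M) (ι := Fin t) (X := X) (by simpa using hM) z.1 z.2
          (fun i => ?_) (fun i => ?_) hcon
        · have := mem_Icc.1 (hz.1 i); omega
        · have := mem_Icc.1 (hz.2 i); omega
  have e4 : (∑ v : Fin d → ZMod M, ‖∑ x ∈ S, b x * ch (∑ i, pw d (x i)) v‖ ^ 2) =
      ‖((∑ v : Fin d → ZMod M, ‖∑ x ∈ S, b x * ch (∑ i, pw d (x i)) v‖ ^ 2 : ℝ) : ℂ)‖ := by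
    rw [Complex.norm_real, Real.norm_of_nonneg (sum_nonneg fun v _ => by positivity)]
  rw [e4, e2]
  refine (norm_sum_le _ _).trans ((sum_le_sum e3).trans ?_)
  rw [← sum_filter, sum_const, nsmul_eq_mul, Js]
  apply le_of_eq; ring

lemma large_sieve {ι : Type*} {t X R : ℕ} (hM : t * X ^ d < M) (s : Finset ι) (u : ι → Fin d → ZMod M)
    (b : (Fin t → ℤ) → ℂ) (hb : ∀ x, ‖b x‖ ≤ 1) (L : Fin d → ℕ) (hL : ∀ j, 0 < L j) (hLM : ∀ j, L j ≤ M)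
    (hL8 : ∀ j, 8 * (L j * (t * X ^ ((j : ℕ) + 1))) ≤ M)
    (hR : ∀ s' ⊆ s, ∀ v : Fin d → ZMod M, (∀ m ∈ s', ∃ θ : Fin d → ℕ, (∀ j, θ j < L j) ∧
      ∀ j, u m j + (θ j : ZMod M) = v j) → s'.card ≤ R) :
    ∑ m ∈ s, ‖∑ x ∈ Fintype.piFinset (fun _ : Fin t => Icc (1 : ℤ) X),
      b x * ch (∑ i, pw d (x i)) (u m)‖ ^ 2 ≤
      R * ((M : ℝ) ^ d / (∏ j, (L j : ℝ))) * ((2 ^ d) ^ 2 * Js d t (Icc 1 (X : ℤ))) := by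
  classical
  set S := Fintype.piFinset (fun _ : Fin t => Icc (1 : ℤ) X) with hS
  set Box := Fintype.piFinset (fun j => range (L j)) with hBox
  set Q : ℝ := ∏ j, (L j : ℝ) with hQ
  have hQ0 : 0 < Q := prod_pos fun j _ => by exact_mod_cast hL j
  have hcard : (Box.card : ℝ) = Q := by rw [hBox, Fintype.card_piFinset]; simp [hQ]
  set cst : (Fin d → ℕ) → Fin d → ZMod M := fun θ j => (θ j : ZMod M) with hcst
  set W : (Fin t → ℤ) → ℂ := fun x => ∑ θ ∈ Box, ch (∑ i, pw d (x i)) (cst θ) with hW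
  have hWl : ∀ x ∈ S, Q / 2 ^ d ≤ ‖W x‖ := by
    intro x hx
    rw [hS, Fintype.mem_piFinset] at hx
    have hx' : ∀ i, 1 ≤ x i ∧ x i ≤ X := fun i => mem_Icc.1 (hx i)
    have h0 : ∀ j, 0 ≤ (∑ i, pw d (x i)) j := by
      intro j
      rw [Finset.sum_apply]
      exact sum_nonneg fun i _ => pow_nonneg (by linarith [(hx' i).1]) _
    refine box_lower L _ h0 fun j => ?_
    have h1 : (∑ i, pw d (x i)) j ≤ t * (X : ℤ) ^ ((j : ℕ) + 1) := by
      rw [Finset.sum_apply]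
      calc _ ≤ ∑ i : Fin t, (X : ℤ) ^ ((j : ℕ) + 1) :=
            sum_le_sum fun i _ => pow_le_pow_left₀ (by linarith [(hx' i).1]) (hx' i).2 _
        _ = _ := by simp
    have h2 : (8 : ℤ) * (L j * (t * (X : ℤ) ^ ((j : ℕ) + 1))) ≤ M := by exact_mod_cast hL8 j
    have := mul_le_mul_of_nonneg_left h1 (by positivity : (0 : ℤ) ≤ L j)
    linarith
  set b' : (Fin t → ℤ) → ℂ := fun x => if x ∈ S then b x * Q / W x else 0 with hb'
  have hb'n : ∀ x, ‖b' x‖ ≤ 2 ^ d := by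
    intro x
    simp only [hb']
    split_ifs with h
    · rw [norm_div, norm_mul, Complex.norm_real, Real.norm_of_nonneg hQ0.le]
      have hw := hWl x h
      have hw0 : 0 < ‖W x‖ := lt_of_lt_of_le (by positivity) hw
      rw [div_le_iff₀ hw0]
      rw [div_le_iff₀ (by positivity)] at hw
      calc ‖b x‖ * Q ≤ 1 * Q := mul_le_mul_of_nonneg_right (hb x) hQ0.le
        _ ≤ _ := by linarith
    · simp
  set G' : (Fin d → ZMod M) → ℂ := fun v => ∑ x ∈ S, b' x * ch (∑ i, pw d (x i)) v with hG'
  have hG : ∀ a, ∑ θ ∈ Box, G' (a + cst θ) = Q * ∑ x ∈ S, b x * ch (∑ i, pw d (x i)) a := by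
    intro a
    simp only [hG']
    rw [sum_comm, mul_sum]
    refine sum_congr rfl fun x hx => ?_
    simp_rw [ch_add_right]
    rw [← mul_sum, ← mul_sum]
    have hw0 : W x ≠ 0 := by
      have : 0 < ‖W x‖ := lt_of_lt_of_le (by positivity) (hWl x hx)
      exact norm_pos_iff.1 this
    have : ∑ θ ∈ Box, ch (∑ i, pw d (x i)) (cst θ) = W x := rfl
    rw [this]
    simp only [hb', hx, if_true]
    field_simp
  have h1 : ∀ a, ‖∑ x ∈ S, b x * ch (∑ i, pw d (x i)) a‖ ^ 2 ≤ (1 / Q) * ∑ θ ∈ Box, ‖G' (a + cst θ)‖ ^ 2 := by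
    intro a
    have h2 : ‖∑ x ∈ S, b x * ch (∑ i, pw d (x i)) a‖ = (1 / Q) * ‖∑ θ ∈ Box, G' (a + cst θ)‖ := by
      rw [hG, norm_mul, Complex.norm_real, Real.norm_of_nonneg hQ0.le]; field_simp
    have h3 : ‖∑ θ ∈ Box, G' (a + cst θ)‖ ^ 2 ≤ Q * ∑ θ ∈ Box, ‖G' (a + cst θ)‖ ^ 2 := by
      rw [← hcard]
      refine (pow_le_pow_left₀ (norm_nonneg _) (norm_sum_le _ _) 2).trans ?_
      exact sq_sum_le_card_mul_sum_sq
    rw [h2, mul_pow]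
    calc (1 / Q) ^ 2 * ‖∑ θ ∈ Box, G' (a + cst θ)‖ ^ 2 ≤ (1 / Q) ^ 2 * (Q * ∑ θ ∈ Box, ‖G' (a + cst θ)‖ ^ 2) :=
          mul_le_mul_of_nonneg_left h3 (by positivity)
      _ = _ := by field_simp
  have hinj : Set.InjOn cst Box := by
    intro θ hθ θ' hθ' he
    rw [mem_coe, hBox, Fintype.mem_piFinset] at hθ hθ'
    funext j
    have := congrFun he j
    simp only [hcst] at this
    rw [ZMod.natCast_eq_natCast_iff'] at this
    rwa [Nat.mod_eq_of_lt (lt_of_lt_of_le (mem_range.1 (hθ j)) (hLM j)),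
      Nat.mod_eq_of_lt (lt_of_lt_of_le (mem_range.1 (hθ' j)) (hLM j))] at this
  have h4 : ∑ m ∈ s, ∑ θ ∈ Box, ‖G' (u m + cst θ)‖ ^ 2 ≤ R * ∑ v, ‖G' v‖ ^ 2 := by
    rw [← sum_product' (f := fun m θ => ‖G' (u m + cst θ)‖ ^ 2),
      ← sum_fiberwise_of_maps_to (s := s ×ˢ Box) (t := univ) (g := fun z => u z.1 + cst z.2)
        (fun z _ => mem_univ _), mul_sum]
    refine sum_le_sum fun v _ => ?_
    have : ∀ z ∈ (s ×ˢ Box).filter (fun z => u z.1 + cst z.2 = v), ‖G' (u z.1 + cst z.2)‖ ^ 2 = ‖G' v‖ ^ 2 := by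
      intro z hz; rw [(mem_filter.1 hz).2]
    rw [sum_congr rfl this, sum_const, nsmul_eq_mul]
    refine mul_le_mul_of_nonneg_right ?_ (by positivity)
    set F := (s ×ˢ Box).filter (fun z => u z.1 + cst z.2 = v) with hF
    have hc : F.card = (F.image Prod.fst).card := by
      rw [card_image_of_injOn]
      intro z hz z' hz' he
      rw [mem_coe, hF, mem_filter, mem_product] at hz hz'
      refine Prod.ext he (hinj (mem_coe.2 hz.1.2) (mem_coe.2 hz'.1.2) ?_)
      have := hz.2.trans hz'.2.symm
      rw [he] at this
      exact add_left_cancel this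
    rw [hc]
    refine Nat.cast_le.2 (hR _ ?_ v ?_)
    · intro m hm
      obtain ⟨z, hz, rfl⟩ := mem_image.1 hm
      exact (mem_product.1 (mem_filter.1 hz).1).1
    · intro m hm
      obtain ⟨z, hz, rfl⟩ := mem_image.1 hm
      rw [hF, mem_filter, mem_product, hBox, Fintype.mem_piFinset] at hz
      exact ⟨z.2, fun j => mem_range.1 (hz.1.2 j), fun j => congrFun hz.2 j⟩
  calc _ ≤ ∑ m ∈ s, (1 / Q) * ∑ θ ∈ Box, ‖G' (u m + cst θ)‖ ^ 2 := sum_le_sum fun m _ => h1 (u m)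
    _ = (1 / Q) * ∑ m ∈ s, ∑ θ ∈ Box, ‖G' (u m + cst θ)‖ ^ 2 := by rw [mul_sum]
    _ ≤ (1 / Q) * (R * ((M : ℝ) ^ d * ((2 ^ d) ^ 2 * Js d t (Icc 1 (X : ℤ))))) :=
        mul_le_mul_of_nonneg_left (h4.trans (mul_le_mul_of_nonneg_left (parseval hM b' _ hb'n)
          (Nat.cast_nonneg _))) (by positivity)
    _ = _ := by field_simp

end
end VMV


namespace VMV
open Finset
open scoped ComplexConjugate

noncomputable def ee (y : ℝ) : ℂ := Complex.exp (((2 * Real.pi * y : ℝ) : ℂ) * Complex.I)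

lemma ee_add (x y : ℝ) : ee (x + y) = ee x * ee y := by
  unfold ee; rw [← Complex.exp_add]; congr 1; push_cast; ring

lemma ee_zero : ee 0 = 1 := by simp [ee]

lemma norm_ee (x : ℝ) : ‖ee x‖ = 1 := Complex.norm_exp_ofReal_mul_I _

lemma ee_int (n : ℤ) : ee n = 1 := by
  unfold ee
  rw [Complex.exp_eq_one_iff]
  exact ⟨n, by push_cast; ring⟩

lemma ee_neg (x : ℝ) : ee (-x) = conj (ee x) := by
  unfold ee
  rw [← Complex.exp_conj, map_mul, Complex.conj_ofReal, Complex.conj_I]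
  congr 1; push_cast; ring

lemma ee_nat_mul (n : ℕ) (x : ℝ) : ee (n * x) = ee x ^ n := by
  unfold ee; rw [← Complex.exp_nat_mul]; congr 1; push_cast; ring

lemma ee_sum {ι : Type*} (s : Finset ι) (g : ι → ℝ) : ee (∑ i ∈ s, g i) = ∏ i ∈ s, ee (g i) := by
  classical
  induction s using Finset.induction_on with
  | empty => simp [ee_zero]
  | insert i s hi ih => rw [sum_insert hi, prod_insert hi, ee_add, ih]

lemma ee_sub_one (x : ℝ) : 4 * |x - round x| ≤ ‖ee x - 1‖ := by
  set y := x - round x with hy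
  have h1 : ee x = ee y := by
    have : x = y + (round x : ℤ) := by rw [hy]; ring
    conv_lhs => rw [this, ee_add, ee_int, mul_one]
  have h2 : |y| ≤ 1 / 2 := abs_sub_round x
  have hpi := Real.pi_pos
  have h3 : ‖ee y - 1‖ = 2 * |Real.sin (Real.pi * y)| := by
    have := Complex.norm_exp_I_mul_ofReal_sub_one (2 * Real.pi * y)
    unfold ee
    rw [mul_comm, this, norm_mul, Real.norm_eq_abs, Real.norm_eq_abs, abs_two]
    congr 3; ring
  rw [h1, h3]
  have h4 : |Real.sin (Real.pi * y)| = Real.sin (Real.pi * |y|) := by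
    rcases le_total 0 y with h | h
    · rw [abs_of_nonneg h, abs_of_nonneg]
      rw [abs_of_nonneg h] at h2
      exact Real.sin_nonneg_of_nonneg_of_le_pi (by positivity) (by nlinarith)
    · rw [abs_of_nonpos h, mul_neg, Real.sin_neg, abs_of_nonpos]
      rw [abs_of_nonpos h] at h2
      exact Real.sin_nonpos_of_nonpos_of_neg_pi_le (by nlinarith) (by nlinarith)
  rw [h4]
  have h5 := Real.mul_le_sin (x := Real.pi * |y|) (by positivity) (by nlinarith)
  have h6 : 2 / Real.pi * (Real.pi * |y|) = 2 * |y| := by field_simp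
  linarith

lemma geom_bound (L : ℕ) (x ρ : ℝ) (hρ : 0 < ρ) (h : ρ ≤ |x - round x|) :
    ‖∑ h ∈ range L, ee (h * x)‖ ≤ 1 / (2 * ρ) := by
  have h1 := ee_sub_one x
  have h2 : ‖∑ h ∈ range L, ee (h * x)‖ * ‖ee x - 1‖ ≤ 2 := by
    simp_rw [ee_nat_mul]
    rw [← norm_mul, geom_sum_mul]
    calc _ ≤ ‖ee x ^ L‖ + ‖(1 : ℂ)‖ := norm_sub_le _ _
      _ = 2 := by rw [norm_pow, norm_ee]; norm_num
  rw [le_div_iff₀ (by positivity)]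
  have := mul_le_mul_of_nonneg_left (by linarith : 4 * ρ ≤ ‖ee x - 1‖) (norm_nonneg (∑ h ∈ range L, ee (h * x)))
  linarith

lemma kernel {ι : Type*} (s : Finset ι) (x : ι → ℝ) {ρ : ℝ} (hρ0 : 0 < ρ)
    (hρ : ∀ i ∈ s, ρ ≤ |x i - round (x i)|) (m L : ℕ) (hm : 1 ≤ m) (hL : 1 ≤ L)
    (hc : 2 * ((m : ℝ) * L) ≤ (2 * ρ * L) ^ (2 * m)) :
    (s.card : ℝ) / 4 ≤ ∑ h ∈ Icc 1 (m * L), ‖∑ i ∈ s, ee (h * x i)‖ := by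
  set Q := m * L with hQ
  have hQ1 : 1 ≤ Q := Nat.mul_pos hm hL
  set U := Fintype.piFinset (fun _ : Fin m => range L) with hU
  have hmaps : ∀ u ∈ U, ∑ i, u i ∈ range Q := by
    intro u hu
    rw [hU, Fintype.mem_piFinset] at hu
    rw [mem_range]
    have hui : ∀ i, u i < L := fun i => mem_range.1 (hu i)
    have : Nonempty (Fin m) := ⟨⟨0, hm⟩⟩
    calc ∑ i, u i < ∑ _i : Fin m, L := sum_lt_sum_of_nonempty univ_nonempty fun i _ => hui i
      _ = Q := by simp [hQ]
  set c : ℕ → ℝ := fun ν => ((U.filter fun u => ∑ i, u i = ν).card : ℝ) with hcdef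
  have hc0 : ∀ ν, 0 ≤ c ν := fun ν => Nat.cast_nonneg _
  have hsum : ∑ ν ∈ range Q, c ν = (L : ℝ) ^ m := by
    simp only [hcdef]
    rw [← Nat.cast_sum, ← card_eq_sum_card_fiberwise hmaps, hU, Fintype.card_piFinset]
    simp
  have hD : ∀ y : ℝ, (∑ h ∈ range L, ee (h * y)) ^ m = ∑ ν ∈ range Q, (c ν : ℂ) * ee (ν * y) := by
    intro y
    have h1 : (∑ h ∈ range L, ee (h * y)) ^ m = ∏ _i : Fin m, ∑ h ∈ range L, ee (h * y) := by simp
    rw [h1, prod_univ_sum, ← sum_fiberwise_of_maps_to hmaps]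
    refine sum_congr rfl fun ν _ => ?_
    have : ∀ u ∈ U.filter (fun u => ∑ i, u i = ν), ∏ i, ee ((u i : ℕ) * y) = ee (ν * y) := by
      intro u hu
      rw [← ee_sum, ← (mem_filter.1 hu).2, ← sum_mul]
      push_cast; rfl
    rw [sum_congr rfl this, sum_const, nsmul_eq_mul]
    simp only [hcdef]; push_cast; rfl
  set R0 : ℝ := ∑ ν ∈ range Q, c ν ^ 2 with hR0
  have hR0l : (L : ℝ) ^ (2 * m) ≤ Q * R0 := by
    have := sq_sum_le_card_mul_sum_sq (s := range Q) (f := c)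
    rw [hsum, card_range, ← pow_mul, mul_comm m 2] at this
    exact this
  have hLp : (0 : ℝ) < (L : ℝ) ^ (2 * m) := by
    have : (0 : ℝ) < L := by exact_mod_cast hL
    positivity
  have hQr : (0 : ℝ) < Q := by exact_mod_cast hQ1
  have hR0p : 0 < R0 := by
    by_contra hcon
    push Not at hcon
    have := mul_nonpos_of_nonneg_of_nonpos hQr.le hcon
    linarith
  set S : ℝ → ℂ := fun z => ∑ i ∈ s, ee (z * x i) with hS
  have hSneg : ∀ z, ‖S (-z)‖ = ‖S z‖ := by
    intro z
    have : S (-z) = conj (S z) := by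
      simp only [hS, map_sum]
      refine sum_congr rfl fun i _ => ?_
      rw [neg_mul, ee_neg]
    rw [this, Complex.norm_conj]
  have hS0 : S 0 = s.card := by simp [hS, ee_zero]
  set H : ℝ := ∑ h ∈ Icc 1 Q, ‖S h‖ with hH
  -- expansion
  have hT : ((∑ i ∈ s, ‖(∑ h ∈ range L, ee (h * x i)) ^ m‖ ^ 2 : ℝ) : ℂ) =
      ∑ z ∈ range Q ×ˢ range Q, ((c z.1 * c z.2 : ℝ) : ℂ) * S ((z.1 : ℝ) - z.2) := by
    rw [Complex.ofReal_sum]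
    simp only [hS, mul_sum]
    rw [sum_comm]
    refine sum_congr rfl fun i _ => ?_
    rw [← Complex.normSq_eq_norm_sq, ← Complex.mul_conj, hD, map_sum, sum_mul_sum, ← sum_product']
    refine sum_congr rfl fun z _ => ?_
    rw [map_mul, Complex.conj_ofReal, ← ee_neg, sub_mul, sub_eq_add_neg, ee_add]
    push_cast; ring
  have hdiag : ∑ z ∈ (range Q ×ˢ range Q).filter (fun z => z.1 = z.2),
      ((c z.1 * c z.2 : ℝ) : ℂ) * S ((z.1 : ℝ) - z.2) = ((R0 * s.card : ℝ) : ℂ) := by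
    rw [sum_filter, sum_product]
    have : ∀ ν ∈ range Q, ∑ ν' ∈ range Q, (if ν = ν' then ((c ν * c ν' : ℝ) : ℂ) * S ((ν : ℝ) - ν') else 0) =
        ((c ν ^ 2 * s.card : ℝ) : ℂ) := by
      intro ν hν
      rw [sum_ite_eq, if_pos hν, sub_self, hS0]; push_cast; ring
    rw [sum_congr rfl this, ← Complex.ofReal_sum, hR0, sum_mul]
  have hrow : ∀ ν ∈ range Q, ∑ ν' ∈ range Q, (if ν ≠ ν' then ‖S ((ν : ℝ) - ν')‖ else 0) ≤ 2 * H := by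
    intro ν hν
    rw [← sum_filter]
    have hsp : (range Q).filter (fun ν' => ν ≠ ν') =
        (range Q).filter (fun ν' => ν' < ν) ∪ (range Q).filter (fun ν' => ν < ν') := by
      ext a; simp only [mem_filter, mem_union, ne_eq]; grind
    have hdj : Disjoint ((range Q).filter (fun ν' => ν' < ν)) ((range Q).filter (fun ν' => ν < ν')) := by
      rw [disjoint_left]; intro a h1 h2; rw [mem_filter] at h1 h2; omega
    rw [hsp, sum_union hdj, two_mul]
    have hν' := mem_range.1 hν
    refine add_le_add ?_ ?_
    · calc _ = ∑ ν' ∈ (range Q).filter (fun ν' => ν' < ν), ‖S ((ν - ν' : ℕ) : ℝ)‖ := by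
            refine sum_congr rfl fun a ha => ?_
            rw [Nat.cast_sub (mem_filter.1 ha).2.le]
        _ = ∑ h ∈ ((range Q).filter (fun ν' => ν' < ν)).image (fun a => ν - a), ‖S (h : ℝ)‖ := by
            rw [sum_image]
            intro a ha b hb he
            rw [mem_coe, mem_filter] at ha hb
            simp only at he; omega
        _ ≤ H := by
            refine sum_le_sum_of_subset_of_nonneg ?_ fun _ _ _ => norm_nonneg _
            intro h hh
            obtain ⟨a, ha, rfl⟩ := mem_image.1 hh
            rw [mem_filter, mem_range] at ha
            rw [mem_Icc]; omega
    · calc _ = ∑ ν' ∈ (range Q).filter (fun ν' => ν < ν'), ‖S ((ν' - ν : ℕ) : ℝ)‖ := by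
            refine sum_congr rfl fun a ha => ?_
            rw [Nat.cast_sub (mem_filter.1 ha).2.le, ← hSneg, neg_sub]
        _ = ∑ h ∈ ((range Q).filter (fun ν' => ν < ν')).image (fun a => a - ν), ‖S (h : ℝ)‖ := by
            rw [sum_image]
            intro a ha b hb he
            rw [mem_coe, mem_filter] at ha hb
            simp only at he; omega
        _ ≤ H := by
            refine sum_le_sum_of_subset_of_nonneg ?_ fun _ _ _ => norm_nonneg _
            intro h hh
            obtain ⟨a, ha, rfl⟩ := mem_image.1 hh
            rw [mem_filter, mem_range] at ha
            rw [mem_Icc]; omega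
  have hoff : ‖∑ z ∈ (range Q ×ˢ range Q).filter (fun z => ¬ z.1 = z.2),
      ((c z.1 * c z.2 : ℝ) : ℂ) * S ((z.1 : ℝ) - z.2)‖ ≤ R0 * (2 * H) := by
    have g1 : ‖∑ z ∈ (range Q ×ˢ range Q).filter (fun z => ¬ z.1 = z.2),
        ((c z.1 * c z.2 : ℝ) : ℂ) * S ((z.1 : ℝ) - z.2)‖ ≤
        ∑ z ∈ range Q ×ˢ range Q, (c z.1 ^ 2 / 2 * (if z.1 ≠ z.2 then ‖S ((z.1 : ℝ) - z.2)‖ else 0) +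
          c z.2 ^ 2 / 2 * (if z.2 ≠ z.1 then ‖S ((z.2 : ℝ) - z.1)‖ else 0)) := by
      refine (norm_sum_le _ _).trans ?_
      rw [sum_filter]
      refine sum_le_sum fun z _ => ?_
      by_cases h : z.1 = z.2
      · simp [h]
      · rw [if_pos h, if_pos h, if_pos (Ne.symm h), norm_mul, Complex.norm_real,
          Real.norm_of_nonneg (mul_nonneg (hc0 _) (hc0 _))]
        have : ‖S ((z.2 : ℝ) - z.1)‖ = ‖S ((z.1 : ℝ) - z.2)‖ := by rw [← hSneg, neg_sub]
        rw [this, ← add_mul]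
        refine mul_le_mul_of_nonneg_right ?_ (norm_nonneg _)
        nlinarith [sq_nonneg (c z.1 - c z.2)]
    refine g1.trans ?_
    rw [sum_add_distrib, sum_product, sum_product_right (f := fun z : ℕ × ℕ => c z.2 ^ 2 / 2 *
      (if z.2 ≠ z.1 then ‖S ((z.2 : ℝ) - z.1)‖ else 0))]
    simp only [← mul_sum]
    have g2 : ∑ ν ∈ range Q, c ν ^ 2 / 2 * ∑ ν' ∈ range Q, (if ν ≠ ν' then ‖S ((ν : ℝ) - ν')‖ else 0) ≤
        ∑ ν ∈ range Q, c ν ^ 2 / 2 * (2 * H) :=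
      sum_le_sum fun ν hν => mul_le_mul_of_nonneg_left (hrow ν hν) (by positivity)
    have g3 : ∑ ν ∈ range Q, c ν ^ 2 / 2 * (2 * H) = R0 * H := by
      rw [hR0, sum_mul]; refine sum_congr rfl fun ν _ => by ring
    linarith
  have hTu : ∑ i ∈ s, ‖(∑ h ∈ range L, ee (h * x i)) ^ m‖ ^ 2 ≤ s.card * (R0 / 2) := by
    rw [← nsmul_eq_mul]
    refine sum_le_card_nsmul _ _ _ fun i hi => ?_
    rw [norm_pow, ← pow_mul, mul_comm m 2]
    refine (pow_le_pow_left₀ (norm_nonneg _) (geom_bound L (x i) ρ hρ0 (hρ i hi)) _).trans ?_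
    rw [div_pow, one_pow, div_le_iff₀ (by positivity)]
    rw [mul_pow] at hc
    have hQe : (Q : ℝ) = m * L := by rw [hQ]; push_cast; ring
    rw [← hQe] at hc
    have hρp : 0 < (2 * ρ) ^ (2 * m) := by positivity
    have := mul_le_mul_of_nonneg_left hR0l hρp.le
    have h2 : (Q : ℝ) * 2 ≤ Q * ((2 * ρ) ^ (2 * m) * R0) := by linarith
    have := le_of_mul_le_mul_left h2 hQr
    linarith
  have hfin : R0 * s.card - R0 * (2 * H) ≤ s.card * (R0 / 2) := by
    have e := sum_filter_add_sum_filter_not (range Q ×ˢ range Q) (fun z => z.1 = z.2)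
      (fun z => ((c z.1 * c z.2 : ℝ) : ℂ) * S ((z.1 : ℝ) - z.2))
    rw [hdiag, ← hT] at e
    have e2 : ((R0 * s.card : ℝ) : ℂ) - ((∑ i ∈ s, ‖(∑ h ∈ range L, ee (h * x i)) ^ m‖ ^ 2 : ℝ) : ℂ) =
        -(∑ z ∈ (range Q ×ˢ range Q).filter (fun z => ¬ z.1 = z.2),
          ((c z.1 * c z.2 : ℝ) : ℂ) * S ((z.1 : ℝ) - z.2)) := by rw [← e]; ring
    rw [← Complex.ofReal_sub] at e2
    have e3 : ‖((R0 * s.card - ∑ i ∈ s, ‖(∑ h ∈ range L, ee (h * x i)) ^ m‖ ^ 2 : ℝ) : ℂ)‖ ≤ R0 * (2 * H) := by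
      rw [e2, norm_neg]; exact hoff
    rw [Complex.norm_real, Real.norm_eq_abs] at e3
    have := (le_abs_self _).trans e3
    linarith
  have : (s.card : ℝ) / 2 ≤ 2 * H := by
    have h2 : R0 * ((s.card : ℝ) / 2) ≤ R0 * (2 * H) := by linarith
    exact le_of_mul_le_mul_left h2 hR0p
  change (s.card : ℝ) / 4 ≤ H
  linarith

end VMV


namespace VMV
open Finset

/-- distance to multiples of M -/
def Nr (M : ℕ) (B a : ℤ) : Prop := ∃ z : ℤ, |a - M * z| ≤ B

lemma Nr.mul {M : ℕ} {B a : ℤ} (h : Nr M B a) (c : ℤ) (hc : 0 ≤ c) : Nr M (c * B) (c * a) := by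
  obtain ⟨z, hz⟩ := h
  refine ⟨c * z, ?_⟩
  have : c * a - M * (c * z) = c * (a - M * z) := by ring
  rw [this, abs_mul, abs_of_nonneg hc]
  exact mul_le_mul_of_nonneg_left hz hc

lemma Nr.mono {M : ℕ} {B B' a : ℤ} (h : Nr M B a) (hB : B ≤ B') : Nr M B' a := by
  obtain ⟨z, hz⟩ := h
  exact ⟨z, hz.trans hB⟩

lemma Nr.sub {M : ℕ} {B B' a a' : ℤ} (h : Nr M B a) (h' : Nr M B' a') : Nr M (B + B') (a - a') := by
  obtain ⟨z, hz⟩ := h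
  obtain ⟨z', hz'⟩ := h'
  refine ⟨z - z', ?_⟩
  have : a - a' - M * (z - z') = (a - M * z) - (a' - M * z') := by ring
  rw [this]
  exact (abs_sub _ _).trans (add_le_add hz hz')

lemma Nr.sum {M : ℕ} {ι : Type*} (s : Finset ι) (B a : ι → ℤ) (h : ∀ i ∈ s, Nr M (B i) (a i)) :
    Nr M (∑ i ∈ s, B i) (∑ i ∈ s, a i) := by
  classical
  induction s using Finset.induction_on with
  | empty => exact ⟨0, by simp⟩
  | insert i s hi ih =>
    rw [sum_insert hi, sum_insert hi]
    obtain ⟨z, hz⟩ := h i (mem_insert_self _ _)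
    obtain ⟨z', hz'⟩ := ih fun j hj => h j (mem_insert_of_mem hj)
    refine ⟨z + z', ?_⟩
    have : a i + ∑ i ∈ s, a i - M * (z + z') = (a i - M * z) + (∑ i ∈ s, a i - M * z') := by ring
    rw [this]
    exact (abs_add_le _ _).trans (add_le_add hz hz')

def gam (k : ℕ) (b : ℕ → ℤ) (j m : ℕ) : ℤ := ∑ l ∈ Icc j k, (l.choose j : ℤ) * b l * (m : ℤ) ^ (l - j)

lemma gam_diff (k : ℕ) (b : ℕ → ℤ) (i m m' : ℕ) (hi : 1 ≤ i) (hik : i ≤ k) :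
    gam k b (i - 1) m - gam k b (i - 1) m' = (i : ℤ) * (((m : ℤ) - m') * b i) +
      ∑ l ∈ Ioc i k, ((l.choose (i - 1) : ℤ) * ∑ a ∈ range (l - i + 1), (m : ℤ) ^ a * (m' : ℤ) ^ (l - i - a)) *
        (((m : ℤ) - m') * b l) := by
  unfold gam
  rw [← sum_sub_distrib]
  have h1 : Icc (i - 1) k = insert (i - 1) (insert i (Ioc i k)) := by
    ext x; simp only [mem_Icc, mem_insert, mem_Ioc]; omega
  rw [h1, sum_insert (by simp only [mem_insert, mem_Ioc]; omega), sum_insert (by simp)]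
  have h2 : i - (i - 1) = 1 := by omega
  have h3 : i.choose (i - 1) = i := by
    obtain ⟨n, rfl⟩ : ∃ n, i = n + 1 := ⟨i - 1, by omega⟩
    simp
  rw [h2, h3, Nat.sub_self]
  simp only [pow_zero, pow_one, sub_self, zero_add]
  congr 1
  · ring
  · refine sum_congr rfl fun l hl => ?_
    have hl' := mem_Ioc.1 hl
    have h4 : l - (i - 1) = l - i + 1 := by omega
    have := (Commute.all (m : ℤ) (m' : ℤ)).geom_sum₂_mul (l - i + 1)
    rw [h4]
    simp only [Nat.add_sub_cancel] at this
    linear_combination (l.choose (i - 1) : ℤ) * b l * (-this)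

lemma near_ind (k e : ℕ) : ∃ C : ℤ, 0 ≤ C ∧ ∀ (M N : ℕ) (b : ℕ → ℤ) (m m' : ℕ), m ≤ N → m' ≤ N →
    (∀ j, 1 ≤ j → j < k → Nr M ((N : ℤ) ^ (k + 1 - j)) (gam k b j m - gam k b j m')) →
    ∀ i, 2 ≤ i → i ≤ k → k - i < e →
      Nr M (C * (N : ℤ) ^ (k + 2 - i)) ((k.factorial : ℤ) ^ (k - i + 1) * (((m : ℤ) - m') * b i)) := by
  induction e with
  | zero => exact ⟨0, le_rfl, fun _ _ _ _ _ _ _ _ i _ _ h => absurd h (by omega)⟩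
  | succ e ih =>
    obtain ⟨C, hC, ih⟩ := ih
    obtain ⟨i, hi⟩ : ∃ i, i = k - e := ⟨_, rfl⟩
    set w : ℤ := (k.factorial : ℤ) ^ (k - i) * ((k.factorial / i : ℕ) : ℤ) with hw
    set C' : ℤ := w + ∑ l ∈ Ioc i k, ((l.choose (i - 1) : ℤ) * ((l - i + 1 : ℕ) : ℤ)) * (w * C) with hC'
    have hw0 : 0 ≤ w := by positivity
    have hC'0 : 0 ≤ C' := by
      rw [hC']; exact add_nonneg hw0 (sum_nonneg fun l _ => by positivity)
    refine ⟨C + C', by positivity, ?_⟩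
    intro M N b m m' hm hm' hγ i' hi2 hik he
    rcases Nat.lt_or_ge (k - i') e with hlt | hge
    · refine (ih M N b m m' hm hm' hγ i' hi2 hik hlt).mono ?_
      exact mul_le_mul_of_nonneg_right (by linarith) (by positivity)
    have hii : i' = i := by omega
    subst hii
    have h1 := hγ (i' - 1) (by omega) (by omega)
    rw [gam_diff k b i' m m' (by omega) hik] at h1
    have hN : k + 1 - (i' - 1) = k + 2 - i' := by omega
    rw [hN] at h1
    have hfac : (i' : ℤ) * ((k.factorial / i' : ℕ) : ℤ) = k.factorial := by
      have : i' * (k.factorial / i') = k.factorial :=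
        Nat.mul_div_cancel' (Nat.dvd_factorial (by omega) hik)
      exact_mod_cast this
    set Qs : ℕ → ℤ := fun l => ∑ a ∈ range (l - i' + 1), (m : ℤ) ^ a * (m' : ℤ) ^ (l - i' - a) with hQs
    have hQ0 : ∀ l, 0 ≤ Qs l := fun l => sum_nonneg fun a _ => by positivity
    have hQ : ∀ l, Qs l ≤ ((l - i' + 1 : ℕ) : ℤ) * (N : ℤ) ^ (l - i') := by
      intro l
      have : ∀ a ∈ range (l - i' + 1), (m : ℤ) ^ a * (m' : ℤ) ^ (l - i' - a) ≤ (N : ℤ) ^ (l - i') := by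
        intro a ha
        have ha' := mem_range.1 ha
        calc (m : ℤ) ^ a * (m' : ℤ) ^ (l - i' - a) ≤ (N : ℤ) ^ a * (N : ℤ) ^ (l - i' - a) := by
              apply mul_le_mul (pow_le_pow_left₀ (by positivity) (by exact_mod_cast hm) _)
                (pow_le_pow_left₀ (by positivity) (by exact_mod_cast hm') _) (by positivity) (by positivity)
          _ = (N : ℤ) ^ (l - i') := by rw [← pow_add]; congr 1; omega
      calc Qs l ≤ ∑ _a ∈ range (l - i' + 1), (N : ℤ) ^ (l - i') := sum_le_sum this
        _ = _ := by simp
    have h2 := Nr.sum (M := M) (Ioc i' k)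
      (fun l => ((l.choose (i' - 1) : ℤ) * ((l - i' + 1 : ℕ) : ℤ)) * (w * C) * (N : ℤ) ^ (k + 2 - i'))
      (fun l => w * (((l.choose (i' - 1) : ℤ) * Qs l) * (((m : ℤ) - m') * b l))) (by
        intro l hl
        have hl' := mem_Ioc.1 hl
        have h3 := ih M N b m m' hm hm' hγ l (by omega) hl'.2 (by omega)
        have h4 := h3.mul (((l.choose (i' - 1) : ℤ) * Qs l) *
          ((k.factorial : ℤ) ^ (l - i' - 1) * ((k.factorial / i' : ℕ) : ℤ)))
          (mul_nonneg (mul_nonneg (by positivity) (hQ0 l)) (by positivity))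
        have hwl : w = ((k.factorial : ℤ) ^ (l - i' - 1) * ((k.factorial / i' : ℕ) : ℤ)) *
            (k.factorial : ℤ) ^ (k - l + 1) := by
          have : k - i' = (l - i' - 1) + (k - l + 1) := by omega
          rw [hw, this, pow_add]; ring
        have hk1 : (1 : ℤ) ≤ (k.factorial : ℤ) ^ (k - l + 1) :=
          one_le_pow₀ (by exact_mod_cast Nat.factorial_pos k)
        set w' : ℤ := (k.factorial : ℤ) ^ (l - i' - 1) * ((k.factorial / i' : ℕ) : ℤ) with hw'
        have hw'0 : 0 ≤ w' := by positivity
        have hww : w' ≤ w := by rw [hwl]; exact le_mul_of_one_le_right hw'0 hk1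
        have e1 : (((l.choose (i' - 1) : ℤ) * Qs l) * w') * ((k.factorial : ℤ) ^ (k - l + 1) * (((m : ℤ) - m') * b l)) =
            w * (((l.choose (i' - 1) : ℤ) * Qs l) * (((m : ℤ) - m') * b l)) := by rw [hwl]; ring
        rw [e1] at h4
        refine h4.mono ?_
        have e2 : (N : ℤ) ^ (k + 2 - i') = (N : ℤ) ^ (l - i') * (N : ℤ) ^ (k + 2 - l) := by
          rw [← pow_add]; congr 1; omega
        rw [e2]
        calc (l.choose (i' - 1) : ℤ) * Qs l * w' * (C * (N : ℤ) ^ (k + 2 - l))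
            ≤ (l.choose (i' - 1) : ℤ) * (((l - i' + 1 : ℕ) : ℤ) * (N : ℤ) ^ (l - i')) * w * (C * (N : ℤ) ^ (k + 2 - l)) := by
              refine mul_le_mul_of_nonneg_right ?_ (by positivity)
              refine mul_le_mul ?_ hww hw'0 (by positivity)
              exact mul_le_mul_of_nonneg_left (hQ l) (by positivity)
          _ = _ := by ring)
    have h5 := (h1.mul w hw0).sub h2
    have e3 : w * ((i' : ℤ) * (((m : ℤ) - m') * b i') +
        ∑ l ∈ Ioc i' k, ((l.choose (i' - 1) : ℤ) * Qs l) * (((m : ℤ) - m') * b l)) -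
        ∑ l ∈ Ioc i' k, w * (((l.choose (i' - 1) : ℤ) * Qs l) * (((m : ℤ) - m') * b l)) =
        (k.factorial : ℤ) ^ (k - i' + 1) * (((m : ℤ) - m') * b i') := by
      rw [mul_add, mul_sum, add_sub_cancel_right, pow_succ, ← hfac, hw]
      rw [← hfac]; ring
    have e3' := e3
    simp only [hQs] at e3'
    rw [e3'] at h5
    refine h5.mono ?_
    rw [← sum_mul, ← add_mul, ← hC']
    exact mul_le_mul_of_nonneg_right (by linarith) (by positivity)

lemma near (k : ℕ) : ∃ C : ℕ, ∀ (M N : ℕ) (b : ℕ → ℤ) (m m' : ℕ), m ≤ N → m' ≤ N →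
    (∀ j, 1 ≤ j → j < k → Nr M ((N : ℤ) ^ (k + 1 - j)) (gam k b j m - gam k b j m')) →
    ∀ i, 2 ≤ i → i ≤ k →
      Nr M (C * (N : ℤ) ^ (k + 2 - i)) ((k.factorial : ℤ) ^ k * (((m : ℤ) - m') * b i)) := by
  obtain ⟨C, hC, h⟩ := near_ind k (k + 1)
  refine ⟨((k.factorial : ℤ) ^ k * C).toNat, ?_⟩
  intro M N b m m' hm hm' hγ i hi2 hik
  have h1 := (h M N b m m' hm hm' hγ i hi2 hik (by omega)).mul ((k.factorial : ℤ) ^ (i - 1)) (by positivity)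
  have e1 : (k.factorial : ℤ) ^ (i - 1) * ((k.factorial : ℤ) ^ (k - i + 1) * (((m : ℤ) - m') * b i)) =
      (k.factorial : ℤ) ^ k * (((m : ℤ) - m') * b i) := by
    rw [← mul_assoc, ← pow_add]; congr 3; omega
  rw [e1] at h1
  refine h1.mono ?_
  rw [Int.toNat_of_nonneg (by positivity), ← mul_assoc]
  refine mul_le_mul_of_nonneg_right (mul_le_mul_of_nonneg_right ?_ hC) (by positivity)
  exact pow_le_pow_right₀ (by exact_mod_cast Nat.factorial_pos k) (by omega)

/-- closest pair against the span -/
lemma closest (s : Finset ℕ) (N R : ℕ) (hs : ∀ m ∈ s, m ≤ N) (hR : 2 ≤ R) (hc : R ≤ s.card) :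
    ∃ m0 ∈ s, ∃ m1 ∈ s, ∃ a ∈ s, ∃ z ∈ s, m0 < m1 ∧ a < z ∧ (R - 1) * (m1 - m0) ≤ z - a := by
  have hne : s.Nonempty := card_pos.1 (by omega)
  set D := (s ×ˢ s).filter (fun w => w.1 < w.2) with hD
  have hDne : D.Nonempty := by
    obtain ⟨a, ha, b, hb, hab⟩ := one_lt_card.1 (by omega : 1 < s.card)
    rcases lt_or_gt_of_ne hab with h | h
    · exact ⟨(a, b), by simp [hD, ha, hb, h]⟩
    · exact ⟨(b, a), by simp [hD, ha, hb, h]⟩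
  obtain ⟨w, hw, hmin⟩ := exists_min_image D (fun w => w.2 - w.1) hDne
  rw [hD, mem_filter, mem_product] at hw
  set d0 := w.2 - w.1 with hd0
  have hd0p : 0 < d0 := by omega
  set a := s.min' hne
  set z := s.max' hne
  have key : s.card ≤ (z - a) / d0 + 1 := by
    have : s.card ≤ (range ((z - a) / d0 + 1)).card := by
      refine card_le_card_of_injOn (fun x => (x - a) / d0) ?_ ?_
      · intro x hx
        have h1 := s.min'_le x hx
        have h2 := s.le_max' x hx
        simp only [coe_range, Set.mem_Iio]
        exact Nat.lt_succ_of_le (Nat.div_le_div_right (by omega))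
      · have main : ∀ x ∈ s, ∀ y ∈ s, x < y → (x - a) / d0 < (y - a) / d0 := by
          intro x hx y hy hxy
          have h1 := s.min'_le x hx
          have h3 := hmin (x, y) (by simp [hD, hx, hy, hxy])
          simp only at h3
          have h4 : x - a + d0 ≤ y - a := by omega
          calc (x - a) / d0 < (x - a) / d0 + 1 := Nat.lt_succ_self _
            _ = (x - a + d0) / d0 := (Nat.add_div_right _ hd0p).symm
            _ ≤ _ := Nat.div_le_div_right h4
        intro x hx y hy he
        simp only at he
        rcases lt_trichotomy x y with h | h | h
        · have := main x hx y hy h; omega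
        · exact h
        · have := main y hy x hx h; omega
    rwa [card_range] at this
  have h5 : (R - 1) * d0 ≤ z - a := by
    calc (R - 1) * d0 ≤ (z - a) / d0 * d0 := Nat.mul_le_mul_right _ (by omega)
      _ ≤ z - a := Nat.div_mul_le_self _ _
  refine ⟨w.1, hw.1.1, w.2, hw.1.2, a, s.min'_mem hne, z, s.max'_mem hne, hw.2, ?_, h5⟩
  have : 0 < (R - 1) * d0 := Nat.mul_pos (by omega) hd0p
  omega

lemma good_q (k : ℕ) (C : ℕ) (M N R : ℕ) (b : ℕ → ℤ) (s : Finset ℕ) (hs : ∀ m ∈ s, m ≤ N)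
    (hR : 2 ≤ R) (hc : R ≤ s.card) (hM : 2 * C * N ^ (k + 1) < M) (hN : 1 ≤ N)
    (h : ∀ m ∈ s, ∀ m' ∈ s, ∀ i, 2 ≤ i → i ≤ k →
      Nr M (C * (N : ℤ) ^ (k + 2 - i)) ((k.factorial : ℤ) ^ k * (((m : ℤ) - m') * b i))) :
    ∃ q : ℕ, 1 ≤ q ∧ (R - 1) * q ≤ k.factorial ^ k * N ∧ ∀ i, 2 ≤ i → i ≤ k →
      ∃ z : ℤ, ((R - 1 : ℕ) : ℤ) * |q * b i - M * z| ≤ C * (N : ℤ) ^ (k + 2 - i) := by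
  obtain ⟨m0, hm0, m1, hm1, a, ha, z, hz, hlt, haz, hd⟩ := closest s N R hs hR hc
  have hzN := hs z hz
  have hm1N := hs m1 hm1
  have hfp : 0 < k.factorial ^ k := pow_pos (Nat.factorial_pos k) _
  refine ⟨k.factorial ^ k * (m1 - m0), Nat.mul_pos hfp (by omega), ?_, ?_⟩
  · calc (R - 1) * (k.factorial ^ k * (m1 - m0)) = k.factorial ^ k * ((R - 1) * (m1 - m0)) := by ring
      _ ≤ _ := Nat.mul_le_mul_left _ (by omega)
  intro i hi2 hik
  obtain ⟨z0, h0⟩ := h m1 hm1 m0 hm0 i hi2 hik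
  obtain ⟨z1, h1⟩ := h z hz a ha i hi2 hik
  set d0 : ℤ := (m1 : ℤ) - m0 with hd0
  set d1 : ℤ := (z : ℤ) - a with hd1
  set y0 := (k.factorial : ℤ) ^ k * (d0 * b i) - M * z0 with hy0
  set y1 := (k.factorial : ℤ) ^ k * (d1 * b i) - M * z1 with hy1
  set T : ℤ := C * (N : ℤ) ^ (k + 2 - i) with hT
  have hd0p : 0 < d0 := by omega
  have hd1p : 0 < d1 := by omega
  have hd0N : d0 ≤ N := by omega
  have hd1N : d1 ≤ N := by omega
  have hdd : ((R - 1 : ℕ) : ℤ) * d0 ≤ d1 := by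
    have : (((R - 1) * (m1 - m0) : ℕ) : ℤ) ≤ ((z - a : ℕ) : ℤ) := by exact_mod_cast hd
    rw [Nat.cast_mul, Nat.cast_sub hlt.le, Nat.cast_sub haz.le] at this
    exact this
  have hid : d0 * y1 - d1 * y0 = M * (d1 * z0 - d0 * z1) := by rw [hy0, hy1]; ring
  have hT0 : 0 ≤ T := by positivity
  have hTN : N * T ≤ C * (N : ℤ) ^ (k + 1) := by
    have : (N : ℤ) * T = C * (N : ℤ) ^ (k + 3 - i) := by
      rw [hT, show k + 3 - i = (k + 2 - i) + 1 by omega, pow_succ]; ring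
    rw [this]
    refine mul_le_mul_of_nonneg_left ?_ (by positivity)
    exact pow_le_pow_right₀ (by exact_mod_cast hN) (by omega)
  have b1 : |d0 * y1| ≤ N * T := by
    rw [abs_mul, abs_of_pos hd0p]
    exact mul_le_mul hd0N h1 (abs_nonneg _) (by positivity)
  have b2 : |d1 * y0| ≤ N * T := by
    rw [abs_mul, abs_of_pos hd1p]
    exact mul_le_mul hd1N h0 (abs_nonneg _) (by positivity)
  have hM' : 2 * C * (N : ℤ) ^ (k + 1) < M := by exact_mod_cast hM
  have b3 : |d0 * y1 - d1 * y0| < M := by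
    refine lt_of_le_of_lt (abs_sub _ _) ?_
    linarith
  have hzero : d0 * y1 - d1 * y0 = 0 := by
    refine Int.eq_zero_of_abs_lt_dvd ⟨_, hid⟩ b3
  refine ⟨z0, ?_⟩
  have e1 : (((k.factorial ^ k * (m1 - m0) : ℕ) : ℤ) * b i - M * z0) = y0 := by
    rw [Nat.cast_mul, Nat.cast_sub hlt.le, hy0, hd0]; push_cast; ring
  rw [e1]
  have e2 : d1 * |y0| = d0 * |y1| := by
    have : d0 * y1 = d1 * y0 := by linarith
    rw [← abs_of_pos hd1p, ← abs_mul, ← this, abs_mul, abs_of_pos hd0p]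
  have e3 : d0 * (((R - 1 : ℕ) : ℤ) * |y0|) ≤ d0 * T := by
    calc d0 * (((R - 1 : ℕ) : ℤ) * |y0|) = (((R - 1 : ℕ) : ℤ) * d0) * |y0| := by ring
      _ ≤ d1 * |y0| := mul_le_mul_of_nonneg_right hdd (abs_nonneg _)
      _ = d0 * |y1| := e2
      _ ≤ d0 * T := mul_le_mul_of_nonneg_left h1 hd0p.le
  exact le_of_mul_le_mul_left e3 hd0p

end VMV


namespace VMV
open Finset
open scoped ComplexConjugate

/-- integer polynomial -/
def pol (k : ℕ) (b : ℕ → ℤ) (n : ℤ) : ℤ := ∑ i ∈ Icc 1 k, b i * n ^ i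

lemma pol_shift (k : ℕ) (b : ℕ → ℤ) (m : ℕ) (x : ℤ) :
    pol k b (m + x) = pol k b m + ∑ j ∈ Icc 1 k, gam k b j m * x ^ j := by
  unfold pol gam
  have h1 : ∀ i ∈ Icc 1 k, b i * ((m : ℤ) + x) ^ i = b i * (m : ℤ) ^ i +
      ∑ j ∈ Icc 1 k, if j ≤ i then (i.choose j : ℤ) * b i * (m : ℤ) ^ (i - j) * x ^ j else 0 := by
    intro i hi
    have hi' := mem_Icc.1 hi
    rw [add_comm (m : ℤ) x, add_pow, sum_range_succ', mul_add, add_comm]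
    congr 1
    · simp
    · rw [← sum_filter, mul_sum]
      refine sum_bij' (fun a _ => a + 1) (fun a _ => a - 1) ?_ ?_ ?_ ?_ ?_
      · intro a ha; simp only [mem_range] at ha; simp only [mem_filter, mem_Icc]; omega
      · intro a ha; simp only [mem_filter, mem_Icc] at ha; simp only [mem_range]; omega
      · intro a ha; simp
      · intro a ha; simp only [mem_filter, mem_Icc] at ha; omega
      · intro a ha; ring
  rw [sum_congr rfl h1, sum_add_distrib]
  congr 1
  rw [sum_comm]
  refine sum_congr rfl fun j hj => ?_
  rw [sum_mul, ← sum_filter]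
  refine sum_congr ?_ fun i _ => rfl
  ext i; simp only [mem_filter, mem_Icc] at hj ⊢; omega

lemma ee_div {M : ℕ} [NeZero M] (a : ℤ) : ee ((a : ℝ) / M) = ZMod.stdAddChar ((a : ℤ) : ZMod M) := by
  rw [ZMod.stdAddChar_coe]
  unfold ee
  congr 1; push_cast; ring

/-- shifted Weyl sum in terms of characters of smaller degree -/
lemma weyl_shift {r M X : ℕ} [NeZero M] (b : ℕ → ℤ) (m : ℕ) :
    ‖∑ x ∈ Icc (1 : ℤ) X, ee ((pol (r + 2) b (m + x) : ℝ) / M)‖ =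
      ‖∑ x ∈ Icc (1 : ℤ) X, (ZMod.stdAddChar ((b (r + 2) * x ^ (r + 2) : ℤ) : ZMod M) : ℂ) *
        ch (pw (r + 1) x) (fun j => ((gam (r + 2) b ((j : ℕ) + 1) m : ℤ) : ZMod M))‖ := by
  have h : ∀ x ∈ Icc (1 : ℤ) X, ee ((pol (r + 2) b (m + x) : ℝ) / M) =
      (ZMod.stdAddChar ((pol (r + 2) b m : ℤ) : ZMod M) : ℂ) *
      ((ZMod.stdAddChar ((b (r + 2) * x ^ (r + 2) : ℤ) : ZMod M) : ℂ) *
        ch (pw (r + 1) x) (fun j => ((gam (r + 2) b ((j : ℕ) + 1) m : ℤ) : ZMod M))) := by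
    intro x _
    rw [ee_div]
    unfold ch
    rw [← AddChar.map_add_eq_mul, ← AddChar.map_add_eq_mul]
    congr 1
    rw [pol_shift]
    have e1 : Icc 1 (r + 2) = insert (r + 2) (Icc 1 (r + 1)) := by
      ext a; simp only [mem_Icc, mem_insert]; omega
    have e2 : gam (r + 2) b (r + 2) m = b (r + 2) := by simp [gam]
    have e3 : ∑ j ∈ Icc 1 (r + 1), gam (r + 2) b j m * x ^ j =
        ∑ j : Fin (r + 1), gam (r + 2) b ((j : ℕ) + 1) m * x ^ ((j : ℕ) + 1) := by
      rw [Fin.sum_univ_eq_sum_range (fun j => gam (r + 2) b (j + 1) m * x ^ (j + 1)) (r + 1)]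
      refine sum_bij' (fun a _ => a - 1) (fun a _ => a + 1) ?_ ?_ ?_ ?_ ?_
      · intro a ha; simp only [mem_Icc] at ha; simp only [mem_range]; omega
      · intro a ha; simp only [mem_range] at ha; simp only [mem_Icc]; omega
      · intro a ha; simp only [mem_Icc] at ha; omega
      · intro a ha; simp
      · intro a ha; simp only [mem_Icc] at ha; rw [Nat.sub_add_cancel ha.1]
    rw [e1, sum_insert (by simp), e2, e3]
    simp only [pw]
    push_cast
    rfl
  rw [sum_congr rfl h, ← mul_sum, norm_mul]
  have : ‖(ZMod.stdAddChar ((pol (r + 2) b m : ℤ) : ZMod M) : ℂ)‖ = 1 := by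
    rw [ZMod.stdAddChar_apply]; exact Circle.norm_coe _
  rw [this, one_mul]

lemma weyl_pow {d t M X : ℕ} [NeZero M] (g : ℤ → ℂ) (a : Fin d → ZMod M) :
    ‖∑ x ∈ Icc (1 : ℤ) X, g x * ch (pw d x) a‖ ^ (2 * t) =
    ‖∑ x ∈ Fintype.piFinset (fun _ : Fin t => Icc (1 : ℤ) X), (∏ i, g (x i)) * ch (∑ i, pw d (x i)) a‖ ^ 2 := by
  rw [mul_comm 2 t, pow_mul, ← norm_pow]
  congr 2
  have : (∑ x ∈ Icc (1 : ℤ) X, g x * ch (pw d x) a) ^ t =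
      ∏ _i : Fin t, ∑ x ∈ Icc (1 : ℤ) X, g x * ch (pw d x) a := by simp
  rw [this, prod_univ_sum]
  refine sum_congr rfl fun x _ => ?_
  rw [prod_mul_distrib, ch_sum]

end VMV


namespace VMV
open Finset

lemma pol_mul (k : ℕ) (A : ℕ → ℤ) (h n : ℤ) : pol k (fun i => h * A i) n = h * pol k A n := by
  unfold pol; rw [mul_sum]; exact sum_congr rfl fun i _ => by ring

lemma mean_lower (k M X m L t : ℕ) (hX : 1 ≤ X) (hm : 1 ≤ m) (hL : 1 ≤ L) (A : ℕ → ℤ) {ρ : ℝ} (hρ0 : 0 < ρ)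
    (hρ : ∀ n : ℕ, 1 ≤ n → n ≤ 2 * X → ρ ≤ |(pol k A n : ℝ) / M - round ((pol k A n : ℝ) / M)|)
    (hc : 2 * ((m : ℝ) * L) ≤ (2 * ρ * L) ^ (2 * m)) :
    ∃ h : ℕ, 1 ≤ h ∧ h ≤ m * L ∧ (X : ℝ) * (X / (4 * (m * L))) ^ (2 * t) ≤
      ∑ w ∈ range X, ‖∑ x ∈ Icc (1 : ℤ) X, ee ((pol k (fun i => (h : ℤ) * A i) (w + x) : ℝ) / M)‖ ^ (2 * t) := by
  have hX0 : (0 : ℝ) < X := by exact_mod_cast hX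
  have hmL : (0 : ℝ) < (m : ℝ) * L := by
    have : (0 : ℝ) < m := by exact_mod_cast hm
    have : (0 : ℝ) < L := by exact_mod_cast hL
    positivity
  have h1 : ∀ w ∈ range X, (X : ℝ) / 4 ≤ ∑ h ∈ Icc 1 (m * L),
      ‖∑ x ∈ Icc (1 : ℤ) X, ee ((pol k (fun i => (h : ℤ) * A i) (w + x) : ℝ) / M)‖ := by
    intro w hw
    have hw := mem_range.1 hw
    have := kernel (Icc (1 : ℤ) X) (fun x => (pol k A (w + x) : ℝ) / M) hρ0 (by
      intro x hx
      have hx := mem_Icc.1 hx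
      have e : ((w : ℤ) + x) = ((w + x.toNat : ℕ) : ℤ) := by push_cast; omega
      rw [e]
      exact hρ _ (by omega) (by omega)) m L hm hL hc
    rw [Int.card_Icc] at this
    have e : ((X : ℤ) + 1 - 1).toNat = X := by omega
    rw [e] at this
    refine this.trans (le_of_eq ?_)
    refine sum_congr rfl fun h _ => ?_
    congr 1
    refine sum_congr rfl fun x _ => ?_
    rw [pol_mul]
    congr 1; push_cast; ring
  set F : ℕ → ℕ → ℝ := fun h w => ‖∑ x ∈ Icc (1 : ℤ) X, ee ((pol k (fun i => (h : ℤ) * A i) (w + x) : ℝ) / M)‖ with hF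
  have h2 : ∑ h ∈ Icc 1 (m * L), (X * X / (4 * (m * L)) : ℝ) ≤ ∑ h ∈ Icc 1 (m * L), ∑ w ∈ range X, F h w := by
    rw [sum_comm]
    have := sum_le_sum h1
    refine le_trans (le_of_eq ?_) this
    simp only [sum_const, card_range, Nat.card_Icc, nsmul_eq_mul]
    have : ((m * L + 1 - 1 : ℕ) : ℝ) = m * L := by push_cast [Nat.add_sub_cancel]; ring
    rw [this]
    field_simp
  obtain ⟨h, hh, h3⟩ := exists_le_of_sum_le ⟨1, by
    have : 1 ≤ m * L := Nat.mul_pos hm hL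
    simp only [mem_Icc]; omega⟩ h2
  have hh := mem_Icc.1 hh
  refine ⟨h, hh.1, hh.2, ?_⟩
  change _ ≤ ∑ w ∈ range X, F h w ^ (2 * t)
  rcases Nat.eq_zero_or_pos t with rfl | ht
  · simp
  obtain ⟨n, hn⟩ : ∃ n, 2 * t = n + 1 := ⟨2 * t - 1, by omega⟩
  rw [hn]
  have h5 := pow_sum_div_card_le_sum_pow (s := range X) (f := F h) (fun i _ => norm_nonneg _) n
  refine le_trans ?_ h5
  rw [card_range, le_div_iff₀ (by positivity)]
  calc (X : ℝ) * (X / (4 * (m * L))) ^ (n + 1) * (X : ℝ) ^ n = (X * X / (4 * (m * L))) ^ (n + 1) := by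
        rw [mul_div_assoc, mul_pow]; ring
    _ ≤ _ := by gcongr

end VMV


namespace VMV
open Finset

lemma exists_near {r t N X R D0 : ℕ} (hN : 1 ≤ N) (hX : X ≤ N) (hD : 8 * t + 1 ≤ D0) (b : ℕ → ℤ)
    (hbig : (R : ℝ) * ((D0 : ℝ) ^ (r + 1) * (N : ℝ) ^ ((r + 1) * (r + 2) / 2)) * ((2 ^ (r + 1)) ^ 2 * Js (r + 1) t (Icc 1 (X : ℤ))) <
      ∑ w ∈ range X, ‖∑ x ∈ Icc (1 : ℤ) X, ee ((pol (r + 2) b (w + x) : ℝ) / ((D0 * N ^ (r + 3) : ℕ) : ℝ))‖ ^ (2 * t)) :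
    ∃ s : Finset ℕ, s ⊆ range X ∧ R + 1 ≤ s.card ∧ ∀ m ∈ s, ∀ m' ∈ s, ∀ j, 1 ≤ j → j < r + 2 →
      Nr (D0 * N ^ (r + 3)) ((N : ℤ) ^ (r + 2 + 1 - j)) (gam (r + 2) b j m - gam (r + 2) b j m') := by
  by_contra hcon
  push Not at hcon
  apply absurd hbig
  rw [not_lt]
  have hMpos : 0 < D0 * N ^ (r + 3) := Nat.mul_pos (by omega) (pow_pos (by omega) _)
  set M := D0 * N ^ (r + 3) with hMdef
  haveI : NeZero M := ⟨hMpos.ne'⟩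
  have hkey : ∀ j, j ≤ r + 2 → N ^ (r + 2 - j) * (t * X ^ (j + 1)) ≤ t * N ^ (r + 3) := by
    intro j hj
    calc N ^ (r + 2 - j) * (t * X ^ (j + 1)) ≤ N ^ (r + 2 - j) * (t * N ^ (j + 1)) := by gcongr
      _ = t * N ^ ((r + 2 - j) + (j + 1)) := by rw [pow_add]; ring
      _ = t * N ^ (r + 3) := by congr 2; omega
  have hNp : 0 < N ^ (r + 3) := pow_pos (by omega) _
  have hMt : 8 * (t * N ^ (r + 3)) + N ^ (r + 3) ≤ M := by
    calc _ = (8 * t + 1) * N ^ (r + 3) := by ring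
      _ ≤ M := Nat.mul_le_mul_right _ hD
  have hls := large_sieve (d := r + 1) (M := M) (t := t) (X := X) (R := R) ?_ (range X)
    (fun w j => ((gam (r + 2) b ((j : ℕ) + 1) w : ℤ) : ZMod M))
    (fun x => ∏ i, (ZMod.stdAddChar ((b (r + 2) * (x i) ^ (r + 2) : ℤ) : ZMod M) : ℂ)) ?_
    (fun j => N ^ (r + 2 - (j : ℕ))) ?_ ?_ ?_ ?_
  · have e1 : (M : ℝ) ^ (r + 1) / ∏ j : Fin (r + 1), ((N ^ (r + 2 - (j : ℕ)) : ℕ) : ℝ) =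
        (D0 : ℝ) ^ (r + 1) * (N : ℝ) ^ ((r + 1) * (r + 2) / 2) := by
      have hN0 : (N : ℝ) ≠ 0 := by
        have : N ≠ 0 := by omega
        exact_mod_cast this
      have a1 : ∏ j : Fin (r + 1), ((N ^ (r + 2 - (j : ℕ)) : ℕ) : ℝ) ≠ 0 := by
        rw [prod_ne_zero_iff]; intro j _; push_cast; positivity
      rw [div_eq_iff a1]
      have a2 : (r + 1) * (r + 2) / 2 = ∑ j : Fin (r + 1), ((j : ℕ) + 1) := by
        rw [Fin.sum_univ_eq_sum_range (fun j => j + 1) (r + 1)]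
        have := Finset.sum_range_id_mul_two (r + 2)
        rw [sum_range_succ'] at this
        simp only [add_zero] at this
        have e : (r + 2) * (r + 2 - 1) = (r + 1) * (r + 2) := by
          rw [show r + 2 - 1 = r + 1 by omega]; ring
        omega
      rw [a2, ← prod_pow_eq_pow_sum, mul_assoc, ← prod_mul_distrib]
      have a3 : ∀ j ∈ (univ : Finset (Fin (r + 1))), (N : ℝ) ^ ((j : ℕ) + 1) * ((N ^ (r + 2 - (j : ℕ)) : ℕ) : ℝ) = (N : ℝ) ^ (r + 3) := by
        intro j _
        push_cast
        rw [← pow_add]; congr 1; have := j.2; omega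
      rw [prod_congr rfl a3, prod_const, card_univ, Fintype.card_fin, hMdef]
      push_cast
      rw [mul_pow]
    rw [e1] at hls
    refine le_trans (le_of_eq ?_) hls
    refine sum_congr rfl fun w _ => ?_
    rw [weyl_shift b w, weyl_pow]
  · calc t * X ^ (r + 1) ≤ t * N ^ (r + 3) := by
          have h1 : X ^ (r + 1) ≤ N ^ (r + 1) := by gcongr
          have h2 : N ^ (r + 1) ≤ N ^ (r + 3) := Nat.pow_le_pow_right hN (by omega)
          gcongr; omega
      _ < M := by omega
  · intro x
    rw [norm_prod]
    refine le_of_eq (prod_eq_one fun i _ => ?_)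
    rw [ZMod.stdAddChar_apply]; exact Circle.norm_coe _
  · intro j; exact pow_pos (by omega) _
  · intro j
    have : N ^ (r + 2 - (j : ℕ)) ≤ N ^ (r + 3) := Nat.pow_le_pow_right hN (by omega)
    omega
  · intro j
    have h1 := hkey j (by have := j.2; omega)
    push_cast
    have h2 : 8 * (N ^ (r + 2 - (j : ℕ)) * (t * X ^ ((j : ℕ) + 1))) ≤ M := by omega
    exact_mod_cast h2
  · intro s' hs' v hv
    by_contra hcard
    obtain ⟨m, hm, m', hm', j, hj1, hj2, hn⟩ := hcon s' hs' (by omega)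
    apply hn
    obtain ⟨θ, hθ, e⟩ := hv m hm
    obtain ⟨θ', hθ', e'⟩ := hv m' hm'
    have hj : j - 1 < r + 1 := by omega
    have q1 := e ⟨j - 1, hj⟩
    have q2 := e' ⟨j - 1, hj⟩
    have q3 := hθ ⟨j - 1, hj⟩
    have q4 := hθ' ⟨j - 1, hj⟩
    have ej : j - 1 + 1 = j := by omega
    have ej' : r + 2 - (j - 1) = r + 2 + 1 - j := by omega
    simp only [ej, ej'] at q1 q2 q3 q4
    generalize θ ⟨j - 1, hj⟩ = T at *
    generalize θ' ⟨j - 1, hj⟩ = T' at *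
    have q5 : (((gam (r + 2) b j m + T) - (gam (r + 2) b j m' + T') : ℤ) : ZMod M) = 0 := by
      push_cast; rw [q1, q2, sub_self]
    rw [ZMod.intCast_zmod_eq_zero_iff_dvd] at q5
    obtain ⟨z, hz⟩ := q5
    refine ⟨z, ?_⟩
    have q3' : (T : ℤ) < (N : ℤ) ^ (r + 2 + 1 - j) := by exact_mod_cast q3
    have q4' : (T' : ℤ) < (N : ℤ) ^ (r + 2 + 1 - j) := by exact_mod_cast q4
    rw [abs_le]
    constructor <;> linarith [Int.natCast_nonneg T, Int.natCast_nonneg T']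

end VMV


namespace VMV
open Finset

lemma final_n (k C M N R F h T0 q : ℕ) (A : ℕ → ℤ) (hk : 1 ≤ k) (hN : 1 ≤ N) (hq1 : 1 ≤ q) (hq : R * q ≤ F * N) (hR0 : 1 ≤ R)
    (hz : ∀ i, 2 ≤ i → i ≤ k → ∃ z : ℤ, (R : ℤ) * |(q : ℤ) * ((h : ℤ) * A i) - M * z| ≤ C * (N : ℤ) ^ (k + 2 - i))
    (hM : N ^ (k + 1) ≤ M) (hh : 1 ≤ h) (hT : 1 ≤ T0) (hR : F * h * T0 ≤ R)
    (hR2 : k * (C * F * h * T0 ^ 2) * T0 ≤ R ^ 2) :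
    ∃ n : ℕ, 1 ≤ n ∧ n ≤ N ∧ |(pol k A n : ℝ) / M - round ((pol k A n : ℝ) / M)| ≤ 2 / T0 := by
  obtain ⟨T, hT1, hT2, hT3⟩ := Real.exists_nat_abs_mul_sub_round_le ((A 1 : ℝ) * q * h / M) (n := T0) hT
  set n := q * h * T with hn
  have hN0 : (0 : ℝ) < N := by exact_mod_cast hN
  have hR0' : (0 : ℝ) < R := by exact_mod_cast hR0
  have hT0' : (0 : ℝ) < T0 := by exact_mod_cast hT
  have hM' : (N : ℝ) ^ (k + 1) ≤ M := by exact_mod_cast hM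
  have hM0 : (0 : ℝ) < M := lt_of_lt_of_le (by positivity) hM'
  have hn1 : 1 ≤ n := Nat.mul_pos (Nat.mul_pos hq1 hh) hT1
  have hn2 : R * n ≤ F * h * T * N := by
    calc R * n = R * q * (h * T) := by rw [hn]; ring
      _ ≤ F * N * (h * T) := Nat.mul_le_mul_right _ hq
      _ = _ := by ring
  have hnN : n ≤ N := by
    have : F * h * T * N ≤ R * N := by
      refine Nat.mul_le_mul_right _ (le_trans ?_ hR)
      exact Nat.mul_le_mul_left _ hT2
    exact Nat.le_of_mul_le_mul_left (hn2.trans this) hR0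
  refine ⟨n, hn1, hnN, ?_⟩
  -- choose integers
  have hz' : ∀ i, ∃ z : ℤ, 2 ≤ i → i ≤ k → (R : ℤ) * |(q : ℤ) * ((h : ℤ) * A i) - M * z| ≤ C * (N : ℤ) ^ (k + 2 - i) := by
    intro i
    by_cases hi : 2 ≤ i ∧ i ≤ k
    · obtain ⟨z, hz⟩ := hz i hi.1 hi.2
      exact ⟨z, fun _ _ => hz⟩
    · exact ⟨0, fun h1 h2 => absurd ⟨h1, h2⟩ hi⟩
  choose z hzz using hz'
  have hterm : ∀ i ∈ Icc 2 k, |(A i : ℝ) * (n : ℝ) ^ i / M - ((z i * (q * h : ℤ) ^ (i - 1) * T ^ i : ℤ) : ℝ)| ≤ C * F * h * T0 ^ 2 / R ^ 2 := by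
    intro i hi
    have hi := mem_Icc.1 hi
    obtain ⟨e, rfl⟩ : ∃ e, i = e + 2 := ⟨i - 2, by omega⟩
    have h1 := hzz (e + 2) hi.1 hi.2
    have h1' : (R : ℝ) * |(q : ℝ) * (h * A (e + 2)) - M * z (e + 2)| ≤ C * (N : ℝ) ^ (k - e) := by
      have e0 : k + 2 - (e + 2) = k - e := by omega
      rw [e0] at h1
      exact_mod_cast h1
    have e1 : (A (e + 2) : ℝ) * (n : ℝ) ^ (e + 2) / M - ((z (e + 2) * (q * h : ℤ) ^ (e + 2 - 1) * T ^ (e + 2) : ℤ) : ℝ) =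
        ((q : ℝ) * (h * A (e + 2)) - M * z (e + 2)) * ((n : ℝ) ^ e * n * T) / M := by
      have : e + 2 - 1 = e + 1 := by omega
      rw [this, hn]
      push_cast
      field_simp
      ring
    rw [e1, abs_div, abs_mul, abs_of_pos hM0, abs_of_nonneg (by positivity : (0 : ℝ) ≤ (n : ℝ) ^ e * n * T)]
    rw [div_le_div_iff₀ hM0 (by positivity)]
    have hn2' : (R : ℝ) * n ≤ F * h * T * N := by exact_mod_cast hn2
    have hnN' : (n : ℝ) ≤ N := by exact_mod_cast hnN
    have hT2' : (T : ℝ) ≤ T0 := by exact_mod_cast hT2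
    calc |(q : ℝ) * (h * A (e + 2)) - M * z (e + 2)| * ((n : ℝ) ^ e * n * T) * R ^ 2
        = ((R : ℝ) * |(q : ℝ) * (h * A (e + 2)) - M * z (e + 2)|) * ((n : ℝ) ^ e * (R * n) * T) := by ring
      _ ≤ (C * (N : ℝ) ^ (k - e)) * ((N : ℝ) ^ e * (F * h * T * N) * T) := by gcongr
      _ = C * F * h * T ^ 2 * ((N : ℝ) ^ ((k - e) + e + 1)) := by rw [pow_add, pow_add]; ring
      _ = C * F * h * T ^ 2 * ((N : ℝ) ^ (k + 1)) := by congr 3; omega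
      _ ≤ C * F * h * T0 ^ 2 * M := by gcongr
  set Z : ℤ := round (T * ((A 1 : ℝ) * q * h / M)) + ∑ i ∈ Icc 2 k, z i * (q * h : ℤ) ^ (i - 1) * T ^ i with hZ
  refine (round_le _ Z).trans ?_
  have e2 : (pol k A n : ℝ) / M - Z = (T * ((A 1 : ℝ) * q * h / M) - round (T * ((A 1 : ℝ) * q * h / M))) +
      ∑ i ∈ Icc 2 k, ((A i : ℝ) * (n : ℝ) ^ i / M - ((z i * (q * h : ℤ) ^ (i - 1) * T ^ i : ℤ) : ℝ)) := by
    have e3 : Icc 1 k = insert 1 (Icc 2 k) := by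
      ext a; simp only [mem_Icc, mem_insert]; omega
    rw [hZ]
    unfold pol
    rw [e3, sum_insert (by simp), sum_sub_distrib]
    push_cast
    rw [add_div, sum_div, hn]
    push_cast
    ring
  rw [e2]
  have h5 : |∑ i ∈ Icc 2 k, ((A i : ℝ) * (n : ℝ) ^ i / M - ((z i * (q * h : ℤ) ^ (i - 1) * T ^ i : ℤ) : ℝ))| ≤ 1 / T0 := by
    calc _ ≤ ∑ i ∈ Icc 2 k, |((A i : ℝ) * (n : ℝ) ^ i / M - ((z i * (q * h : ℤ) ^ (i - 1) * T ^ i : ℤ) : ℝ))| := abs_sum_le_sum_abs _ _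
      _ ≤ ∑ i ∈ Icc 2 k, (C * F * h * T0 ^ 2 / R ^ 2 : ℝ) := sum_le_sum hterm
      _ = ((k + 1 - 2 : ℕ) : ℝ) * (C * F * h * T0 ^ 2 / R ^ 2 : ℝ) := by
          rw [sum_const, Nat.card_Icc, nsmul_eq_mul]
      _ ≤ k * (C * F * h * T0 ^ 2 / R ^ 2 : ℝ) := by
          gcongr; omega
      _ ≤ 1 / T0 := by
          rw [← mul_div_assoc, div_le_div_iff₀ (by positivity) hT0', one_mul]
          exact_mod_cast hR2
  have h6 : (1 : ℝ) / (T0 + 1) ≤ 1 / T0 := by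
    apply one_div_le_one_div_of_le hT0'; linarith
  refine (abs_add_le _ _).trans ((add_le_add (hT3.trans h6) h5).trans (le_of_eq ?_))
  ring

end VMV


namespace VMV
open Finset

lemma core (r m : ℕ) (hr : 1 ≤ r) (hm : 1 ≤ m) {Δ : ℝ} (hΔ : 0 < Δ) :
    ∃ D0 : ℕ, ∃ B : ℝ, 1 ≤ D0 ∧ 0 < B ∧ ∀ N L : ℕ, 2 ≤ N → 1 ≤ L → ∀ ρ : ℝ, 0 < ρ →
      2 * ((m : ℝ) * L) ≤ (2 * ρ * L) ^ (2 * m) → 2 / (L : ℝ) < ρ →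
      B * (L : ℝ) ^ (2 * (r * (r + 2)) + 2) * (N : ℝ) ^ Δ < N → ∀ A : ℕ → ℤ,
      ∃ n : ℕ, 1 ≤ n ∧ n ≤ N ∧
        |(pol (r + 2) A n : ℝ) / ((D0 * N ^ (r + 3) : ℕ) : ℝ) - round ((pol (r + 2) A n : ℝ) / ((D0 * N ^ (r + 3) : ℕ) : ℝ))| < ρ := by
  obtain ⟨C, hC⟩ := near (r + 2)
  obtain ⟨CJ, hCJ1, hCJ⟩ := Adm_all (r := r) hr hΔ
  set t := r * (r + 2) with ht
  set F := (r + 2).factorial ^ (r + 2) with hF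
  have hF1 : 1 ≤ F := pow_pos (Nat.factorial_pos _) _
  set G := F * m * ((r + 2) * C + 1) with hG
  have hG1 : 1 ≤ G := Nat.mul_pos (Nat.mul_pos hF1 hm) (by omega)
  set D0 := 8 * t + 2 * C + 1 with hD0
  set B : ℝ := G * (D0 : ℝ) ^ (r + 1) * (2 ^ (r + 1)) ^ 2 * CJ * (4 ^ (2 * t + 1) * (4 * m) ^ (2 * t)) with hB
  have hm0 : (0 : ℝ) < m := by exact_mod_cast hm
  have hG0 : (0 : ℝ) < G := by exact_mod_cast hG1
  have hD00 : (0 : ℝ) < D0 := by rw [hD0]; positivity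
  refine ⟨D0, B, by omega, by positivity, ?_⟩
  intro N L hN hL ρ hρ hc hLρ hsz A
  have hL0 : (0 : ℝ) < L := by exact_mod_cast hL
  have hN0 : (0 : ℝ) < N := by have : 0 < N := by omega
                               exact_mod_cast this
  by_contra hcon
  push Not at hcon
  set M := D0 * N ^ (r + 3) with hM
  set X := N / 2 with hX
  have hX1 : 1 ≤ X := by omega
  have hX4 : (N : ℝ) / 4 ≤ X := by
    have : N ≤ 4 * X := by omega
    have : (N : ℝ) ≤ 4 * X := by exact_mod_cast this
    linarith
  have hXN : X ≤ N := by omega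
  obtain ⟨h, hh1, hh2, hlow⟩ := mean_lower (r + 2) M X m L t hX1 hm hL A hρ
    (fun n h1 h2 => hcon n h1 (by omega)) hc
  set R := G * L ^ 2 with hR
  have hR1 : 1 ≤ R := Nat.mul_pos hG1 (pow_pos hL _)
  have hJ : (Js (r + 1) t (Icc 1 (X : ℤ)) : ℝ) ≤ CJ * (N : ℝ) ^ (kap r + Δ) := by
    refine (hCJ X hX1).trans ?_
    have : 0 ≤ kap r + Δ := by
      unfold kap
      have : (1 : ℝ) ≤ r := by exact_mod_cast hr
      have : 0 ≤ ((r : ℝ) + 2) * (3 * r - 1) / 2 := by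
        apply div_nonneg _ (by norm_num)
        apply mul_nonneg <;> linarith
      linarith
    gcongr
  have hpow : (N : ℝ) ^ ((r + 1) * (r + 2) / 2) * (N : ℝ) ^ (kap r + Δ) = (N : ℝ) ^ (2 * t) * (N : ℝ) ^ Δ := by
    rw [← Real.rpow_natCast, ← Real.rpow_natCast, ← Real.rpow_add hN0, ← Real.rpow_add hN0]
    congr 1
    have h1 := kap_add r
    have h2 : (((r + 1) * (r + 2) / 2 : ℕ) : ℝ) = ((r : ℝ) + 1) * (r + 2) / 2 := by
      rw [Nat.cast_div (by exact (Nat.even_mul_succ_self (r + 1)).two_dvd) (by norm_num)]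
      push_cast; ring
    rw [h2, ← h1]; ring
  obtain ⟨s, hsX, hsc, hsn⟩ := exists_near (r := r) (t := t) (N := N) (X := X) (R := R) (D0 := D0) (by omega) hXN (by omega)
    (fun i => (h : ℤ) * A i) (by
      refine lt_of_lt_of_le ?_ hlow
      have e1 : (R : ℝ) = G * (L : ℝ) ^ 2 := by rw [hR]; push_cast; ring
      calc (R : ℝ) * ((D0 : ℝ) ^ (r + 1) * (N : ℝ) ^ ((r + 1) * (r + 2) / 2)) * ((2 ^ (r + 1)) ^ 2 * Js (r + 1) t (Icc 1 (X : ℤ)))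
          ≤ (R : ℝ) * ((D0 : ℝ) ^ (r + 1) * (N : ℝ) ^ ((r + 1) * (r + 2) / 2)) * ((2 ^ (r + 1)) ^ 2 * (CJ * (N : ℝ) ^ (kap r + Δ))) := by gcongr
        _ = (R : ℝ) * (D0 : ℝ) ^ (r + 1) * (2 ^ (r + 1)) ^ 2 * CJ * ((N : ℝ) ^ ((r + 1) * (r + 2) / 2) * (N : ℝ) ^ (kap r + Δ)) := by ring
        _ = (B * (L : ℝ) ^ (2 * t + 2) * (N : ℝ) ^ Δ) * ((N : ℝ) ^ (2 * t) / (4 ^ (2 * t + 1) * (4 * (m * L)) ^ (2 * t))) := by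
            rw [hpow, e1, hB, pow_add (L : ℝ), mul_pow 4 ((m : ℝ) * L), mul_pow (m : ℝ) L, mul_pow 4 (m : ℝ)]
            field_simp
        _ < (N : ℝ) * ((N : ℝ) ^ (2 * t) / (4 ^ (2 * t + 1) * (4 * (m * L)) ^ (2 * t))) := by gcongr
        _ = (N / 4 : ℝ) * (N / 4 / (4 * (m * L))) ^ (2 * t) := by
            rw [div_pow, div_pow, pow_succ]; field_simp
        _ ≤ (X : ℝ) * (X / (4 * (m * L))) ^ (2 * t) := by gcongr)
  have hnear : ∀ a ∈ s, ∀ a' ∈ s, ∀ i, 2 ≤ i → i ≤ r + 2 →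
      Nr M (C * (N : ℤ) ^ (r + 2 + 2 - i)) (((r + 2).factorial : ℤ) ^ (r + 2) * (((a : ℤ) - a') * ((fun i => (h : ℤ) * A i) i))) := by
    intro a ha a' ha' i hi1 hi2
    have h1 := mem_range.1 (hsX ha)
    have h2 := mem_range.1 (hsX ha')
    exact hC M N _ a a' (by omega) (by omega) (hsn a ha a' ha') i hi1 hi2
  have hNp : 0 < N ^ (r + 3) := pow_pos (by omega) _
  obtain ⟨q, hq1, hq2, hq3⟩ := good_q (r + 2) C M N (R + 1) (fun i => (h : ℤ) * A i) s
    (fun a ha => by have := mem_range.1 (hsX ha); omega) (by omega) hsc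
    (by
      rw [hM]
      exact Nat.mul_lt_mul_of_pos_right (by omega) hNp) (by omega) hnear
  rw [Nat.add_sub_cancel] at hq2 hq3
  obtain ⟨n, hn1, hn2, hn3⟩ := final_n (r + 2) C M N R F h L q A (by omega) (by omega) hq1 hq2 hR1 hq3
    (by rw [hM]; exact Nat.le_mul_of_pos_left _ (by omega)) hh1 hL
    (by
      calc F * h * L ≤ F * (m * L) * L := by gcongr
        _ = F * m * 1 * L ^ 2 := by ring
        _ ≤ R := by rw [hR, hG]; gcongr; omega)
    (by
      calc (r + 2) * (C * F * h * L ^ 2) * L ≤ (r + 2) * (C * F * (m * L) * L ^ 2) * L := by gcongr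
        _ = (F * m * ((r + 2) * C)) * L ^ 4 := by ring
        _ ≤ G * L ^ 4 := by rw [hG]; gcongr; omega
        _ ≤ G * G * L ^ 4 := by gcongr; exact Nat.le_mul_of_pos_left _ hG1
        _ = R ^ 2 := by rw [hR]; ring)
  have := hcon n hn1 hn2
  linarith

end VMV


namespace VMV
open Finset

lemma sum_Fin_Icc (k : ℕ) (α : Fin k → ℝ) : ∃ a : ℕ → ℝ, ∀ n : ℝ,
    ∑ j : Fin k, α j * n ^ ((j : ℕ) + 1) = ∑ i ∈ Icc 1 k, a i * n ^ i := by
  refine ⟨fun i => if h : i - 1 < k then α ⟨i - 1, h⟩ else 0, fun n => ?_⟩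
  set a : ℕ → ℝ := fun i => if h : i - 1 < k then α ⟨i - 1, h⟩ else 0 with ha
  have : ∀ j ∈ (univ : Finset (Fin k)), α j * n ^ ((j : ℕ) + 1) = a ((j : ℕ) + 1) * n ^ ((j : ℕ) + 1) := by
    intro j _
    simp [ha]
  rw [sum_congr rfl this, Fin.sum_univ_eq_sum_range (fun j => a (j + 1) * n ^ (j + 1)) k]
  refine sum_bij' (fun a _ => a + 1) (fun a _ => a - 1) ?_ ?_ ?_ ?_ ?_
  · intro a ha; simp only [mem_range] at ha; simp only [mem_Icc]; omega
  · intro a ha; simp only [mem_Icc] at ha; simp only [mem_range]; omega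
  · intro a ha; simp
  · intro a ha; simp only [mem_Icc] at ha; omega
  · intro a ha; rfl

lemma approx (k M N n : ℕ) (hN : 1 ≤ N) (hn : n ≤ N) (hM : N ^ (k + 1) ≤ M) (a : ℕ → ℝ) :
    |∑ i ∈ Icc 1 k, a i * (n : ℝ) ^ i - (pol k (fun i => round (a i * M)) n : ℝ) / M| ≤ k / (2 * N) := by
  have hN0 : (0 : ℝ) < N := by exact_mod_cast hN
  have hN1 : (1 : ℝ) ≤ N := by exact_mod_cast hN
  have hn' : (n : ℝ) ≤ N := by exact_mod_cast hn
  have hM' : (N : ℝ) ^ (k + 1) ≤ M := by exact_mod_cast hM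
  have hM0 : (0 : ℝ) < M := lt_of_lt_of_le (by positivity) hM'
  unfold pol
  push_cast
  rw [sum_div, ← sum_sub_distrib]
  refine (abs_sum_le_sum_abs _ _).trans ?_
  have : ∀ i ∈ Icc 1 k, |a i * (n : ℝ) ^ i - (round (a i * M) : ℝ) * (n : ℝ) ^ i / M| ≤ 1 / (2 * N) := by
    intro i hi
    have hi := mem_Icc.1 hi
    have e : a i * (n : ℝ) ^ i - (round (a i * M) : ℝ) * (n : ℝ) ^ i / M = (a i * M - round (a i * M)) * (n : ℝ) ^ i / M := by
      field_simp
    rw [e, abs_div, abs_mul, abs_of_pos hM0, abs_of_nonneg (by positivity : (0 : ℝ) ≤ (n : ℝ) ^ i),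
      div_le_div_iff₀ hM0 (by positivity)]
    have h1 := abs_sub_round (a i * M)
    have h2 : (n : ℝ) ^ i ≤ (N : ℝ) ^ k := (pow_le_pow_left₀ (by positivity) hn' i).trans (pow_le_pow_right₀ hN1 hi.2)
    calc _ ≤ 1 / 2 * (N : ℝ) ^ k * (2 * N) := by gcongr
      _ = (N : ℝ) ^ (k + 1) := by rw [pow_succ]; ring
      _ ≤ 1 * M := by rw [one_mul]; exact hM'
  refine (sum_le_sum this).trans (le_of_eq ?_)
  rw [sum_const, Nat.card_Icc, nsmul_eq_mul, Nat.add_sub_cancel]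
  ring

lemma main_small (r : ℕ) (hr : 1 ≤ r) (τ ε : ℝ) (hτ : τ = 1 / (4 * ((r : ℝ) + 1) * r)) (hε : 0 < ε) (hετ : ε ≤ τ) :
    ∃ N₀ : ℕ, ∀ N : ℕ, N ≥ N₀ → ∀ α : Fin (r + 2) → ℝ,
      ∃ n : ℕ, 1 ≤ n ∧ n ≤ N ∧
        |(∑ j : Fin (r + 2), α j * (n : ℝ) ^ ((j : ℕ) + 1)) -
            (round (∑ j : Fin (r + 2), α j * (n : ℝ) ^ ((j : ℕ) + 1)) : ℝ)| < (N : ℝ) ^ (ε - τ) := by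
  obtain ⟨m, hm⟩ := exists_nat_ge (2 / ε)
  have hm0 : (0 : ℝ) < m := lt_of_lt_of_le (by positivity) hm
  have hm1 : 1 ≤ m := by exact_mod_cast hm0
  have hmε : 2 ≤ m * ε := by rwa [div_le_iff₀ hε] at hm
  obtain ⟨D0, B, hD0, hB, hcore⟩ := core r m hr hm1 hε
  set t := r * (r + 2) with ht
  have hr1 : (1 : ℝ) ≤ r := by exact_mod_cast hr
  have hτ1 : τ ≤ 1 / 8 := by
    rw [hτ]; apply one_div_le_one_div_of_le (by norm_num); nlinarith
  have hτt : τ * (2 * t + 2) ≤ 1 := by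
    rw [hτ, div_mul_eq_mul_div, one_mul, div_le_one (by positivity), ht]
    push_cast; nlinarith
  have ht1 : (1 : ℝ) ≤ t := by
    rw [ht]; push_cast; nlinarith
  set σ := τ - ε / 2 with hσ
  have hσ0 : 0 < σ := by linarith
  have hlim : Filter.Tendsto (fun N : ℕ => (N : ℝ) ^ (ε / 2)) Filter.atTop Filter.atTop :=
    (tendsto_rpow_atTop (by positivity)).comp tendsto_natCast_atTop_atTop
  obtain ⟨N₁, hN₁⟩ := Filter.eventually_atTop.1 (hlim.eventually_gt_atTop (4 + B * 2 ^ (2 * t + 2) + (r + 2)))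
  refine ⟨max N₁ (4 * m + 2), fun N hN α => ?_⟩
  have hNa := hN₁ N (le_trans (le_max_left _ _) hN)
  have hNb : 4 * m + 2 ≤ N := le_trans (le_max_right _ _) hN
  have hB2 : 0 < B * 2 ^ (2 * t + 2) := by positivity
  have hN1 : (1 : ℝ) ≤ N := by
    have : 1 ≤ N := by omega
    exact_mod_cast this
  have hN0 : (0 : ℝ) < N := by linarith
  have hN4m : 4 * (m : ℝ) ≤ N := by
    have : 4 * m ≤ N := by omega
    exact_mod_cast this
  set P := (N : ℝ) ^ (ε / 2) with hP
  have hP0 : 0 < P := by positivity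
  set S := (N : ℝ) ^ σ with hS
  have hS1 : 1 ≤ S := Real.one_le_rpow hN1 hσ0.le
  have hS0 : 0 < S := by linarith
  set ρ0 := (N : ℝ) ^ (ε - τ) with hρ0
  have hρS : ρ0 * S = P := by
    rw [hρ0, hS, ← Real.rpow_add hN0]; congr 1; rw [hσ]; ring
  have hρ00 : 0 < ρ0 := by positivity
  set L := ⌈S⌉₊ with hL
  have hLS : S ≤ L := Nat.le_ceil _
  have hL2 : (L : ℝ) ≤ 2 * S := by
    have := Nat.ceil_lt_add_one hS0.le
    linarith
  have hL0 : (0 : ℝ) < L := by linarith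
  have hL1 : 1 ≤ L := by exact_mod_cast hL0
  obtain ⟨a, ha⟩ := sum_Fin_Icc (r + 2) α
  obtain ⟨n, hn1, hn2, hn3⟩ := hcore N L (by omega) hL1 (ρ0 / 2) (by positivity)
    (by
      have h1 : P ≤ 2 * (ρ0 / 2) * L := by
        rw [← hρS]
        have : 2 * (ρ0 / 2) = ρ0 := by ring
        rw [this]; gcongr
      calc 2 * ((m : ℝ) * L) ≤ 2 * (m * (2 * S)) := by gcongr
        _ = (4 * m) * S := by ring
        _ ≤ (N : ℝ) ^ (1 : ℝ) * (N : ℝ) ^ σ := by rw [Real.rpow_one]; gcongr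
        _ = (N : ℝ) ^ (1 + σ) := by rw [Real.rpow_add hN0]
        _ ≤ (N : ℝ) ^ (ε / 2 * ((2 * m : ℕ) : ℝ)) := by
            apply Real.rpow_le_rpow_of_exponent_le hN1
            push_cast; linarith
        _ = P ^ (2 * m) := by rw [Real.rpow_mul hN0.le, Real.rpow_natCast]
        _ ≤ _ := by gcongr)
    (by
      rw [div_lt_iff₀ hL0]
      have : P ≤ ρ0 * L := by rw [← hρS]; gcongr
      linarith)
    (by
      have e1 : S ^ (2 * t + 2) = (N : ℝ) ^ (σ * (2 * t + 2)) := by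
        rw [hS, ← Real.rpow_natCast, ← Real.rpow_mul hN0.le]; push_cast; rfl
      calc B * (L : ℝ) ^ (2 * t + 2) * (N : ℝ) ^ ε ≤ B * (2 * S) ^ (2 * t + 2) * (N : ℝ) ^ ε := by gcongr
        _ = (B * 2 ^ (2 * t + 2)) * ((N : ℝ) ^ (σ * (2 * t + 2)) * (N : ℝ) ^ ε) := by rw [mul_pow, e1]; ring
        _ < P * ((N : ℝ) ^ (σ * (2 * t + 2)) * (N : ℝ) ^ ε) := by
            apply mul_lt_mul_of_pos_right _ (by positivity)
            linarith
        _ = (N : ℝ) ^ (ε / 2 + (σ * (2 * t + 2) + ε)) := by rw [hP, Real.rpow_add hN0, Real.rpow_add hN0]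
        _ ≤ (N : ℝ) ^ (1 : ℝ) := by
            apply Real.rpow_le_rpow_of_exponent_le hN1
            rw [hσ]; nlinarith
        _ = N := Real.rpow_one _)
    (fun i => round (a i * ((D0 * N ^ (r + 3) : ℕ) : ℝ)))
  refine ⟨n, hn1, hn2, ?_⟩
  rw [ha]
  have hap := approx (r + 2) (D0 * N ^ (r + 3)) N n (by omega) hn2 (Nat.le_mul_of_pos_left _ hD0) a
  set y := ∑ i ∈ Icc 1 (r + 2), a i * (n : ℝ) ^ i
  set y' := (pol (r + 2) (fun i => round (a i * ((D0 * N ^ (r + 3) : ℕ) : ℝ))) n : ℝ) / ((D0 * N ^ (r + 3) : ℕ) : ℝ)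
  have h7 : ((r + 2 : ℕ) : ℝ) / (2 * N) ≤ ρ0 / 2 := by
    rw [div_le_div_iff₀ (by positivity) (by norm_num)]
    have : P ≤ ρ0 * N := by
      calc P ≤ (N : ℝ) ^ ((ε - τ) + 1) := by
            apply Real.rpow_le_rpow_of_exponent_le hN1; linarith
        _ = ρ0 * N := by rw [Real.rpow_add hN0, Real.rpow_one]
    push_cast
    linarith
  calc |y - round y| ≤ |y - round y'| := round_le _ _
    _ = |(y - y') + (y' - round y')| := by congr 1; ring
    _ ≤ |y - y'| + |y' - round y'| := abs_add_le _ _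
    _ < ρ0 := by linarith

end VMV

theorem polynomial_equidistribution (k : ℕ) (hk : 3 ≤ k) (ε : ℝ) (hε : ε > 0) :
    ∃ N₀ : ℕ, ∀ N : ℕ, N ≥ N₀ → ∀ α : Fin k → ℝ,
      ∃ n : ℕ, 1 ≤ n ∧ n ≤ N ∧
        |(∑ j : Fin k, α j * (n : ℝ) ^ ((j : ℕ) + 1)) -
            (round (∑ j : Fin k, α j * (n : ℝ) ^ ((j : ℕ) + 1)) : ℝ)| <
          (N : ℝ) ^ (ε - 1 / (4 * ((k : ℝ) - 1) * ((k : ℝ) - 2))) := by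
  obtain ⟨r, rfl⟩ : ∃ r, k = r + 2 := ⟨k - 2, by omega⟩
  have hr : 1 ≤ r := by omega
  have hr0 : (0 : ℝ) < r := by exact_mod_cast hr
  have e : (1 : ℝ) / (4 * (((r + 2 : ℕ) : ℝ) - 1) * (((r + 2 : ℕ) : ℝ) - 2)) = 1 / (4 * ((r : ℝ) + 1) * r) := by
    push_cast; congr 1; ring
  rw [e]
  set τ : ℝ := 1 / (4 * ((r : ℝ) + 1) * r) with hτ
  have hτ0 : 0 < τ := by positivity
  obtain ⟨N₀, h⟩ := VMV.main_small r hr τ (min ε τ) hτ (lt_min hε hτ0) (min_le_right _ _)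
  refine ⟨max N₀ 1, fun N hN α => ?_⟩
  obtain ⟨n, h1, h2, h3⟩ := h N (le_trans (le_max_left _ _) hN) α
  refine ⟨n, h1, h2, lt_of_lt_of_le h3 ?_⟩
  have hN1 : (1 : ℝ) ≤ N := by
    have : 1 ≤ N := le_trans (le_max_right _ _) hN
    exact_mod_cast this
  apply Real.rpow_le_rpow_of_exponent_le hN1
  have := min_le_left ε τ
  linarith
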